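/- Let n ≥ 2, 0 ≤ q ≤ n, a = 0 (no pressure, p ≡ 0), s, k positive integers, 0 < λ < λ' < 1, δ > n/2, μ > 0, T > 0. Suppose the data pair (f⁽⁰⁾, u₀⁽⁰⁾) ∈ F^{k,s(s,λ,λ',δ)}_{T,Λ^q} × C^{2s+k+1,λ,δ}_{Λ^q} admits a solution u⁽⁰⁾ ∈ F^{k,s(s,λ,λ',δ)}_{T,Λ^q} of the problem ∂_t u − μΔu + N_q(u) = f on ℝⁿ×(0,T), u(·,0) = u₀. Then there exists ε > 0 such that for all data (f, u₀) in the same spaces with ‖f − f⁽⁰⁾‖_{F^{k,s(s,λ,λ',δ)}_{T,Λ^q}} + ‖u₀ − u₀⁽⁰⁾‖_{C^{2s+k+1,λ,δ}_{Λ^q}} < ε, the problem has a unique solution u ∈ F^{k,s(s,λ,λ',δ)}_{T,Λ^q}. -/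

import Mathlib

open scoped BigOperators ENNReal Classical
open Filter MeasureTheory

noncomputable section

namespace NSdeRham

/-- Euclidean space `ℝⁿ`. -/
abbrev Spc (n : ℕ) := EuclideanSpace ℝ (Fin n)

variable {n : ℕ}

/-- The weight `w(x) = √(1+|x|²)`. -/
def wt (x : Spc n) : ℝ := Real.sqrt (1 + ‖x‖ ^ 2)

/-- `w(x,y) = max (w x) (w y)`. -/
def wt2 (x y : Spc n) : ℝ := max (wt x) (wt y)

/-- Partial derivative in the `i`-th coordinate direction. -/
def pd (i : Fin n) (f : Spc n → ℝ) (x : Spc n) : ℝ :=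
  fderiv ℝ f x (EuclideanSpace.single i 1)

/-- The Laplace operator `Δ = ∑ ∂²/∂xᵢ²`. -/
def lap (f : Spc n → ℝ) (x : Spc n) : ℝ := ∑ i : Fin n, pd i (pd i f) x

section enorms

variable {F : Type*} [NormedAddCommGroup F]

/-- Weighted sup-"norm" `sup_x w(x)^δ ‖g x‖` (with values in `ℝ≥0∞`). -/
def eWSup (δ : ℝ) (g : Spc n → F) : ℝ≥0∞ :=
  ⨆ x : Spc n, ENNReal.ofReal (wt x ^ δ * ‖g x‖)

/-- Weighted Hölder seminorm `⟨g⟩_{λ,δ}`. -/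
def eWHold (lam δ : ℝ) (g : Spc n → F) : ℝ≥0∞ :=
  ⨆ (x : Spc n) (y : Spc n) (_ : x ≠ y ∧ ‖x - y‖ ≤ ‖x‖ / 2),
    ENNReal.ofReal (wt2 x y ^ (δ + lam) * ‖g x - g y‖ / ‖x - y‖ ^ lam)

/-- The ordinary Hölder norm on the (closed) unit ball around the origin. -/
def eOHold (lam : ℝ) (g : Spc n → F) : ℝ≥0∞ :=
  (⨆ (x : Spc n) (_ : ‖x‖ ≤ 1), ENNReal.ofReal ‖g x‖) +
    ⨆ (x : Spc n) (y : Spc n) (_ : ‖x‖ ≤ 1 ∧ ‖y‖ ≤ 1 ∧ x ≠ y),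
      ENNReal.ofReal (‖g x - g y‖ / ‖x - y‖ ^ lam)

/-- The norm of `C^{0,λ,δ}`; for `λ = 0` this is just the weighted sup-norm. -/
def eHol0 (lam δ : ℝ) (g : Spc n → F) : ℝ≥0∞ :=
  if lam = 0 then eWSup δ g else eOHold lam g + eWSup δ g + eWHold lam δ g

/-- The norm of the base anisotropic space `C^{𝐬(0,λ,δ)}_T`. -/
def eAniso0 (T lam δ : ℝ) (v : ℝ → Spc n → F) : ℝ≥0∞ :=
  (⨆ t : Set.Icc (0 : ℝ) T, eHol0 lam δ (v t)) +
    if lam = 0 then 0 else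
      ⨆ (t₁ : Set.Icc (0 : ℝ) T) (t₂ : Set.Icc (0 : ℝ) T) (_ : (t₁ : ℝ) ≠ (t₂ : ℝ))
        (x : Spc n),
        ENNReal.ofReal (wt x ^ δ * ‖v t₁ x - v t₂ x‖ / |(t₁ : ℝ) - (t₂ : ℝ)| ^ (lam / 2))

end enorms

/-- The norm of the static weighted Hölder space `C^{s,λ,δ}`. -/
def eHolS (s : ℕ) (lam δ : ℝ) (g : Spc n → ℝ) : ℝ≥0∞ :=
  ∑ m ∈ Finset.range (s + 1), eHol0 lam (δ + m) (iteratedFDeriv ℝ m g)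

/-- Membership in the static weighted Hölder space `C^{s,λ,δ}`. -/
def HolSMem (s : ℕ) (lam δ : ℝ) (g : Spc n → ℝ) : Prop :=
  ContDiff ℝ s g ∧ eHolS s lam δ g ≠ ⊤

/-- Time derivative of order `j` (within `[0,T]`). -/
def tDeriv (T : ℝ) (j : ℕ) (u : ℝ → Spc n → ℝ) (t : ℝ) (x : Spc n) : ℝ :=
  iteratedDerivWithin j (fun τ => u τ x) (Set.Icc 0 T) t

/-- Mixed derivative `∂_x^m ∂_t^j`. -/
def mixDeriv (T : ℝ) (m j : ℕ) (u : ℝ → Spc n → ℝ) (t : ℝ) :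
    Spc n → ContinuousMultilinearMap ℝ (fun _ : Fin m => Spc n) ℝ :=
  iteratedFDeriv ℝ m (fun x => tDeriv T j u t x)

/-- The norm of the anisotropic weighted parabolic Hölder space `C^{k,𝐬(s,λ,δ)}_T`. -/
def eAnisoKS (T : ℝ) (k s : ℕ) (lam δ : ℝ) (u : ℝ → Spc n → ℝ) : ℝ≥0∞ :=
  ∑ b ∈ Finset.range (k + 1), ∑ m ∈ Finset.range (2 * s + 1), ∑ j ∈ Finset.range (s + 1),
    if m + 2 * j ≤ 2 * s then eAniso0 T lam (δ + b + m) (mixDeriv T (b + m) j u) else 0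

/-- Regularity required of members of `C^{k,𝐬(s,λ,δ)}_T`. -/
def AnisoReg (T : ℝ) (k s : ℕ) (u : ℝ → Spc n → ℝ) : Prop :=
  (∀ x : Spc n, ContDiffOn ℝ s (fun t => u t x) (Set.Icc 0 T)) ∧
  (∀ j : ℕ, j ≤ s → ∀ t ∈ Set.Icc (0 : ℝ) T,
    ContDiff ℝ (2 * (s - j) + k) (fun x => tDeriv T j u t x)) ∧
  (∀ j m : ℕ, j ≤ s → m + 2 * j ≤ 2 * s + k →
    Continuous fun p : Set.Icc (0 : ℝ) T × Spc n => mixDeriv T m j u p.1 p.2)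

/-- Membership in `C^{k,𝐬(s,λ,δ)}_T`. -/
def AnisoMem (T : ℝ) (k s : ℕ) (lam δ : ℝ) (u : ℝ → Spc n → ℝ) : Prop :=
  AnisoReg T k s u ∧ eAnisoKS T k s lam δ u ≠ ⊤

/-- The norm of `𝓕^{k,𝐬(s,λ,λ',δ)}_T = C^{k+1,𝐬(s,λ,δ)}_T ∩ C^{k,𝐬(s,λ',δ)}_T`. -/
def eFn (T : ℝ) (k s : ℕ) (lam lam' δ : ℝ) (u : ℝ → Spc n → ℝ) : ℝ≥0∞ :=
  eAnisoKS T (k + 1) s lam δ u + eAnisoKS T k s lam' δ u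

/-- Membership in `𝓕^{k,𝐬(s,λ,λ',δ)}_T`. -/
def FMem (T : ℝ) (k s : ℕ) (lam lam' δ : ℝ) (u : ℝ → Spc n → ℝ) : Prop :=
  AnisoReg T (k + 1) s u ∧ eFn T k s lam lam' δ u ≠ ⊤

/-- Index set of a basis of `Λ^q`. -/
abbrev Idx (n q : ℕ) := {I : Finset (Fin n) // I.card = q}

/-- Static differential `q`-forms: coefficient functions. -/
abbrev FormS (n q : ℕ) := Idx n q → Spc n → ℝ

/-- Time-dependent differential `q`-forms. -/
abbrev FormT (n q : ℕ) := Idx n q → ℝ → Spc n → ℝ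

/-- Fibre of the bundle `Λ^q`. -/
abbrev Fib (n q : ℕ) := Idx n q → ℝ

/-- The exterior derivative `d_q` on static `q`-forms. -/
def dS {q : ℕ} (u : FormS n q) : FormS n (q + 1) := fun J x =>
  ∑ i : Fin n,
    if h : i ∈ J.1 then
      (-1 : ℝ) ^ (J.1.filter fun j => j < i).card *
        pd i (u ⟨J.1.erase i, by simp [Finset.card_erase_of_mem h, J.2]⟩) x
    else 0

/-- The exterior derivative `d_{q-1}` mapping `(q-1)`-forms to `q`-forms. -/
def dLowS {q : ℕ} (p : FormS n (q - 1)) : FormS n q := fun J x =>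
  ∑ i : Fin n,
    if h : i ∈ J.1 ∧ (J.1.erase i).card = q - 1 then
      (-1 : ℝ) ^ (J.1.filter fun j => j < i).card * pd i (p ⟨J.1.erase i, h.2⟩) x
    else 0

/-- The formal adjoint `d_{q-1}^*` mapping `q`-forms to `(q-1)`-forms. -/
def coDS {q : ℕ} (u : FormS n q) : FormS n (q - 1) := fun K x =>
  -∑ i : Fin n,
    if h : i ∉ K.1 ∧ (insert i K.1).card = q then
      (-1 : ℝ) ^ (K.1.filter fun j => j < i).card * pd i (u ⟨insert i K.1, h.2⟩) x
    else 0

/-- `d_q` on time-dependent forms. -/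
def dT {q : ℕ} (u : FormT n q) : FormT n (q + 1) := fun J t => dS (fun I => u I t) J

/-- `d_{q-1}` on time-dependent forms. -/
def dLowT {q : ℕ} (p : FormT n (q - 1)) : FormT n q := fun J t => dLowS (fun I => p I t) J

/-- `d_{q-1}^*` on time-dependent forms. -/
def coDT {q : ℕ} (u : FormT n q) : FormT n (q - 1) := fun K t => coDS (fun I => u I t) K

/-- Norm of `C^{k,𝐬(s,λ,δ)}_{T,Λ^q}`. -/
def eAnisoKSF {q : ℕ} (T : ℝ) (k s : ℕ) (lam δ : ℝ) (u : FormT n q) : ℝ≥0∞ :=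
  ∑ I : Idx n q, eAnisoKS T k s lam δ (u I)

/-- Membership in `C^{k,𝐬(s,λ,δ)}_{T,Λ^q}`. -/
def CMemF {q : ℕ} (T : ℝ) (k s : ℕ) (lam δ : ℝ) (u : FormT n q) : Prop :=
  (∀ I, AnisoReg T k s (u I)) ∧ eAnisoKSF T k s lam δ u ≠ ⊤

/-- Graph norm of `C^{k,𝐬(s,λ,δ)}_{T,Λ^q,𝒟_{d⊕d*}}`. -/
def eCD {q : ℕ} (T : ℝ) (k s : ℕ) (lam δ : ℝ) (u : FormT n q) : ℝ≥0∞ :=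
  eAnisoKSF T k s lam δ u + eAnisoKSF T k s lam (δ + 1) (dT u) +
    eAnisoKSF T k s lam (δ + 1) (coDT u)

/-- Membership in `C^{k,𝐬(s,λ,δ)}_{T,Λ^q,𝒟_{d⊕d*}}`. -/
def CMemD {q : ℕ} (T : ℝ) (k s : ℕ) (lam δ : ℝ) (u : FormT n q) : Prop :=
  CMemF T k s lam δ u ∧ CMemF T k s lam (δ + 1) (dT u) ∧ CMemF T k s lam (δ + 1) (coDT u)

/-- Norm of `𝓕^{k,𝐬(s,λ,λ',δ)}_{T,Λ^q}`. -/
def eFF {q : ℕ} (T : ℝ) (k s : ℕ) (lam lam' δ : ℝ) (u : FormT n q) : ℝ≥0∞ :=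
  ∑ I : Idx n q, eFn T k s lam lam' δ (u I)

/-- Membership in `𝓕^{k,𝐬(s,λ,λ',δ)}_{T,Λ^q}`. -/
def FMemF {q : ℕ} (T : ℝ) (k s : ℕ) (lam lam' δ : ℝ) (u : FormT n q) : Prop :=
  (∀ I, AnisoReg T (k + 1) s (u I)) ∧ eFF T k s lam lam' δ u ≠ ⊤

/-- Graph norm of `𝓕^{k,𝐬(s,λ,λ',δ)}_{T,Λ^q,𝒟_{d⊕d*}}`. -/
def eFD {q : ℕ} (T : ℝ) (k s : ℕ) (lam lam' δ : ℝ) (u : FormT n q) : ℝ≥0∞ :=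
  eFF T k s lam lam' δ u + eFF T k s lam lam' (δ + 1) (dT u) +
    eFF T k s lam lam' (δ + 1) (coDT u)

/-- Membership in `𝓕^{k,𝐬(s,λ,λ',δ)}_{T,Λ^q,𝒟_{d⊕d*}}`. -/
def FMemD {q : ℕ} (T : ℝ) (k s : ℕ) (lam lam' δ : ℝ) (u : FormT n q) : Prop :=
  FMemF T k s lam lam' δ u ∧ FMemF T k s lam lam' (δ + 1) (dT u) ∧
    FMemF T k s lam lam' (δ + 1) (coDT u)

/-- Norm of the static space `C^{s,λ,δ}_{Λ^q}`. -/
def eHolSF {q : ℕ} (s : ℕ) (lam δ : ℝ) (g : FormS n q) : ℝ≥0∞ :=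
  ∑ I : Idx n q, eHolS s lam δ (g I)

/-- Membership in the static space `C^{s,λ,δ}_{Λ^q}`. -/
def HolMemF {q : ℕ} (s : ℕ) (lam δ : ℝ) (g : FormS n q) : Prop :=
  (∀ I, ContDiff ℝ s (g I)) ∧ eHolSF s lam δ g ≠ ⊤

/-- Equality of time-dependent forms on `ℝⁿ × [0,T]`. -/
def EqOnT {q : ℕ} (T : ℝ) (u v : FormT n q) : Prop :=
  ∀ I, ∀ t ∈ Set.Icc (0 : ℝ) T, ∀ x, u I t x = v I t x

/-- The form `u` is co-closed (`d^* u = 0`) on `ℝⁿ × [0,T]`. -/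
def CoClosed {q : ℕ} (T : ℝ) (u : FormT n q) : Prop :=
  ∀ K, ∀ t ∈ Set.Icc (0 : ℝ) T, ∀ x, coDT u K t x = 0

/-- Type of the bilinear zero order operator `M₁^{(q)}`. -/
abbrev M1Type (n q : ℕ) := (Fib n (q + 1) × Fib n (q - 1)) →ₗ[ℝ] Fib n q →ₗ[ℝ] Fib n q

/-- Type of the bilinear zero order operator `M₂^{(q)}`. -/
abbrev M2Type (n q : ℕ) := Fib n q →ₗ[ℝ] Fib n q →ₗ[ℝ] Fib n (q - 1)

/-- Value of a time-dependent form at a point, as an element of the fibre. -/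
def fib {q : ℕ} (u : FormT n q) (t : ℝ) (x : Spc n) : Fib n q := fun I => u I t x

/-- Value of `(d_q ⊕ d_{q-1}^*) u` at a point. -/
def ddFib {q : ℕ} (u : FormT n q) (t : ℝ) (x : Spc n) : Fib n (q + 1) × Fib n (q - 1) :=
  (fun J => dT u J t x, fun K => coDT u K t x)

/-- The operator `W_q u = M₁((d⊕d^*)u, w) + M₁((d⊕d^*)w, u)`. -/
def Wop {q : ℕ} (M₁ : M1Type n q) (w u : FormT n q) : FormT n q := fun I t x =>
  M₁ (ddFib u t x) (fib w t x) I + M₁ (ddFib w t x) (fib u t x) I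

/-- The symmetric bilinearization `B_q(w,u)` of the nonlinearity. -/
def Bop {q : ℕ} (M₁ : M1Type n q) (M₂ : M2Type n q) (w u : FormT n q) : FormT n q :=
  fun I t x =>
    Wop M₁ w u I t x +
      dLowT (fun K t' x' =>
        M₂ (fib u t' x') (fib w t' x') K + M₂ (fib w t' x') (fib u t' x') K) I t x

/-- The nonlinearity `𝒩_q u = M₁((d⊕d^*)u, u) + d_{q-1} M₂(u,u)`. -/
def Nop {q : ℕ} (M₁ : M1Type n q) (M₂ : M2Type n q) (u : FormT n q) : FormT n q :=
  fun I t x =>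
    M₁ (ddFib u t x) (fib u t x) I +
      dLowT (fun K t' x' => M₂ (fib u t' x') (fib u t' x') K) I t x

/-- Fundamental solution of the heat operator `∂_t - μΔ`. -/
def heatKer (μ : ℝ) (x : Spc n) (t : ℝ) : ℝ :=
  if 0 < t then (4 * Real.pi * μ * t) ^ (-(n : ℝ) / 2) * Real.exp (-‖x‖ ^ 2 / (4 * μ * t))
  else 0

/-- Volume heat potential `Ψ_μ`. -/
def volPot (μ : ℝ) (f : ℝ → Spc n → ℝ) (t : ℝ) (x : Spc n) : ℝ :=
  ∫ τ in Set.Ioc (0 : ℝ) t, ∫ y : Spc n, heatKer μ (x - y) (t - τ) * f τ y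

/-- Poisson heat potential `Ψ_{μ,0}`. -/
def poisPot (μ : ℝ) (g : Spc n → ℝ) (t : ℝ) (x : Spc n) : ℝ :=
  ∫ y : Spc n, heatKer μ (x - y) t * g y

/-- Volume heat potential acting coefficient-wise on forms. -/
def volPotF {q : ℕ} (μ : ℝ) (f : FormT n q) : FormT n q := fun I => volPot μ (f I)

/-- Poisson heat potential acting coefficient-wise on forms. -/
def poisPotF {q : ℕ} (μ : ℝ) (g : FormS n q) : FormT n q := fun I => poisPot μ (g I)

/-- Area of the unit sphere in `ℝⁿ`. -/
def sphArea (n : ℕ) : ℝ := 2 * Real.pi ^ ((n : ℝ) / 2) / Real.Gamma ((n : ℝ) / 2)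

/-- Standard fundamental solution of the Laplace operator in `ℝⁿ`. -/
def lapKer (n : ℕ) (x : Spc n) : ℝ :=
  if n = 2 then (1 / Real.pi) * Real.log ‖x‖
  else ‖x‖ ^ (2 - (n : ℝ)) / (sphArea n * (2 - (n : ℝ)))

/-- Newtonian potential. -/
def newtPot (f : Spc n → ℝ) (x : Spc n) : ℝ := ∫ y : Spc n, lapKer n (x - y) * f y

/-- The integral operator `Φ_q` mapping `(q+1)`-forms to `q`-forms;
concretely `Φ_q f = -d^* (e * f)`. -/
def PhiOp {q : ℕ} (f : FormT n (q + 1)) : FormT n q := fun K t x =>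
  -coDS (n := n) (q := q + 1) (fun J y => newtPot (fun z => f J t z) y) K x

/-- Squared `L²` norm of a form at time `t`. -/
def l2Sq {q : ℕ} (u : FormT n q) (t : ℝ) : ℝ :=
  ∑ I : Idx n q, ∫ x : Spc n, (u I t x) ^ 2

/-- Squared `L²` norm of the spatial gradient of a form at time `t`. -/
def gradSq {q : ℕ} (u : FormT n q) (t : ℝ) : ℝ :=
  ∑ I : Idx n q, ∑ i : Fin n, ∫ x : Spc n, (pd i (fun y => u I t y) x) ^ 2

/-- The norm of `C^{0,𝐬(0,0,δ)}_{T,Λ^q}` (weighted sup-norm). -/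
def eSupT {q : ℕ} (T δ : ℝ) (u : FormT n q) : ℝ≥0∞ :=
  ∑ I : Idx n q,
    ⨆ (t : Set.Icc (0 : ℝ) T) (x : Spc n), ENNReal.ofReal (wt x ^ δ * |u I t x|)

/-- The norm `‖∇u‖_{C^{0,𝐬(0,0,δ)}_{T}}` of the spatial gradient. -/
def eSupGradT {q : ℕ} (T δ : ℝ) (u : FormT n q) : ℝ≥0∞ :=
  ∑ I : Idx n q, ∑ i : Fin n,
    ⨆ (t : Set.Icc (0 : ℝ) T) (x : Spc n),
      ENNReal.ofReal (wt x ^ δ * |pd i (fun y => u I t y) x|)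

/-- `q`-form with coefficients harmonic polynomials of degree at most `m`. -/
def HarmPolyForm {q : ℕ} (m : ℕ) (h : FormS n q) : Prop :=
  ∀ I, (∃ P : MvPolynomial (Fin n) ℝ, P.totalDegree ≤ m ∧
      ∀ x : Spc n, h I x = MvPolynomial.eval (fun i => x i) P) ∧
    ∀ x : Spc n, lap (h I) x = 0

/-- Classical solution of the Cauchy problem
`∂_t u - μ Δ u + extra = f` on `ℝⁿ × (0,T)`, `u(·,0) = u₀`. -/
def CauchySol {q : ℕ} (T μ : ℝ) (u extra f : FormT n q) (u₀ : FormS n q) : Prop :=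
  (∀ I, ∀ t ∈ Set.Ioo (0 : ℝ) T, ∀ x,
    deriv (fun τ => u I τ x) t - μ * lap (fun y => u I t y) x + extra I t x = f I t x) ∧
  ∀ I x, u I 0 x = u₀ I x

/-- `Ψ_{μ,q} 𝒩_q u`. -/
def NopPot {q : ℕ} (μ : ℝ) (M₁ : M1Type n q) (M₂ : M2Type n q) (u : FormT n q) : FormT n q :=
  volPotF μ (Nop M₁ M₂ u)

/-- `u + Ψ_{μ,q} 𝒩_q u`. -/
def TmapN {q : ℕ} (μ : ℝ) (M₁ : M1Type n q) (M₂ : M2Type n q) (u : FormT n q) : FormT n q :=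
  u + NopPot μ M₁ M₂ u

/-- The linearization `u + Ψ_{μ,q} B_q(v,u)`. -/
def LmapB {q : ℕ} (μ : ℝ) (M₁ : M1Type n q) (M₂ : M2Type n q) (v u : FormT n q) :
    FormT n q :=
  u + volPotF μ (Bop M₁ M₂ v u)

/-- `Φ_q d_q Ψ_{μ,q} 𝒩_q u`. -/
def PhiNpot {q : ℕ} (μ : ℝ) (M₁ : M1Type n q) (M₂ : M2Type n q) (u : FormT n q) :
    FormT n q :=
  PhiOp (dT (volPotF μ (Nop M₁ M₂ u)))

/-- `u + Φ_q d_q Ψ_{μ,q} 𝒩_q u`. -/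
def PhiNmap {q : ℕ} (μ : ℝ) (M₁ : M1Type n q) (M₂ : M2Type n q) (u : FormT n q) :
    FormT n q :=
  u + PhiNpot μ M₁ M₂ u

/-- The linearization `u + Φ_q d_q Ψ_{μ,q} B_q(v,u)`. -/
def PhiLmap {q : ℕ} (μ : ℝ) (M₁ : M1Type n q) (M₂ : M2Type n q) (v u : FormT n q) :
    FormT n q :=
  u + PhiOp (dT (volPotF μ (Bop M₁ M₂ v u)))

/-! ### Weights and weighted parabolic Hölder bounds -/

lemma one_le_wt (x : Spc n) : 1 ≤ wt x := by
  unfold wt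
  rw [Real.one_le_sqrt]
  nlinarith [sq_nonneg ‖x‖]

lemma wt_pos (x : Spc n) : 0 < wt x := lt_of_lt_of_le one_pos (one_le_wt x)

lemma norm_le_wt (x : Spc n) : ‖x‖ ≤ wt x := by
  unfold wt
  apply Real.le_sqrt_of_sq_le
  linarith

lemma wt_le_add (x y : Spc n) : wt x ≤ wt y + ‖x - y‖ := by
  have hy := norm_le_wt y
  have hy0 := wt_pos y
  have h : ‖x‖ ≤ ‖y‖ + ‖x - y‖ := by
    have := norm_add_le y (x - y)
    simpa using this
  have h2 : wt y ^ 2 = 1 + ‖y‖ ^ 2 := Real.sq_sqrt (by positivity)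
  unfold wt at h2 hy hy0 ⊢
  apply Real.sqrt_le_iff.2
  constructor
  · positivity
  · nlinarith [norm_nonneg x, norm_nonneg y, norm_nonneg (x - y)]

lemma wt_le_shift (x z : Spc n) : wt x ≤ (1 + ‖z‖) * wt (x + z) := by
  have h := wt_le_add x (x + z)
  have h1 : ‖x - (x + z)‖ = ‖z‖ := by
    rw [sub_add_cancel_left, norm_neg]
  rw [h1] at h
  nlinarith [one_le_wt (x + z), norm_nonneg z]

/-- The minimum of the weights at two points. -/
def wtm (x y : Spc n) : ℝ := min (wt x) (wt y)

lemma one_le_wtm (x y : Spc n) : 1 ≤ wtm x y := le_min (one_le_wt x) (one_le_wt y)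

lemma wtm_pos (x y : Spc n) : 0 < wtm x y := lt_of_lt_of_le one_pos (one_le_wtm x y)

lemma wtm_comm (x y : Spc n) : wtm x y = wtm y x := min_comm _ _

lemma wt_rpow_neg_le_wtm_left (x y : Spc n) {p : ℝ} (hp : 0 ≤ p) :
    wt x ^ (-p) ≤ wtm x y ^ (-p) :=
  Real.rpow_le_rpow_of_nonpos (wtm_pos x y) (min_le_left _ _) (by linarith)

lemma wt_rpow_neg_le_wtm_right (x y : Spc n) {p : ℝ} (hp : 0 ≤ p) :
    wt y ^ (-p) ≤ wtm x y ^ (-p) :=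
  Real.rpow_le_rpow_of_nonpos (wtm_pos x y) (min_le_right _ _) (by linarith)

lemma wtm_le_shift (x y z : Spc n) : wtm x y ≤ (1 + ‖z‖) * wtm (x + z) (y + z) := by
  have hz := norm_nonneg z
  unfold wtm
  rw [mul_min_of_nonneg _ _ (by positivity)]
  exact min_le_min (wt_le_shift x z) (wt_le_shift y z)

lemma rpow_neg_le_of_le_mul {a b c p N : ℝ} (ha : 0 < a) (hb : 0 < b) (hc : 1 ≤ c)
    (h : a ≤ c * b) (hp : 0 ≤ p) (hpN : p ≤ N) : b ^ (-p) ≤ c ^ N * a ^ (-p) := by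
  have hc0 : 0 < c := by linarith
  have h1 : a ^ p ≤ (c * b) ^ p := Real.rpow_le_rpow ha.le h hp
  rw [Real.mul_rpow hc0.le hb.le] at h1
  have h2 : c ^ p ≤ c ^ N := Real.rpow_le_rpow_of_exponent_le hc hpN
  have hap : 0 < a ^ p := Real.rpow_pos_of_pos ha p
  have hbp : 0 < b ^ p := Real.rpow_pos_of_pos hb p
  rw [Real.rpow_neg hb.le, Real.rpow_neg ha.le, ← div_eq_mul_inv, inv_eq_one_div,
    div_le_div_iff₀ hbp hap]
  calc 1 * a ^ p ≤ c ^ p * b ^ p := by linarith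
    _ ≤ c ^ N * b ^ p := by gcongr

/-- Weighted parabolic Hölder bounds on `[0,T]`, with exponent `e`, weight exponent `p`,
growth rate `β` in time and constant `C`. -/
structure HB {F : Type*} [NormedAddCommGroup F] (T β e p C : ℝ) (v : ℝ → Spc n → F) : Prop where
  bd : ∀ t ∈ Set.Icc 0 T, ∀ x, ‖v t x‖ ≤ C * Real.exp (β * t) * wt x ^ (-p)
  sp : ∀ t ∈ Set.Icc 0 T, ∀ x y,
    ‖v t x - v t y‖ ≤ C * Real.exp (β * t) * ‖x - y‖ ^ e * wtm x y ^ (-(p + e))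
  tm : ∀ s t, 0 ≤ s → s ≤ t → t ≤ T → ∀ x,
    ‖v t x - v s x‖ ≤ C * Real.exp (β * t) * (t - s) ^ (e / 2) * wt x ^ (-p)

namespace HB

variable {F : Type*} [NormedAddCommGroup F] {T β e p C : ℝ} {v u : ℝ → Spc n → F}

lemma congr (h : HB T β e p C v) (huv : ∀ t ∈ Set.Icc 0 T, ∀ x, u t x = v t x) :
    HB T β e p C u where
  bd t ht x := by rw [huv t ht]; exact h.bd t ht x
  sp t ht x y := by rw [huv t ht, huv t ht]; exact h.sp t ht x y
  tm s t hs hst ht x := by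
    rw [huv t ⟨hs.trans hst, ht⟩, huv s ⟨hs, hst.trans ht⟩]; exact h.tm s t hs hst ht x

lemma const_nonneg (h : HB T β e p C v) (hT : 0 ≤ T) : 0 ≤ C := by
  have h1 := (norm_nonneg _).trans (h.bd 0 ⟨le_rfl, hT⟩ 0)
  have h2 : 0 < Real.exp (β * 0) * wt (0 : Spc n) ^ (-p) :=
    mul_pos (Real.exp_pos _) (Real.rpow_pos_of_pos (wt_pos _) _)
  rw [mul_assoc] at h1
  exact nonneg_of_mul_nonneg_left h1 h2

lemma mono {C' : ℝ} (h : HB T β e p C v) (hC : C ≤ C') : HB T β e p C' v where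
  bd t ht x := (h.bd t ht x).trans (by
    have := wt_pos x
    gcongr)
  sp t ht x y := (h.sp t ht x y).trans (by
    have := wtm_pos x y
    gcongr)
  tm s t hs hst ht x := (h.tm s t hs hst ht x).trans (by
    have := wt_pos x
    have : 0 ≤ t - s := by linarith
    gcongr)

lemma add {C' : ℝ} (h : HB T β e p C v) (h' : HB T β e p C' u) :
    HB T β e p (C + C') (fun t x => v t x + u t x) where
  bd t ht x := by
    refine (norm_add_le _ _).trans ?_
    have := h.bd t ht x
    have := h'.bd t ht x
    linarith
  sp t ht x y := by
    have h1 := h.sp t ht x y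
    have h2 := h'.sp t ht x y
    calc ‖v t x + u t x - (v t y + u t y)‖ = ‖(v t x - v t y) + (u t x - u t y)‖ := by
          congr 1; abel
      _ ≤ _ := norm_add_le _ _
      _ ≤ _ := by linarith
  tm s t hs hst ht x := by
    have h1 := h.tm s t hs hst ht x
    have h2 := h'.tm s t hs hst ht x
    calc ‖v t x + u t x - (v s x + u s x)‖ = ‖(v t x - v s x) + (u t x - u s x)‖ := by
          congr 1; abel
      _ ≤ _ := norm_add_le _ _
      _ ≤ _ := by linarith

lemma of_lip {G : Type*} [NormedAddCommGroup G] {K : ℝ} (hK : 0 ≤ K) {w : ℝ → Spc n → G}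
    (h : HB T β e p C v) (hb : ∀ t ∈ Set.Icc 0 T, ∀ x, ‖w t x‖ ≤ K * ‖v t x‖)
    (hd : ∀ t ∈ Set.Icc 0 T, ∀ s ∈ Set.Icc 0 T, ∀ x y,
      ‖w t x - w s y‖ ≤ K * ‖v t x - v s y‖) :
    HB T β e p (K * C) w where
  bd t ht x := (hb t ht x).trans (by
    have := mul_le_mul_of_nonneg_left (h.bd t ht x) hK
    linarith)
  sp t ht x y := (hd t ht t ht x y).trans (by
    have := mul_le_mul_of_nonneg_left (h.sp t ht x y) hK
    linarith)
  tm s t hs hst ht x := (hd t ⟨hs.trans hst, ht⟩ s ⟨hs, hst.trans ht⟩ x x).trans (by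
    have := mul_le_mul_of_nonneg_left (h.tm s t hs hst ht x) hK
    linarith)

lemma weight_mono {p' : ℝ} (h : HB T β e p' C v) (hp : p ≤ p') (hT : 0 ≤ T) :
    HB T β e p C v := by
  have hC := h.const_nonneg hT
  refine ⟨fun t ht x => (h.bd t ht x).trans ?_, fun t ht x y => (h.sp t ht x y).trans ?_,
    fun s t hs hst ht x => (h.tm s t hs hst ht x).trans ?_⟩
  · have := Real.rpow_le_rpow_of_exponent_le (one_le_wt x) (neg_le_neg hp)
    gcongr
  · have := Real.rpow_le_rpow_of_exponent_le (one_le_wtm x y)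
      (show -(p' + e) ≤ -(p + e) by linarith)
    gcongr
  · have := Real.rpow_le_rpow_of_exponent_le (one_le_wt x) (neg_le_neg hp)
    have : 0 ≤ t - s := by linarith
    gcongr

lemma rate_mono {β' : ℝ} (h : HB T β e p C v) (hβ : β ≤ β') (hT : 0 ≤ T) :
    HB T β' e p C v := by
  have hC := h.const_nonneg hT
  refine ⟨fun t ht x => (h.bd t ht x).trans ?_, fun t ht x y => (h.sp t ht x y).trans ?_,
    fun s t hs hst ht x => (h.tm s t hs hst ht x).trans ?_⟩
  · have := ht.1
    have := wt_pos x
    gcongr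
  · have := ht.1
    have := wtm_pos x y
    gcongr
  · have := wt_pos x
    have : 0 ≤ t - s := by linarith
    have : 0 ≤ t := by linarith
    gcongr

lemma rate_zero (h : HB T β e p C v) (hβ : 0 ≤ β) (hT : 0 ≤ T) :
    HB T 0 e p (C * Real.exp (β * T)) v := by
  have hC := h.const_nonneg hT
  have key : ∀ t, t ≤ T → C * Real.exp (β * t) ≤ C * Real.exp (β * T) * Real.exp (0 * t) := by
    intro t ht
    simp only [zero_mul, Real.exp_zero, mul_one]
    gcongr
  refine ⟨fun t ht x => (h.bd t ht x).trans ?_, fun t ht x y => (h.sp t ht x y).trans ?_,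
    fun s t hs hst ht x => (h.tm s t hs hst ht x).trans ?_⟩
  · have := key t ht.2
    have := wt_pos x
    gcongr
  · have := key t ht.2
    have := wtm_pos x y
    gcongr
  · have := key t ht
    have := wt_pos x
    have : 0 ≤ t - s := by linarith
    gcongr

lemma exp_mono {e' : ℝ} (h : HB T β e' p C v) (he : 0 ≤ e) (hee : e ≤ e') (hp : 0 ≤ p)
    (he1 : e' ≤ 1) (hT : 0 ≤ T) : HB T β e p ((2 + T) * C) v := by
  have hC := h.const_nonneg hT
  refine ⟨fun t ht x => (h.bd t ht x).trans ?_, fun t ht x y => ?_,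
    fun s t hs hst ht x => (h.tm s t hs hst ht x).trans ?_⟩
  · have := wt_pos x
    have : C ≤ (2 + T) * C := by nlinarith
    gcongr
  · have hm := wtm_pos x y
    have hE := Real.exp_pos (β * t)
    by_cases hxy : ‖x - y‖ ≤ wtm x y
    · refine (h.sp t ht x y).trans ?_
      have h1 : ‖x - y‖ ^ e' * wtm x y ^ (-(p + e')) ≤ ‖x - y‖ ^ e * wtm x y ^ (-(p + e)) := by
        have h2 : (‖x - y‖ / wtm x y) ^ e' ≤ (‖x - y‖ / wtm x y) ^ e :=
          Real.rpow_le_rpow_of_exponent_ge_of_imp (by positivity)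
            (div_le_one_of_le₀ hxy hm.le) hee (fun h0 he0 => by linarith)
        rw [Real.div_rpow (norm_nonneg _) hm.le, Real.div_rpow (norm_nonneg _) hm.le] at h2
        have h3 : ∀ a : ℝ, wtm x y ^ (-(p + a)) = wtm x y ^ (-p) * (wtm x y ^ a)⁻¹ := by
          intro a
          rw [neg_add, Real.rpow_add hm, Real.rpow_neg hm.le a]
        rw [h3, h3]
        have := mul_le_mul_of_nonneg_left h2 (Real.rpow_nonneg hm.le (-p))
        simp only [div_eq_mul_inv] at this
        linarith
      have h4 : C ≤ (2 + T) * C := by nlinarith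
      calc C * Real.exp (β * t) * ‖x - y‖ ^ e' * wtm x y ^ (-(p + e'))
          = (C * Real.exp (β * t)) * (‖x - y‖ ^ e' * wtm x y ^ (-(p + e'))) := by ring
        _ ≤ ((2 + T) * C * Real.exp (β * t)) * (‖x - y‖ ^ e * wtm x y ^ (-(p + e))) := by
          gcongr
        _ = _ := by ring
    · push Not at hxy
      have h1 := (h.bd t ht x).trans (mul_le_mul_of_nonneg_left
        (wt_rpow_neg_le_wtm_left x y hp) (by positivity))
      have h2 := (h.bd t ht y).trans (mul_le_mul_of_nonneg_left
        (wt_rpow_neg_le_wtm_right x y hp) (by positivity))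
      have h3 : wtm x y ^ (-p) ≤ ‖x - y‖ ^ e * wtm x y ^ (-(p + e)) := by
        rw [neg_add, Real.rpow_add hm, Real.rpow_neg hm.le e]
        have h4 : wtm x y ^ e ≤ ‖x - y‖ ^ e := Real.rpow_le_rpow hm.le hxy.le he
        have h5 : 0 < wtm x y ^ e := Real.rpow_pos_of_pos hm e
        have h6 : 1 ≤ ‖x - y‖ ^ e * (wtm x y ^ e)⁻¹ := by
          rw [← div_eq_mul_inv, one_le_div h5]; exact h4
        have h7 := Real.rpow_nonneg hm.le (-p)
        nlinarith
      have h8 := norm_sub_le (v t x) (v t y)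
      calc ‖v t x - v t y‖ ≤ 2 * (C * Real.exp (β * t) * wtm x y ^ (-p)) := by linarith
        _ ≤ (2 + T) * (C * Real.exp (β * t) * (‖x - y‖ ^ e * wtm x y ^ (-(p + e)))) := by
          gcongr
          linarith
        _ = _ := by ring
  · have hw := wt_pos x
    have hts : 0 ≤ t - s := by linarith
    have h1 : (t - s) ^ (e' / 2) ≤ (2 + T) * (t - s) ^ (e / 2) := by
      have h2 : (t - s) ^ (e' / 2 - e / 2) ≤ 2 + T := by
        calc (t - s) ^ (e' / 2 - e / 2) ≤ (2 + T) ^ (e' / 2 - e / 2) :=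
              Real.rpow_le_rpow hts (by linarith) (by linarith)
          _ ≤ (2 + T) ^ (1 : ℝ) :=
              Real.rpow_le_rpow_of_exponent_le (by linarith) (by linarith)
          _ = 2 + T := Real.rpow_one _
      calc (t - s) ^ (e' / 2) = (t - s) ^ ((e' / 2 - e / 2) + e / 2) := by ring_nf
        _ = (t - s) ^ (e' / 2 - e / 2) * (t - s) ^ (e / 2) :=
            Real.rpow_add_of_nonneg hts (by linarith) (by linarith)
        _ ≤ _ := by gcongr
    calc C * Real.exp (β * t) * (t - s) ^ (e' / 2) * wt x ^ (-p)
        ≤ C * Real.exp (β * t) * ((2 + T) * (t - s) ^ (e / 2)) * wt x ^ (-p) := by gcongr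
      _ = _ := by ring

lemma lim {vk : ℕ → ℝ → Spc n → F} (h : ∀ k, HB T β e p C (vk k))
    (hv : ∀ t ∈ Set.Icc 0 T, ∀ x, Tendsto (fun k => vk k t x) atTop (nhds (v t x))) :
    HB T β e p C v where
  bd t ht x := le_of_tendsto (hv t ht x).norm (Eventually.of_forall fun k => (h k).bd t ht x)
  sp t ht x y := le_of_tendsto ((hv t ht x).sub (hv t ht y)).norm
    (Eventually.of_forall fun k => (h k).sp t ht x y)
  tm s t hs hst ht x := le_of_tendsto
    ((hv t ⟨hs.trans hst, ht⟩ x).sub (hv s ⟨hs, hst.trans ht⟩ x)).norm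
    (Eventually.of_forall fun k => (h k).tm s t hs hst ht x)

lemma continuousOn (h : HB T β e p C v) (he : 0 < e) (hp : 0 ≤ p) (hβ : 0 ≤ β) :
    ContinuousOn (fun q : ℝ × Spc n => v q.1 q.2) (Set.Icc 0 T ×ˢ Set.univ) := by
  rintro ⟨t, x⟩ ⟨ht, -⟩
  have hT : 0 ≤ T := ht.1.trans ht.2
  have hC := h.const_nonneg hT
  have key : ∀ q ∈ Set.Icc 0 T ×ˢ (Set.univ : Set (Spc n)),
      ‖v q.1 q.2 - v t x‖ ≤ C * Real.exp (β * T) * (|q.1 - t| ^ (e / 2) + ‖q.2 - x‖ ^ e) := by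
    rintro ⟨s, y⟩ ⟨hs, -⟩
    have hone : ∀ a b : ℝ, 1 ≤ a → 0 ≤ b → a ^ (-b) ≤ 1 := fun a b ha hb =>
      Real.rpow_le_one_of_one_le_of_nonpos ha (by linarith)
    have h1 : ‖v s y - v s x‖ ≤ C * Real.exp (β * T) * ‖y - x‖ ^ e := by
      refine (h.sp s hs y x).trans ?_
      have h2 := hone _ (p + e) (one_le_wtm y x) (by linarith)
      have h3 := hs.2
      have h4 := wtm_pos y x
      calc C * Real.exp (β * s) * ‖y - x‖ ^ e * wtm y x ^ (-(p + e))
          ≤ C * Real.exp (β * T) * ‖y - x‖ ^ e * 1 := by gcongr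
        _ = _ := mul_one _
    have h5 : ∀ s t : ℝ, 0 ≤ s → s ≤ t → t ≤ T →
        ‖v t x - v s x‖ ≤ C * Real.exp (β * T) * |t - s| ^ (e / 2) := by
      intro s t hs hst ht
      refine (h.tm s t hs hst ht x).trans ?_
      have h2 := hone _ p (one_le_wt x) hp
      have h4 := wt_pos x
      rw [abs_of_nonneg (by linarith : 0 ≤ t - s)]
      have : 0 ≤ t - s := by linarith
      calc C * Real.exp (β * t) * (t - s) ^ (e / 2) * wt x ^ (-p)
          ≤ C * Real.exp (β * T) * (t - s) ^ (e / 2) * 1 := by gcongr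
        _ = _ := mul_one _
    have h6 : ‖v s x - v t x‖ ≤ C * Real.exp (β * T) * |s - t| ^ (e / 2) := by
      rcases le_total s t with hst | hst
      · rw [norm_sub_rev, abs_sub_comm]; exact h5 s t hs.1 hst ht.2
      · exact h5 t s ht.1 hst hs.2
    calc ‖v s y - v t x‖ = ‖(v s y - v s x) + (v s x - v t x)‖ := by congr 1; abel
      _ ≤ _ := norm_add_le _ _
      _ ≤ _ := by
        simp only
        linarith
  refine tendsto_iff_norm_sub_tendsto_zero.2 ?_
  refine squeeze_zero' (Eventually.of_forall fun _ => norm_nonneg _)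
    (eventually_nhdsWithin_of_forall key) ?_
  have hc : Continuous fun q : ℝ × Spc n =>
      C * Real.exp (β * T) * (|q.1 - t| ^ (e / 2) + ‖q.2 - x‖ ^ e) := by
    have h1 : Continuous fun q : ℝ × Spc n => |q.1 - t| ^ (e / 2) :=
      Continuous.rpow_const (by fun_prop) (fun _ => Or.inr (by linarith))
    have h2 : Continuous fun q : ℝ × Spc n => ‖q.2 - x‖ ^ e :=
      Continuous.rpow_const (by fun_prop) (fun _ => Or.inr he.le)
    exact continuous_const.mul (h1.add h2)
  have := (hc.tendsto (t, x)).mono_left (nhdsWithin_le_nhds (s := Set.Icc 0 T ×ˢ Set.univ))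
  simpa [Real.zero_rpow (by linarith : e / 2 ≠ 0), Real.zero_rpow he.ne'] using this

end HB

lemma HB.mul {T β e p p' A C : ℝ} {u v : ℝ → Spc n → ℝ} (hu : HB T 0 e p A u)
    (hv : HB T β e p' C v) (hp : 0 ≤ p) (hp' : 0 ≤ p') (hβ : 0 ≤ β) (hT : 0 ≤ T) :
    HB T β e (p + p') (2 * (A * C)) (fun t x => u t x * v t x) := by
  have hA := hu.const_nonneg hT
  have hC := hv.const_nonneg hT
  refine ⟨fun t ht x => ?_, fun t ht x y => ?_, fun s t hs hst ht x => ?_⟩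
  · have h1 := hu.bd t ht x
    have h2 := hv.bd t ht x
    have hw := wt_pos x
    simp only [zero_mul, Real.exp_zero, mul_one] at h1
    rw [norm_mul]
    calc ‖u t x‖ * ‖v t x‖ ≤ (A * wt x ^ (-p)) * (C * Real.exp (β * t) * wt x ^ (-p')) := by
          gcongr
      _ = A * C * Real.exp (β * t) * wt x ^ (-(p + p')) := by
          rw [neg_add, Real.rpow_add hw]; ring
      _ ≤ 2 * (A * C) * Real.exp (β * t) * wt x ^ (-(p + p')) := by
          have hAC : A * C ≤ 2 * (A * C) := by linarith [mul_nonneg hA hC]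
          gcongr
  · have hm := wtm_pos x y
    have h1 := (hu.bd t ht x).trans (mul_le_mul_of_nonneg_left
        (wt_rpow_neg_le_wtm_left x y hp) (by positivity))
    have h2 := (hv.bd t ht y).trans (mul_le_mul_of_nonneg_left
        (wt_rpow_neg_le_wtm_right x y hp') (by positivity))
    have h3 := hu.sp t ht x y
    have h4 := hv.sp t ht x y
    simp only [zero_mul, Real.exp_zero, mul_one] at h1 h3
    have e1 : u t x * v t x - u t y * v t y
      = u t x * (v t x - v t y) + (u t x - u t y) * v t y := by ring
    rw [e1]
    refine (norm_add_le _ _).trans ?_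
    rw [norm_mul, norm_mul]
    calc ‖u t x‖ * ‖v t x - v t y‖ + ‖u t x - u t y‖ * ‖v t y‖
        ≤ (A * wtm x y ^ (-p)) * (C * Real.exp (β * t) * ‖x - y‖ ^ e * wtm x y ^ (-(p' + e)))
          + (A * ‖x - y‖ ^ e * wtm x y ^ (-(p + e)))
            * (C * Real.exp (β * t) * wtm x y ^ (-p')) := by gcongr
      _ = _ := by
          have e2 : -(p + p' + e) = -p + (-p') + (-e) := by ring
          rw [e2, neg_add, neg_add, Real.rpow_add hm, Real.rpow_add hm, Real.rpow_add hm,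
            Real.rpow_add hm]
          ring
  · have hw := wt_pos x
    have htI : t ∈ Set.Icc 0 T := ⟨hs.trans hst, ht⟩
    have hsI : s ∈ Set.Icc 0 T := ⟨hs, hst.trans ht⟩
    have h1 := hu.bd t htI x
    have h2 := hv.bd s hsI x
    have h3 := hu.tm s t hs hst ht x
    have h4 := hv.tm s t hs hst ht x
    simp only [zero_mul, Real.exp_zero, mul_one] at h1 h3
    have h5 : ‖v s x‖ ≤ C * Real.exp (β * t) * wt x ^ (-p') := h2.trans (by gcongr)
    have e1 : u t x * v t x - u s x * v s x
      = u t x * (v t x - v s x) + (u t x - u s x) * v s x := by ring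
    rw [e1]
    refine (norm_add_le _ _).trans ?_
    rw [norm_mul, norm_mul]
    have : 0 ≤ t - s := by linarith
    calc ‖u t x‖ * ‖v t x - v s x‖ + ‖u t x - u s x‖ * ‖v s x‖
        ≤ (A * wt x ^ (-p)) * (C * Real.exp (β * t) * (t - s) ^ (e / 2) * wt x ^ (-p'))
          + (A * (t - s) ^ (e / 2) * wt x ^ (-p))
            * (C * Real.exp (β * t) * wt x ^ (-p')) := by gcongr
      _ = _ := by
          rw [neg_add, Real.rpow_add hw]
          ring

lemma HB.const_mul {T β e p C : ℝ} {v : ℝ → Spc n → ℝ} (h : HB T β e p C v) (c : ℝ) :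
    HB T β e p (|c| * C) (fun t x => c * v t x) :=
  h.of_lip (abs_nonneg c) (fun t _ x => by rw [norm_mul]; rfl)
    (fun t _ s _ x y => by rw [← mul_sub, norm_mul]; rfl)

lemma HB.zero {F : Type*} [NormedAddCommGroup F] {T β e p : ℝ} :
    HB T β e p 0 (fun _ _ => (0 : F) : ℝ → Spc n → F) :=
  ⟨fun t _ x => by simp, fun t _ x y => by simp, fun s t _ _ _ x => by simp⟩

/-! ### Weighted parabolic Hölder spaces of finite spatial order -/

/-- Partial derivative of a time-dependent function. -/
def dx (i : Fin n) (v : ℝ → Spc n → ℝ) : ℝ → Spc n → ℝ := fun t x => pd i (v t) x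

lemma pd_add (i : Fin n) {f g : Spc n → ℝ} {x : Spc n} (hf : DifferentiableAt ℝ f x)
    (hg : DifferentiableAt ℝ g x) : pd i (fun y => f y + g y) x = pd i f x + pd i g x := by
  unfold pd
  rw [fderiv_fun_add hf hg]
  rfl

lemma pd_sub (i : Fin n) {f g : Spc n → ℝ} {x : Spc n} (hf : DifferentiableAt ℝ f x)
    (hg : DifferentiableAt ℝ g x) : pd i (fun y => f y - g y) x = pd i f x - pd i g x := by
  unfold pd
  rw [fderiv_fun_sub hf hg]
  rfl

lemma pd_mul (i : Fin n) {f g : Spc n → ℝ} {x : Spc n} (hf : DifferentiableAt ℝ f x)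
    (hg : DifferentiableAt ℝ g x) :
    pd i (fun y => f y * g y) x = pd i f x * g x + f x * pd i g x := by
  unfold pd
  rw [fderiv_fun_mul hf hg]
  simp only [_root_.add_apply, _root_.smul_apply, smul_eq_mul]
  ring

lemma pd_const_mul (i : Fin n) (c : ℝ) {f : Spc n → ℝ} {x : Spc n}
    (hf : DifferentiableAt ℝ f x) : pd i (fun y => c * f y) x = c * pd i f x := by
  unfold pd
  rw [fderiv_const_mul hf]
  rfl

lemma pd_zero (i : Fin n) (x : Spc n) : pd i (fun _ => 0) x = 0 := by
  unfold pd
  simp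

lemma clm_eq_sum (L : Spc n →L[ℝ] ℝ) :
    L = ∑ i, L (EuclideanSpace.single i 1) • (EuclideanSpace.proj i : Spc n →L[ℝ] ℝ) := by
  ext v
  have hv : v = ∑ i, v i • (EuclideanSpace.single i 1 : Spc n) := by
    ext j
    simp [Finset.sum_apply, Pi.single_apply]
  conv_lhs => rw [hv]
  simp [map_sum, mul_comm]

lemma fderiv_eq_sum_pd (f : Spc n → ℝ) (x : Spc n) :
    fderiv ℝ f x = ∑ i, pd i f x • (EuclideanSpace.proj i : Spc n →L[ℝ] ℝ) :=
  clm_eq_sum _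

lemma norm_proj_le (i : Fin n) : ‖(EuclideanSpace.proj i : Spc n →L[ℝ] ℝ)‖ ≤ 1 :=
  ContinuousLinearMap.opNorm_le_bound _ zero_le_one fun v => by
    simpa using PiLp.norm_apply_le v i

lemma norm_sum_smul_proj_le (a : Fin n → ℝ) :
    ‖∑ i, a i • (EuclideanSpace.proj i : Spc n →L[ℝ] ℝ)‖ ≤ ∑ i, |a i| := by
  refine (norm_sum_le _ _).trans (Finset.sum_le_sum fun i _ => ?_)
  rw [norm_smul, Real.norm_eq_abs]
  exact mul_le_of_le_one_right (abs_nonneg _) (norm_proj_le i)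

/-- Weighted parabolic Hölder bounds for all spatial derivatives up to a given order; the Hölder
exponent `ex` depends on the number of remaining derivatives. -/
def XS (T β : ℝ) (ex : ℕ → ℝ) : ℕ → ℝ → ℝ → (ℝ → Spc n → ℝ) → Prop
  | 0, p, C, v => HB T β (ex 0) p C v
  | m + 1, p, C, v => HB T β (ex (m + 1)) p C v ∧
      (∀ t ∈ Set.Icc 0 T, Differentiable ℝ (v t)) ∧ ∀ i, XS T β ex m (p + 1) C (dx i v)

namespace XS

variable {T β p C : ℝ} {ex : ℕ → ℝ} {m : ℕ} {u v : ℝ → Spc n → ℝ}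

lemma hb (h : XS T β ex m p C v) : HB T β (ex m) p C v := by
  cases m with
  | zero => exact h
  | succ m => exact h.1

lemma diff (h : XS T β ex (m + 1) p C v) : ∀ t ∈ Set.Icc 0 T, Differentiable ℝ (v t) := h.2.1

lemma dx (h : XS T β ex (m + 1) p C v) (i : Fin n) :
    XS T β ex m (p + 1) C (NSdeRham.dx i v) := h.2.2 i

lemma congr (h : XS T β ex m p C v) (huv : ∀ t ∈ Set.Icc 0 T, ∀ x, u t x = v t x) :
    XS T β ex m p C u := by
  induction m generalizing p u v with
  | zero => exact HB.congr h huv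
  | succ m ih =>
    have hfun : ∀ t ∈ Set.Icc 0 T, u t = v t := fun t ht => funext (huv t ht)
    refine ⟨h.1.congr huv, fun t ht => ?_, fun i => ih (h.2.2 i) fun t ht x => ?_⟩
    · rw [hfun t ht]; exact h.2.1 t ht
    · unfold NSdeRham.dx; rw [hfun t ht]

lemma const_nonneg (h : XS T β ex m p C v) (hT : 0 ≤ T) : 0 ≤ C := h.hb.const_nonneg hT

lemma mono {C' : ℝ} (h : XS T β ex m p C v) (hC : C ≤ C') : XS T β ex m p C' v := by
  induction m generalizing p v with
  | zero => exact HB.mono h hC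
  | succ m ih => exact ⟨h.1.mono hC, h.2.1, fun i => ih (h.2.2 i)⟩

lemma add {C' : ℝ} (h : XS T β ex m p C v) (h' : XS T β ex m p C' u) :
    XS T β ex m p (C + C') (fun t x => v t x + u t x) := by
  induction m generalizing p u v with
  | zero => exact HB.add h h'
  | succ m ih =>
    exact ⟨h.1.add h'.1, fun t ht => (h.2.1 t ht).add (h'.2.1 t ht), fun i =>
      (ih (h.2.2 i) (h'.2.2 i)).congr fun t ht x => pd_add i (h.2.1 t ht x) (h'.2.1 t ht x)⟩

lemma const_mul (h : XS T β ex m p C v) (c : ℝ) :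
    XS T β ex m p (|c| * C) (fun t x => c * v t x) := by
  induction m generalizing p v with
  | zero => exact HB.const_mul h c
  | succ m ih =>
    exact ⟨h.1.const_mul c, fun t ht => (h.2.1 t ht).const_mul c, fun i =>
      (ih (h.2.2 i)).congr fun t ht x => pd_const_mul i c (h.2.1 t ht x)⟩

lemma neg (h : XS T β ex m p C v) : XS T β ex m p C (fun t x => -v t x) := by
  have := h.const_mul (-1)
  simpa using this

lemma sub {C' : ℝ} (h : XS T β ex m p C v) (h' : XS T β ex m p C' u) :
    XS T β ex m p (C + C') (fun t x => v t x - u t x) := by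
  simpa only [sub_eq_add_neg] using h.add h'.neg

lemma zero : XS T β ex m p 0 (fun _ _ => 0 : ℝ → Spc n → ℝ) := by
  induction m generalizing p with
  | zero => exact HB.zero
  | succ m ih =>
    exact ⟨HB.zero, fun t _ => differentiable_const _, fun i => ih.congr fun t _ x => pd_zero i x⟩

lemma sum {ι : Type*} (s : Finset ι) {c : ι → ℝ} {w : ι → ℝ → Spc n → ℝ}
    (h : ∀ k ∈ s, XS T β ex m p (c k) (w k)) :
    XS T β ex m p (∑ k ∈ s, c k) (fun t x => ∑ k ∈ s, w k t x) := by
  induction s using Finset.induction_on with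
  | empty => simpa using zero
  | insert a s ha ih =>
    simp only [Finset.sum_insert ha]
    exact (h a (Finset.mem_insert_self _ _)).add
      (ih fun k hk => h k (Finset.mem_insert_of_mem hk))

lemma weight_mono {p' : ℝ} (h : XS T β ex m p' C v) (hp : p ≤ p') (hT : 0 ≤ T) :
    XS T β ex m p C v := by
  induction m generalizing p p' v with
  | zero => exact HB.weight_mono h hp hT
  | succ m ih => exact ⟨h.1.weight_mono hp hT, h.2.1, fun i => ih (h.2.2 i) (by linarith)⟩

lemma rate_mono {β' : ℝ} (h : XS T β ex m p C v) (hβ : β ≤ β') (hT : 0 ≤ T) :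
    XS T β' ex m p C v := by
  induction m generalizing p v with
  | zero => exact HB.rate_mono h hβ hT
  | succ m ih => exact ⟨h.1.rate_mono hβ hT, h.2.1, fun i => ih (h.2.2 i)⟩

lemma rate_zero (h : XS T β ex m p C v) (hβ : 0 ≤ β) (hT : 0 ≤ T) :
    XS T 0 ex m p (C * Real.exp (β * T)) v := by
  induction m generalizing p v with
  | zero => exact HB.rate_zero h hβ hT
  | succ m ih => exact ⟨h.1.rate_zero hβ hT, h.2.1, fun i => ih (h.2.2 i)⟩

end XS

/-- Admissible families of Hölder exponents. -/
structure GoodEx (ex : ℕ → ℝ) (κ : ℝ) : Prop where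
  kpos : 0 < κ
  klt : κ < 1 / 2
  pos : ∀ m, 0 < ex m
  mono : Monotone ex
  le : ∀ m, ex m ≤ 1 - 2 * κ

namespace XS

variable {T β p κ C : ℝ} {ex : ℕ → ℝ} {m : ℕ} {u v : ℝ → Spc n → ℝ}

lemma pred (hex : GoodEx ex κ) (h : XS T β ex (m + 1) p C v) (hp : 0 ≤ p) (hT : 0 ≤ T) :
    XS T β ex m p ((2 + T) * C) v := by
  have hone := hex.kpos
  induction m generalizing p v with
  | zero =>
    exact h.1.exp_mono (hex.pos 0).le (hex.mono (Nat.le_succ 0)) hp (by linarith [hex.le 1]) hT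
  | succ m ih =>
    exact ⟨h.1.exp_mono (hex.pos _).le (hex.mono (Nat.le_succ _)) hp
      (by linarith [hex.le (m + 1 + 1)]) hT, h.2.1, fun i => ih (h.2.2 i) (by linarith)⟩

lemma mul (hex : GoodEx ex κ) {p' A : ℝ} (hu : XS T 0 ex m p A u) (hv : XS T β ex m p' C v)
    (hp : 0 ≤ p) (hp' : 0 ≤ p') (hβ : 0 ≤ β) (hT : 0 ≤ T) :
    XS T β ex m (p + p') (2 * (2 * (2 + T)) ^ m * (A * C)) (fun t x => u t x * v t x) := by
  have hA := hu.const_nonneg hT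
  have hC := hv.const_nonneg hT
  have hAC := mul_nonneg hA hC
  induction m generalizing p p' A C u v with
  | zero => exact HB.mono (HB.mul hu hv hp hp' hβ hT) (by simp)
  | succ m ih =>
    refine ⟨(hu.1.mul hv.1 hp hp' hβ hT).mono ?_, fun t ht => (hu.2.1 t ht).mul (hv.2.1 t ht),
      fun i => ?_⟩
    · have : (1 : ℝ) ≤ (2 * (2 + T)) ^ (m + 1) := one_le_pow₀ (by linarith)
      nlinarith
    · have hT2 : 0 ≤ (2 + T) * C := by positivity
      have hT3 : 0 ≤ (2 + T) * A := by positivity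
      have h1 := ih (hu.2.2 i) (hv.pred hex hp' hT) (by linarith) hp' hA hT2 (by positivity)
      have h2 := ih (hu.pred hex hp hT) (hv.2.2 i) hp (by linarith) hT3 hC (by positivity)
      have h1' : XS T β ex m (p + p' + 1) _ _ := h1.weight_mono (by linarith) hT
      have h2' : XS T β ex m (p + p' + 1) _ _ := h2.weight_mono (by linarith) hT
      refine ((h1'.add h2').mono (le_of_eq ?_)).congr fun t ht x => ?_
      · ring
      · exact pd_mul i (hu.2.1 t ht x) (hv.2.1 t ht x)

lemma level_le (hex : GoodEx ex κ) {M : ℕ} (hmM : m ≤ M) (h : XS T β ex M p C v) (hp : 0 ≤ p)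
    (hT : 0 ≤ T) : ∃ C', XS T β ex m p C' v := by
  induction M, hmM using Nat.le_induction generalizing C with
  | base => exact ⟨C, h⟩
  | succ M _ ih => exact ih (h.pred hex hp hT)

lemma lim {vk : ℕ → ℝ → Spc n → ℝ} {a : ℕ → ℝ} (hp : 0 ≤ p) (ha : Tendsto a atTop (nhds 0))
    (hd : ∀ k l, k ≤ l → XS T β ex m p (a k) (fun t x => vk l t x - vk k t x))
    (hk : ∀ k, ∃ C, XS T β ex m p C (vk k)) :
    ∀ k, XS T β ex m p (a k)
      (fun t x => limUnder atTop (fun k => vk k t x) - vk k t x) := by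
  have base : ∀ {e p : ℝ} {vk : ℕ → ℝ → Spc n → ℝ},
      (∀ k l, k ≤ l → HB T β e p (a k) (fun t x => vk l t x - vk k t x)) →
      (∀ t ∈ Set.Icc 0 T, ∀ x, Tendsto (fun k => vk k t x) atTop
        (nhds (limUnder atTop (fun k => vk k t x)))) ∧
      ∀ k, HB T β e p (a k) (fun t x => limUnder atTop (fun k => vk k t x) - vk k t x) := by
    intro e p vk hd
    have hlim : ∀ t ∈ Set.Icc 0 T, ∀ x, Tendsto (fun k => vk k t x) atTop
        (nhds (limUnder atTop (fun k => vk k t x))) := by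
      intro t ht x
      refine tendsto_nhds_limUnder (cauchySeq_tendsto_of_complete ?_)
      refine cauchySeq_of_le_tendsto_0 (fun k => 2 * (a k * Real.exp (β * t) * wt x ^ (-p)))
        (fun i j N hi hj => ?_) ?_
      · have h1 := (hd N i hi).bd t ht x
        have h2 := (hd N j hj).bd t ht x
        rw [Real.dist_eq]
        rw [Real.norm_eq_abs] at h1 h2
        calc |vk i t x - vk j t x| = |(vk i t x - vk N t x) - (vk j t x - vk N t x)| := by
              congr 1; ring
          _ ≤ _ := abs_sub _ _
          _ ≤ _ := by linarith
      · have := ((ha.mul_const (Real.exp (β * t))).mul_const (wt x ^ (-p))).const_mul 2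
        simpa using this
    refine ⟨hlim, fun k => HB.lim (vk := fun l t x => vk (l + k) t x - vk k t x)
      (fun l => hd k (l + k) (Nat.le_add_left _ _)) fun t ht x => ?_⟩
    exact (((tendsto_add_atTop_iff_nat k).2 (hlim t ht x)).sub_const _)
  induction m generalizing p vk with
  | zero => exact (base hd).2
  | succ m ih =>
    obtain ⟨hlim, hHB⟩ := base (fun k l hkl => (hd k l hkl).1)
    have hdk : ∀ k, ∀ t ∈ Set.Icc 0 T, Differentiable ℝ (vk k t) := by
      intro k
      obtain ⟨C, hC⟩ := hk k
      exact hC.2.1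
    have hi : ∀ i k, XS T β ex m (p + 1) (a k) (fun t x =>
        limUnder atTop (fun k => NSdeRham.dx i (vk k) t x) - NSdeRham.dx i (vk k) t x) := by
      intro i
      refine ih (by linarith) (fun k l hkl => ?_) (fun k => ?_)
      · exact ((hd k l hkl).2.2 i).congr fun t ht x => (pd_sub i (hdk l t ht x) (hdk k t ht x)).symm
      · obtain ⟨C, hC⟩ := hk k
        exact ⟨C, hC.2.2 i⟩
    have hfd : ∀ t ∈ Set.Icc 0 T, ∀ x, HasFDerivAt (fun x => limUnder atTop (fun k => vk k t x))
        (∑ i, limUnder atTop (fun k => NSdeRham.dx i (vk k) t x) •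
          (EuclideanSpace.proj i : Spc n →L[ℝ] ℝ)) x := by
      intro t ht x
      refine hasFDerivAt_of_tendstoUniformly (l := atTop) (f := fun k => vk k t)
        (f' := fun k x => fderiv ℝ (vk k t) x)
        (g' := fun x => ∑ i, limUnder atTop (fun k => NSdeRham.dx i (vk k) t x) •
          (EuclideanSpace.proj i : Spc n →L[ℝ] ℝ)) ?_
        (fun k x => (hdk k t ht x).hasFDerivAt) (fun x => hlim t ht x) x
      rw [Metric.tendstoUniformly_iff]
      intro ε hε
      have hsm : Tendsto (fun k => ∑ _i : Fin n, |a k| * Real.exp (β * t) * 1 ^ (-(p + 1)))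
          atTop (nhds 0) := by
        have := (((ha.abs.mul_const (Real.exp (β * t))).mul_const
          ((1 : ℝ) ^ (-(p + 1)))).const_mul (n : ℝ))
        simpa using this
      filter_upwards [hsm.eventually (gt_mem_nhds hε), eventually_ge_atTop 0] with k hk1 _ y
      refine lt_of_le_of_lt ?_ hk1
      rw [dist_eq_norm, fderiv_eq_sum_pd, ← Finset.sum_sub_distrib]
      simp only [← sub_smul]
      refine (norm_sum_smul_proj_le _).trans (Finset.sum_le_sum fun i _ => ?_)
      refine ((hi i k).hb.bd t ht y).trans ?_
      have hw : wt y ^ (-(p + 1)) ≤ (1 : ℝ) ^ (-(p + 1)) := by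
        rw [Real.one_rpow]
        exact Real.rpow_le_one_of_one_le_of_nonpos (one_le_wt y) (by linarith)
      have hk0 := le_abs_self (a k)
      have hw0 := (Real.rpow_pos_of_pos (wt_pos y) (-(p + 1))).le
      gcongr
    refine fun k => ⟨hHB k, fun t ht x => ((hfd t ht x).differentiableAt).sub (hdk k t ht x),
      fun i => (hi i k).congr fun t ht x => ?_⟩
    unfold NSdeRham.dx
    rw [pd_sub i (hfd t ht x).differentiableAt (hdk k t ht x)]
    congr 1
    unfold pd
    rw [(hfd t ht x).fderiv]
    simp [NSdeRham.dx, pd]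

end XS

/-! ### Averaging operators of heat type -/

namespace HB

variable {F : Type*} [NormedAddCommGroup F] {T β e p C : ℝ}

lemma integral {Z : Type*} [MeasurableSpace Z] {π : Measure Z} [NormedSpace ℝ F]
    {w : Z → ℝ → Spc n → F} {M : Z → ℝ}
    (hM : Integrable M π) (hw : ∀ᵐ z ∂π, HB T β e p (M z) (w z))
    (hint : ∀ t ∈ Set.Icc 0 T, ∀ x, Integrable (fun z => w z t x) π) :
    HB T β e p (∫ z, M z ∂π) (fun t x => ∫ z, w z t x ∂π) where
  bd t ht x := by
    rw [mul_assoc, ← integral_mul_const]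
    refine norm_integral_le_of_norm_le (hM.mul_const _) ?_
    filter_upwards [hw] with z hz
    rw [← mul_assoc]
    exact hz.bd t ht x
  sp t ht x y := by
    rw [mul_assoc, mul_assoc, ← integral_mul_const, ← integral_sub (hint t ht x) (hint t ht y)]
    refine norm_integral_le_of_norm_le (hM.mul_const _) ?_
    filter_upwards [hw] with z hz
    rw [← mul_assoc, ← mul_assoc]
    exact hz.sp t ht x y
  tm s t hs hst ht x := by
    rw [mul_assoc, mul_assoc, ← integral_mul_const,
      ← integral_sub (hint t ⟨hs.trans hst, ht⟩ x) (hint s ⟨hs, hst.trans ht⟩ x)]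
    refine norm_integral_le_of_norm_le (hM.mul_const _) ?_
    filter_upwards [hw] with z hz
    rw [← mul_assoc, ← mul_assoc]
    exact hz.tm s t hs hst ht x

end HB

lemma sqrt_sub_sqrt_le {a b : ℝ} (ha : 0 ≤ a) (hab : a ≤ b) : √b - √a ≤ √(b - a) := by
  have h1 := Real.sqrt_nonneg (b - a)
  have h2 := Real.sqrt_nonneg a
  have h3 : √b ≤ √(b - a) + √a := by
    refine Real.sqrt_le_iff.2 ⟨by positivity, ?_⟩
    nlinarith [Real.sq_sqrt ha, Real.sq_sqrt (sub_nonneg.2 hab), mul_nonneg h1 h2]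
  linarith

/-- Truncation of the time variable to `[0,T]`. -/
def cl (T t : ℝ) : ℝ := max 0 (min t T)

lemma cl_mem {T : ℝ} (hT : 0 ≤ T) (t : ℝ) : cl T t ∈ Set.Icc 0 T :=
  ⟨le_max_left _ _, max_le hT (min_le_right _ _)⟩

lemma cl_eq {T t : ℝ} (ht : t ∈ Set.Icc 0 T) : cl T t = t := by
  unfold cl
  rw [min_eq_left ht.2, max_eq_right ht.1]

lemma continuous_cl (T : ℝ) : Continuous (cl T) := by
  unfold cl
  fun_prop

lemma mul_one_sub_mem {T t r : ℝ} (ht : t ∈ Set.Icc 0 T) (hr : 0 < r) (hr1 : r ≤ 1) :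
    t * (1 - r) ∈ Set.Icc 0 T := by
  obtain ⟨h0, h1⟩ := ht
  constructor
  · exact mul_nonneg h0 (by linarith)
  · nlinarith

/-- The integrand of the averaging operators of heat type. -/
def ho (c T : ℝ) (a : ℝ → ℝ) (Q : ℝ × Spc n → ℝ) (h : ℝ → Spc n → ℝ) (z : ℝ × Spc n)
    (t : ℝ) (x : Spc n) : ℝ :=
  a t * Q z * h (cl T (t * (1 - z.1))) (x + √(c * t * z.1) • z.2)

/-- The constant in the estimates of averaging operators of heat type. -/
def hoC (c T N : ℝ) : ℝ := (3 + c) * (1 + √(c * T)) ^ N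

lemma hoC_pos {c T : ℝ} (hc : 0 ≤ c) (N : ℝ) : 0 < hoC c T N := by
  have := Real.sqrt_nonneg (c * T)
  unfold hoC
  positivity

set_option maxHeartbeats 1000000 in
lemma hb_ho {c T β e p C N : ℝ} {a η : ℝ → ℝ} {Q : ℝ × Spc n → ℝ} {h : ℝ → Spc n → ℝ}
    (hc : 0 ≤ c) (hT : 0 ≤ T) (hβ : 0 ≤ β) (he : 0 ≤ e) (he1 : e ≤ 1) (hp : 0 ≤ p)
    (hN : p + e ≤ N) (hh : HB T β e p C h) {z : ℝ × Spc n} (hz : 0 < z.1) (hz1 : z.1 ≤ 1)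
    (ha : ∀ t ∈ Set.Icc 0 T, |a t| * Real.exp (-(β * t * z.1)) ≤ η z.1)
    (hd : ∀ s t, 0 ≤ s → s ≤ t → t ≤ T →
      |a t - a s| * Real.exp (-(β * t * z.1)) ≤ η z.1 * (t - s) ^ (e / 2)) :
    HB T β e p (hoC c T N * (|Q z| * η z.1 * (1 + ‖z.2‖) ^ (N + 1)) * C) (ho c T a Q h z) := by
  obtain ⟨r, ζ⟩ := z
  simp only at hz hz1 ha hd ⊢
  have hC := hh.const_nonneg hT
  have hη : 0 ≤ η r := le_trans (by positivity) (ha 0 ⟨le_rfl, hT⟩)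
  set S := √(c * T) with hS
  have hS0 : 0 ≤ S := Real.sqrt_nonneg _
  have hζ := norm_nonneg ζ
  have hσ : ∀ t ∈ Set.Icc 0 T, ‖√(c * t * r) • ζ‖ ≤ S * ‖ζ‖ := by
    intro t ht
    rw [norm_smul, Real.norm_of_nonneg (Real.sqrt_nonneg _)]
    refine mul_le_mul_of_nonneg_right (Real.sqrt_le_sqrt ?_) hζ
    have := ht.1
    calc c * t * r ≤ c * t * 1 := by gcongr
      _ ≤ c * T := by rw [mul_one]; exact mul_le_mul_of_nonneg_left ht.2 hc
  set B := (1 + S) ^ N * (1 + ‖ζ‖) ^ N with hB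
  have hN0 : 0 ≤ N := by linarith
  have hB0 : 0 ≤ B := by positivity
  have hb1 : ∀ t ∈ Set.Icc 0 T, 1 + ‖√(c * t * r) • ζ‖ ≤ (1 + S) * (1 + ‖ζ‖) := by
    intro t ht
    have := hσ t ht
    nlinarith
  have hone : 1 ≤ (1 + S) * (1 + ‖ζ‖) := by nlinarith [mul_nonneg hS0 hζ]
  have hw : ∀ t ∈ Set.Icc 0 T, ∀ x : Spc n, ∀ q, 0 ≤ q → q ≤ N →
      wt (x + √(c * t * r) • ζ) ^ (-q) ≤ B * wt x ^ (-q) := by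
    intro t ht x q hq hqN
    rw [hB, ← Real.mul_rpow (by positivity) (by positivity)]
    refine rpow_neg_le_of_le_mul (wt_pos _) (wt_pos _) hone
      ((wt_le_shift x (√(c * t * r) • ζ)).trans ?_) hq hqN
    exact mul_le_mul_of_nonneg_right (hb1 t ht) (wt_pos _).le
  have hexp : ∀ t, Real.exp (β * (t * (1 - r))) = Real.exp (β * t) * Real.exp (-(β * t * r)) := by
    intro t
    rw [← Real.exp_add]
    congr 1
    ring
  have hB1 : B ≤ (1 + S) ^ N * (1 + ‖ζ‖) ^ (N + 1) := by
    rw [hB]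
    gcongr
    · linarith
    · linarith
  have hK : ∀ {m : ℝ}, m ≤ 3 + c → 0 ≤ m →
      m * (|Q (r, ζ)| * η r * B * C) ≤
        hoC c T N * (|Q (r, ζ)| * η r * (1 + ‖ζ‖) ^ (N + 1)) * C := by
    intro m hm hm0
    calc m * (|Q (r, ζ)| * η r * B * C)
        ≤ (3 + c) * (|Q (r, ζ)| * η r * ((1 + S) ^ N * (1 + ‖ζ‖) ^ (N + 1)) * C) := by gcongr
      _ = _ := by unfold hoC; ring
  refine ⟨fun t ht x => ?_, fun t ht x y => ?_, fun s t hs hst ht x => ?_⟩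
  · unfold ho
    have hm := mul_one_sub_mem ht hz hz1
    rw [cl_eq hm, norm_mul, norm_mul, Real.norm_eq_abs, Real.norm_eq_abs]
    have h1 := hh.bd _ hm (x + √(c * t * r) • ζ)
    rw [hexp] at h1
    have h2 := hw t ht x p hp (by linarith)
    have hwx := (Real.rpow_pos_of_pos (wt_pos x) (-p)).le
    calc |a t| * |Q (r, ζ)| * ‖h (t * (1 - r)) (x + √(c * t * r) • ζ)‖
        ≤ |a t| * |Q (r, ζ)| * (C * (Real.exp (β * t) * Real.exp (-(β * t * r))) *
            (B * wt x ^ (-p))) := by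
          refine mul_le_mul_of_nonneg_left (h1.trans ?_) (by positivity)
          gcongr
      _ = 1 * (|Q (r, ζ)| * (|a t| * Real.exp (-(β * t * r))) * B * C) *
            Real.exp (β * t) * wt x ^ (-p) := by ring
      _ ≤ 1 * (|Q (r, ζ)| * η r * B * C) * Real.exp (β * t) * wt x ^ (-p) := by
          have := ha t ht
          gcongr
      _ ≤ _ := by
          have := hK (m := 1) (by linarith) zero_le_one
          gcongr
  · unfold ho
    have hm := mul_one_sub_mem ht hz hz1
    rw [cl_eq hm, ← mul_sub, norm_mul, norm_mul, Real.norm_eq_abs, Real.norm_eq_abs]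
    have h1 := hh.sp _ hm (x + √(c * t * r) • ζ) (y + √(c * t * r) • ζ)
    rw [hexp, add_sub_add_right_eq_sub] at h1
    have h2 : wtm (x + √(c * t * r) • ζ) (y + √(c * t * r) • ζ) ^ (-(p + e)) ≤
        B * wtm x y ^ (-(p + e)) := by
      rw [hB, ← Real.mul_rpow (by positivity) (by positivity)]
      refine rpow_neg_le_of_le_mul (wtm_pos _ _) (wtm_pos _ _) hone
        ((wtm_le_shift x y (√(c * t * r) • ζ)).trans ?_) (by linarith) hN
      exact mul_le_mul_of_nonneg_right (hb1 t ht) (wtm_pos _ _).le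
    have hwx := (Real.rpow_pos_of_pos (wtm_pos x y) (-(p + e))).le
    calc |a t| * |Q (r, ζ)| * ‖h (t * (1 - r)) (x + √(c * t * r) • ζ) -
            h (t * (1 - r)) (y + √(c * t * r) • ζ)‖
        ≤ |a t| * |Q (r, ζ)| * (C * (Real.exp (β * t) * Real.exp (-(β * t * r))) *
            ‖x - y‖ ^ e * (B * wtm x y ^ (-(p + e)))) := by
          refine mul_le_mul_of_nonneg_left (h1.trans ?_) (by positivity)
          gcongr
      _ = 1 * (|Q (r, ζ)| * (|a t| * Real.exp (-(β * t * r))) * B * C) *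
            Real.exp (β * t) * ‖x - y‖ ^ e * wtm x y ^ (-(p + e)) := by ring
      _ ≤ 1 * (|Q (r, ζ)| * η r * B * C) * Real.exp (β * t) * ‖x - y‖ ^ e *
            wtm x y ^ (-(p + e)) := by
          have := ha t ht
          gcongr
      _ ≤ _ := by
          have := hK (m := 1) (by linarith) zero_le_one
          gcongr
  · have htI : t ∈ Set.Icc 0 T := ⟨hs.trans hst, ht⟩
    have hsI : s ∈ Set.Icc 0 T := ⟨hs, hst.trans ht⟩
    have hmt := mul_one_sub_mem htI hz hz1
    have hms := mul_one_sub_mem hsI hz hz1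
    have hwx := (Real.rpow_pos_of_pos (wt_pos x) (-p)).le
    have hts : 0 ≤ t - s := by linarith
    have hτ := Real.rpow_nonneg hts (e / 2)
    set X := x + √(c * t * r) • ζ with hX
    set Y := x + √(c * s * r) • ζ with hY
    have hE : Real.exp (β * (s * (1 - r))) ≤ Real.exp (β * (t * (1 - r))) := by
      have : 0 ≤ 1 - r := by linarith
      gcongr
    have hws : wt Y ^ (-p) ≤ B * wt x ^ (-p) := hw s hsI x p hp (by linarith)
    have hwt : wt X ^ (-p) ≤ B * wt x ^ (-p) := hw t htI x p hp (by linarith)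
    have hwm : wtm X Y ^ (-(p + e)) ≤ B * wt x ^ (-p) := by
      have h1 : wtm X Y ^ (-(p + e)) ≤ B * wt x ^ (-(p + e)) := by
        rw [hB, ← Real.mul_rpow (by positivity) (by positivity)]
        refine rpow_neg_le_of_le_mul (wt_pos _) (wtm_pos _ _) hone ?_ (by linarith) hN
        unfold wtm
        rw [mul_min_of_nonneg _ _ (by positivity)]
        refine le_min ((wt_le_shift x (√(c * t * r) • ζ)).trans ?_)
          ((wt_le_shift x (√(c * s * r) • ζ)).trans ?_)
        · exact mul_le_mul_of_nonneg_right (hb1 t htI) (wt_pos _).le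
        · exact mul_le_mul_of_nonneg_right (hb1 s hsI) (wt_pos _).le
      refine h1.trans (mul_le_mul_of_nonneg_left ?_ hB0)
      exact Real.rpow_le_rpow_of_exponent_le (one_le_wt x) (by linarith)
    have hXY : ‖X - Y‖ ^ e ≤ (1 + c) * (t - s) ^ (e / 2) * (1 + ‖ζ‖) := by
      have h1 : ‖X - Y‖ ≤ √c * √(t - s) * ‖ζ‖ := by
        rw [hX, hY, add_sub_add_left_eq_sub, ← sub_smul, norm_smul, Real.norm_eq_abs]
        refine mul_le_mul_of_nonneg_right ?_ hζ
        have h2 : c * s * r ≤ c * t * r := by gcongr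
        rw [abs_of_nonneg (sub_nonneg.2 (Real.sqrt_le_sqrt h2)), ← Real.sqrt_mul hc]
        refine (sqrt_sub_sqrt_le (by positivity) h2).trans (Real.sqrt_le_sqrt ?_)
        have : 0 ≤ c * (t - s) := by positivity
        nlinarith
      have h3 : √c ^ e ≤ 1 + c := by
        rcases le_total (√c) 1 with h | h
        · exact (Real.rpow_le_one (Real.sqrt_nonneg _) h he).trans (by linarith)
        · calc √c ^ e ≤ √c ^ (2 : ℝ) := Real.rpow_le_rpow_of_exponent_le h (by linarith)
            _ = c := by rw [Real.rpow_two, Real.sq_sqrt hc]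
            _ ≤ _ := by linarith
      have h4 : ‖ζ‖ ^ e ≤ 1 + ‖ζ‖ := by
        calc ‖ζ‖ ^ e ≤ (1 + ‖ζ‖) ^ e := Real.rpow_le_rpow hζ (by linarith) he
          _ ≤ (1 + ‖ζ‖) ^ (1 : ℝ) := Real.rpow_le_rpow_of_exponent_le (by linarith) he1
          _ = _ := Real.rpow_one _
      have h5 : √(t - s) ^ e = (t - s) ^ (e / 2) := by
        rw [Real.sqrt_eq_rpow, ← Real.rpow_mul hts]
        congr 1
        ring
      calc ‖X - Y‖ ^ e ≤ (√c * √(t - s) * ‖ζ‖) ^ e := Real.rpow_le_rpow (norm_nonneg _) h1 he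
        _ = √c ^ e * √(t - s) ^ e * ‖ζ‖ ^ e := by
            rw [Real.mul_rpow (by positivity) hζ,
              Real.mul_rpow (Real.sqrt_nonneg _) (Real.sqrt_nonneg _)]
        _ ≤ _ := by rw [h5]; gcongr
    have h1 := hh.tm _ _ hms.1 (mul_le_mul_of_nonneg_right hst (by linarith)) hmt.2 Y
    have h2 := hh.sp _ hmt X Y
    have h3 := hh.bd _ hmt X
    have hτ1 : (t * (1 - r) - s * (1 - r)) ^ (e / 2) ≤ (t - s) ^ (e / 2) := by
      rw [← sub_mul]
      refine Real.rpow_le_rpow (mul_nonneg hts (by linarith)) ?_ (by linarith)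
      nlinarith
    have hsplit : ho c T a Q h (r, ζ) t x - ho c T a Q h (r, ζ) s x =
        (a t - a s) * Q (r, ζ) * h (t * (1 - r)) X +
        a s * Q (r, ζ) * ((h (t * (1 - r)) X - h (t * (1 - r)) Y) +
          (h (t * (1 - r)) Y - h (s * (1 - r)) Y)) := by
      unfold ho
      simp only [cl_eq hmt, cl_eq hms, ← hX, ← hY]
      ring
    have has : |a s| * Real.exp (-(β * t * r)) ≤ η r := by
      refine le_trans ?_ (ha s hsI)
      gcongr
    have hat := hd s t hs hst ht
    rw [hsplit]
    have hA : ‖(a t - a s) * Q (r, ζ) * h (t * (1 - r)) X‖ ≤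
        (|Q (r, ζ)| * η r * B * C) * Real.exp (β * t) * (t - s) ^ (e / 2) * wt x ^ (-p) := by
      rw [norm_mul, norm_mul, Real.norm_eq_abs, Real.norm_eq_abs]
      calc |a t - a s| * |Q (r, ζ)| * ‖h (t * (1 - r)) X‖
          ≤ |a t - a s| * |Q (r, ζ)| *
            (C * (Real.exp (β * t) * Real.exp (-(β * t * r))) * (B * wt x ^ (-p))) := by
            rw [hexp] at h3
            refine mul_le_mul_of_nonneg_left (h3.trans ?_) (by positivity)
            gcongr
        _ = |Q (r, ζ)| * (|a t - a s| * Real.exp (-(β * t * r))) * B * C *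
              Real.exp (β * t) * wt x ^ (-p) := by ring
        _ ≤ |Q (r, ζ)| * (η r * (t - s) ^ (e / 2)) * B * C *
              Real.exp (β * t) * wt x ^ (-p) := by gcongr
        _ = _ := by ring
    have hD : ‖a s * Q (r, ζ) * ((h (t * (1 - r)) X - h (t * (1 - r)) Y) +
          (h (t * (1 - r)) Y - h (s * (1 - r)) Y))‖ ≤
        ((1 + (1 + c) * (1 + ‖ζ‖)) * (|Q (r, ζ)| * η r * B * C)) * Real.exp (β * t) *
          (t - s) ^ (e / 2) * wt x ^ (-p) := by
      rw [norm_mul, norm_mul, Real.norm_eq_abs, Real.norm_eq_abs]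
      have h4 : ‖(h (t * (1 - r)) X - h (t * (1 - r)) Y) +
          (h (t * (1 - r)) Y - h (s * (1 - r)) Y)‖ ≤
          C * Real.exp (β * (t * (1 - r))) * ((1 + c) * (t - s) ^ (e / 2) * (1 + ‖ζ‖)) *
            (B * wt x ^ (-p)) +
          C * Real.exp (β * (t * (1 - r))) * (t - s) ^ (e / 2) * (B * wt x ^ (-p)) := by
        refine (norm_add_le _ _).trans (add_le_add (h2.trans ?_) (h1.trans ?_))
        · have := (wtm_pos X Y).le
          gcongr
        · have := (wt_pos Y).le
          gcongr
      calc |a s| * |Q (r, ζ)| * _ ≤ |a s| * |Q (r, ζ)| * _ :=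
            mul_le_mul_of_nonneg_left h4 (by positivity)
        _ = |Q (r, ζ)| * (|a s| * Real.exp (-(β * t * r))) * B * C *
              (1 + (1 + c) * (1 + ‖ζ‖)) *
              Real.exp (β * t) * (t - s) ^ (e / 2) * wt x ^ (-p) := by rw [hexp]; ring
        _ ≤ |Q (r, ζ)| * η r * B * C *
              (1 + (1 + c) * (1 + ‖ζ‖)) *
              Real.exp (β * t) * (t - s) ^ (e / 2) * wt x ^ (-p) := by gcongr
        _ = _ := by ring
    refine (norm_add_le _ _).trans ((add_le_add hA hD).trans ?_)
    have hfin : (|Q (r, ζ)| * η r * B * C) +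
        ((1 + (1 + c) * (1 + ‖ζ‖)) * (|Q (r, ζ)| * η r * B * C)) ≤
        hoC c T N * (|Q (r, ζ)| * η r * (1 + ‖ζ‖) ^ (N + 1)) * C := by
      have h6 : (1 + ‖ζ‖) ^ (N + 1) = (1 + ‖ζ‖) ^ N * (1 + ‖ζ‖) := by
        rw [Real.rpow_add (by linarith), Real.rpow_one]
      have h7 : 0 ≤ |Q (r, ζ)| * η r * B * C := by positivity
      calc _ = (2 + (1 + c) * (1 + ‖ζ‖)) * (|Q (r, ζ)| * η r * B * C) := by ring
        _ ≤ ((3 + c) * (1 + ‖ζ‖)) * (|Q (r, ζ)| * η r * B * C) := by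
          refine mul_le_mul_of_nonneg_right ?_ h7
          nlinarith
        _ = _ := by unfold hoC; rw [h6, hB]; ring
    calc _ = (|Q (r, ζ)| * η r * B * C +
          ((1 + (1 + c) * (1 + ‖ζ‖)) * (|Q (r, ζ)| * η r * B * C))) * Real.exp (β * t) *
          (t - s) ^ (e / 2) * wt x ^ (-p) := by ring
      _ ≤ _ := by gcongr

/-- Averaging operator of heat type. -/
def hop (π : Measure (ℝ × Spc n)) (c T : ℝ) (a : ℝ → ℝ) (Q : ℝ × Spc n → ℝ)
    (h : ℝ → Spc n → ℝ) (t : ℝ) (x : Spc n) : ℝ :=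
  ∫ z, ho c T a Q h z t x ∂π

/-- Admissible kernels of averaging operators of heat type. -/
structure HoKer (π : Measure (ℝ × Spc n)) (T β κ N : ℝ) (a η : ℝ → ℝ)
    (Q : ℝ × Spc n → ℝ) : Prop where
  ae : ∀ᵐ z ∂π, 0 < z.1 ∧ z.1 ≤ 1
  meas : AEStronglyMeasurable Q π
  int : Integrable (fun z => |Q z| * η z.1 * (1 + ‖z.2‖) ^ (N + 1)) π
  ha : ∀ r, 0 < r → r ≤ 1 → ∀ t ∈ Set.Icc 0 T, |a t| * Real.exp (-(β * t * r)) ≤ η r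
  hd : ∀ r, 0 < r → r ≤ 1 → ∀ e, 0 ≤ e → e ≤ 1 - 2 * κ → ∀ s t, 0 ≤ s → s ≤ t → t ≤ T →
      |a t - a s| * Real.exp (-(β * t * r)) ≤ η r * (t - s) ^ (e / 2)

section hop

variable {π : Measure (ℝ × Spc n)} {c T β e p C κ N : ℝ} {a η : ℝ → ℝ} {Q : ℝ × Spc n → ℝ}
  {h : ℝ → Spc n → ℝ}

lemma continuous_comp_cl (hT : 0 ≤ T) {Z : Type*} [TopologicalSpace Z]
    (hh : ContinuousOn (fun q : ℝ × Spc n => h q.1 q.2) (Set.Icc 0 T ×ˢ Set.univ))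
    {f : Z → ℝ} {g : Z → Spc n} (hf : Continuous f) (hg : Continuous g) :
    Continuous fun z => h (cl T (f z)) (g z) :=
  hh.comp_continuous (f := fun z => (cl T (f z), g z)) (((continuous_cl T).comp hf).prodMk hg)
    fun _ => ⟨cl_mem hT _, Set.mem_univ _⟩

lemma hb_hop_aux (K : HoKer π T β κ N a η Q) (hc : 0 ≤ c) (hT : 0 ≤ T) (hβ : 0 ≤ β) (he : 0 < e)
    (hκ : 0 < κ) (he1 : e ≤ 1 - 2 * κ) (hp : 0 ≤ p) (hN : p + e ≤ N) (hh : HB T β e p C h) :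
    (∀ᵐ z ∂π, HB T β e p (hoC c T N * (|Q z| * η z.1 * (1 + ‖z.2‖) ^ (N + 1)) * C)
      (ho c T a Q h z)) ∧
    ∀ t ∈ Set.Icc 0 T, ∀ x, Integrable (fun z => ho c T a Q h z t x) π := by
  have h1 : ∀ᵐ z ∂π, HB T β e p (hoC c T N * (|Q z| * η z.1 * (1 + ‖z.2‖) ^ (N + 1)) * C)
      (ho c T a Q h z) := by
    filter_upwards [K.ae] with z hz
    exact hb_ho hc hT hβ he.le (by linarith) hp hN hh hz.1 hz.2 (K.ha _ hz.1 hz.2)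
      (K.hd _ hz.1 hz.2 e he.le he1)
  refine ⟨h1, fun t ht x => ?_⟩
  refine Integrable.mono' (((K.int.const_mul (hoC c T N)).mul_const C).mul_const
    (Real.exp (β * t) * wt x ^ (-p))) ?_ ?_
  · unfold ho
    refine (K.meas.const_mul (a t)).mul (Continuous.aestronglyMeasurable ?_)
    exact continuous_comp_cl hT (hh.continuousOn he hp hβ) (by fun_prop) (by fun_prop)
  · filter_upwards [h1] with z hz
    rw [← mul_assoc]
    exact hz.bd t ht x

lemma hb_hop (K : HoKer π T β κ N a η Q) (hc : 0 ≤ c) (hT : 0 ≤ T) (hβ : 0 ≤ β) (he : 0 < e)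
    (hκ : 0 < κ) (he1 : e ≤ 1 - 2 * κ) (hp : 0 ≤ p) (hN : p + e ≤ N) (hh : HB T β e p C h) :
    HB T β e p (hoC c T N * (∫ z, |Q z| * η z.1 * (1 + ‖z.2‖) ^ (N + 1) ∂π) * C)
      (hop π c T a Q h) := by
  obtain ⟨h1, h2⟩ := hb_hop_aux K hc hT hβ he hκ he1 hp hN hh
  have h3 := HB.integral ((K.int.const_mul (hoC c T N)).mul_const C) h1 h2
  rwa [integral_mul_const, integral_const_mul] at h3

lemma hasFDerivAt_hop (K : HoKer π T β κ N a η Q) (hc : 0 ≤ c) (hT : 0 ≤ T) (hβ : 0 ≤ β)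
    (he : 0 < e) (hκ : 0 < κ) (he1 : e ≤ 1 - 2 * κ) (hp : 0 ≤ p) (hN : p + 1 + e ≤ N)
    (hh : HB T β e p C h) {e' C' : ℝ} (he' : 0 < e') (hN1 : 0 ≤ N + 1)
    (hd : ∀ t ∈ Set.Icc 0 T, Differentiable ℝ (h t))
    (hi : ∀ i, HB T β e' (p + 1) C' (dx i h)) {t : ℝ} (ht : t ∈ Set.Icc 0 T) (x : Spc n) :
    DifferentiableAt ℝ (hop π c T a Q h t) x ∧
    ∀ i, pd i (hop π c T a Q h t) x = hop π c T a Q (dx i h) t x := by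
  obtain ⟨-, hint⟩ := hb_hop_aux K hc hT hβ he hκ he1 hp (by linarith) hh
  set L : Spc n → ℝ × Spc n → (Spc n →L[ℝ] ℝ) := fun x z =>
    (a t * Q z) • fderiv ℝ (h (cl T (t * (1 - z.1)))) (x + √(c * t * z.1) • z.2) with hL
  have hcont : ∀ i x, AEStronglyMeasurable
      (fun z : ℝ × Spc n => dx i h (cl T (t * (1 - z.1))) (x + √(c * t * z.1) • z.2)) π := by
    intro i x
    exact (continuous_comp_cl hT ((hi i).continuousOn he' (by linarith) hβ)
      (by fun_prop) (by fun_prop)).aestronglyMeasurable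
  have hmeas : ∀ x, AEStronglyMeasurable (L x) π := by
    intro x
    refine (K.meas.const_mul (a t)).smul ?_
    have : (fun z : ℝ × Spc n => fderiv ℝ (h (cl T (t * (1 - z.1)))) (x + √(c * t * z.1) • z.2)) =
        fun z => ∑ i, dx i h (cl T (t * (1 - z.1))) (x + √(c * t * z.1) • z.2) •
          (EuclideanSpace.proj i : Spc n →L[ℝ] ℝ) := by
      ext1 z
      exact fderiv_eq_sum_pd _ _
    rw [this]
    exact Finset.aestronglyMeasurable_fun_sum _ fun i _ => (hcont i x).smul_const _
  have hbound : ∀ᵐ z ∂π, ∀ x ∈ Set.univ, ‖L x z‖ ≤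
      (|Q z| * η z.1 * (1 + ‖z.2‖) ^ (N + 1)) *
        (Real.exp (β * T) * ∑ _i : Fin n, C' * Real.exp (β * T)) := by
    filter_upwards [K.ae] with z hz x _
    have hC' : ∀ i : Fin n, 0 ≤ C' := fun i => (hi i).const_nonneg hT
    have hm := mul_one_sub_mem ht hz.1 hz.2
    have h1 : |a t| ≤ η z.1 * Real.exp (β * T) := by
      have h2 := K.ha _ hz.1 hz.2 t ht
      rw [Real.exp_neg, ← div_eq_mul_inv, div_le_iff₀ (Real.exp_pos _)] at h2
      refine h2.trans ?_
      have h3 : 0 ≤ η z.1 := le_trans (by positivity) (K.ha _ hz.1 hz.2 t ht)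
      have h4 : β * t * z.1 ≤ β * T := by
        have := ht.1
        calc β * t * z.1 ≤ β * t * 1 := by gcongr; exact hz.2
          _ ≤ β * T := by rw [mul_one]; gcongr; exact ht.2
      gcongr
    have h3 : 0 ≤ η z.1 := le_trans (by positivity) (K.ha _ hz.1 hz.2 t ht)
    have h5 : ∀ y i, |dx i h (t * (1 - z.1)) y| ≤ C' * Real.exp (β * T) := by
      intro y i
      refine ((hi i).bd _ hm y).trans ?_
      have hw : wt y ^ (-(p + 1)) ≤ 1 :=
        Real.rpow_le_one_of_one_le_of_nonpos (one_le_wt y) (by linarith)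
      have hw0 := (Real.rpow_pos_of_pos (wt_pos y) (-(p + 1))).le
      have := hC' i
      have hm2 := hm.2
      calc C' * Real.exp (β * (t * (1 - z.1))) * wt y ^ (-(p + 1))
          ≤ C' * Real.exp (β * T) * 1 := by gcongr
        _ = _ := mul_one _
    simp only [hL]
    rw [cl_eq hm, norm_smul, norm_mul, Real.norm_eq_abs, Real.norm_eq_abs, fderiv_eq_sum_pd]
    have h6 : (1 : ℝ) ≤ (1 + ‖z.2‖) ^ (N + 1) :=
      Real.one_le_rpow (by linarith [norm_nonneg z.2]) hN1
    have h7 : ∀ y, ‖∑ i, pd i (h (t * (1 - z.1))) y • (EuclideanSpace.proj i : Spc n →L[ℝ] ℝ)‖ ≤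
        ∑ _i : Fin n, C' * Real.exp (β * T) := fun y =>
      (norm_sum_smul_proj_le _).trans (Finset.sum_le_sum fun i _ => h5 y i)
    have h8 : 0 ≤ ∑ _i : Fin n, C' * Real.exp (β * T) := (norm_nonneg _).trans (h7 0)
    calc |a t| * |Q z| * _ ≤ (η z.1 * Real.exp (β * T)) * |Q z| *
          (∑ _i : Fin n, C' * Real.exp (β * T)) := by gcongr; exact h7 _
      _ = (|Q z| * η z.1 * 1) * (Real.exp (β * T) * ∑ _i : Fin n, C' * Real.exp (β * T)) := by
          ring
      _ ≤ _ := by gcongr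
  have hL' : Integrable (L x) π := by
    refine Integrable.mono' (K.int.mul_const
      (Real.exp (β * T) * ∑ _i : Fin n, C' * Real.exp (β * T))) (hmeas x) ?_
    filter_upwards [hbound] with z hz using hz x (Set.mem_univ _)
  have hder : HasFDerivAt (hop π c T a Q h t) (∫ z, L x z ∂π) x := by
    refine hasFDerivAt_integral_of_dominated_of_fderiv_le (s := Set.univ)
      (F := fun x z => ho c T a Q h z t x) Filter.univ_mem
      (Eventually.of_forall fun y => (hint t ht y).aestronglyMeasurable) (hint t ht x)
      (hmeas x) hbound (K.int.mul_const _) (Eventually.of_forall fun z y _ => ?_)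
    have h1 : HasFDerivAt (h (cl T (t * (1 - z.1))))
        (fderiv ℝ (h (cl T (t * (1 - z.1)))) (y + √(c * t * z.1) • z.2))
        (y + √(c * t * z.1) • z.2) := (hd _ (cl_mem hT _) _).hasFDerivAt
    have h2 := h1.comp y ((hasFDerivAt_id y).add_const (√(c * t * z.1) • z.2))
    exact (h2.const_mul (a t * Q z))
  refine ⟨hder.differentiableAt, fun i => ?_⟩
  unfold pd
  rw [hder.fderiv, ContinuousLinearMap.integral_apply hL']
  rfl

lemma xs_hop {ex : ℕ → ℝ} {m : ℕ} (K : HoKer π T β κ N a η Q) (hex : GoodEx ex κ) (hc : 0 ≤ c)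
    (hT : 0 ≤ T) (hβ : 0 ≤ β) (hp : 0 ≤ p) (hN : p + m + 1 ≤ N) (hh : XS T β ex m p C h) :
    XS T β ex m p (hoC c T N * (∫ z, |Q z| * η z.1 * (1 + ‖z.2‖) ^ (N + 1) ∂π) * C)
      (hop π c T a Q h) := by
  have hκ := hex.kpos
  induction m generalizing p h with
  | zero =>
    have := hex.le 0
    simp only [Nat.cast_zero] at hN
    exact hb_hop K hc hT hβ (hex.pos 0) hκ this hp (by linarith) hh
  | succ m ih =>
    have h1 := hex.le (m + 1)
    have hm : (0 : ℝ) ≤ m := Nat.cast_nonneg m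
    push_cast at hN
    have h2 : ∀ t ∈ Set.Icc 0 T, ∀ x, _ := fun t ht x =>
      hasFDerivAt_hop (c := c) K hc hT hβ (hex.pos _) hκ h1 hp (by linarith) hh.1
        (hex.pos m) (by linarith) hh.2.1 (fun i => (hh.2.2 i).hb) ht x
    refine ⟨hb_hop K hc hT hβ (hex.pos _) hκ h1 hp (by linarith) hh.1, fun t ht x => (h2 t ht x).1,
      fun i => (ih (by linarith) (by linarith) (hh.2.2 i)).congr fun t ht x => (h2 t ht x).2 i⟩

end hop

/-! ### The Gaussian kernel -/

/-- The unnormalised total mass of the Gaussian. -/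
def gMass (n : ℕ) : ℝ := ∫ ζ : Spc n, Real.exp (-(1 / 2) * ‖ζ‖ ^ 2)

/-- The standard Gaussian density. -/
def gk (ζ : Spc n) : ℝ := Real.exp (-(1 / 2) * ‖ζ‖ ^ 2) / gMass n

lemma integral_exp_pos {b : ℝ} (hb : 0 < b) : 0 < ∫ ζ : Spc n, Real.exp (-b * ‖ζ‖ ^ 2) := by
  rw [GaussianFourier.integral_rexp_neg_mul_sq_norm hb]
  positivity

lemma integrable_exp {b : ℝ} (hb : 0 < b) :
    Integrable (fun ζ : Spc n => Real.exp (-b * ‖ζ‖ ^ 2)) := by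
  by_contra h
  exact (integral_exp_pos hb).ne' (integral_undef h)

lemma gMass_pos : 0 < gMass n := integral_exp_pos (by norm_num)

lemma gk_pos (ζ : Spc n) : 0 < gk ζ := div_pos (Real.exp_pos _) gMass_pos

lemma continuous_gk : Continuous (gk : Spc n → ℝ) := by
  unfold gk
  fun_prop

lemma integral_gk : ∫ ζ : Spc n, gk ζ = 1 := by
  unfold gk
  rw [integral_div]
  exact div_self gMass_pos.ne'

lemma one_add_rpow_le_exp (M : ℝ) :
    ∃ C, ∀ r, 0 ≤ r → (1 + r) ^ M ≤ C * Real.exp (r ^ 2 / 4) := by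
  obtain ⟨m, hm⟩ := exists_nat_ge M
  refine ⟨m.factorial * Real.exp 2, fun r hr => ?_⟩
  have h1 := Real.pow_div_factorial_le_exp (1 + r) (by linarith) m
  rw [div_le_iff₀ (by positivity)] at h1
  calc (1 + r) ^ M ≤ (1 + r) ^ (m : ℝ) := Real.rpow_le_rpow_of_exponent_le (by linarith) hm
    _ = (1 + r) ^ m := Real.rpow_natCast _ _
    _ ≤ Real.exp (1 + r) * m.factorial := h1
    _ ≤ Real.exp (2 + r ^ 2 / 4) * m.factorial := by
        refine mul_le_mul_of_nonneg_right (Real.exp_le_exp.2 ?_) (by positivity)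
        nlinarith [sq_nonneg (r / 2 - 1)]
    _ = _ := by rw [Real.exp_add]; ring

lemma integrable_gk_mul_rpow (M : ℝ) :
    Integrable (fun ζ : Spc n => gk ζ * (1 + ‖ζ‖) ^ M) := by
  obtain ⟨C, hC⟩ := one_add_rpow_le_exp M
  refine Integrable.mono' ((integrable_exp (n := n) (b := 1 / 4) (by norm_num)).const_mul
    (C / gMass n)) ?_ (Eventually.of_forall fun ζ => ?_)
  · refine (continuous_gk.mul (Continuous.rpow_const (by fun_prop) fun ζ => Or.inl ?_)
      ).aestronglyMeasurable
    positivity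
  · have h1 : 0 ≤ (1 + ‖ζ‖) ^ M := by positivity
    rw [Real.norm_of_nonneg (mul_nonneg (gk_pos ζ).le h1)]
    have hM := gMass_pos (n := n)
    unfold gk
    calc Real.exp (-(1 / 2) * ‖ζ‖ ^ 2) / gMass n * (1 + ‖ζ‖) ^ M
        ≤ Real.exp (-(1 / 2) * ‖ζ‖ ^ 2) / gMass n * (C * Real.exp (‖ζ‖ ^ 2 / 4)) := by
          gcongr
          exact hC _ (norm_nonneg _)
      _ = C / gMass n * (Real.exp (-(1 / 2) * ‖ζ‖ ^ 2) * Real.exp (‖ζ‖ ^ 2 / 4)) := by ring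
      _ = _ := by
          rw [← Real.exp_add]
          congr 2
          ring

lemma integrable_gk : Integrable (gk : Spc n → ℝ) := by
  simpa using integrable_gk_mul_rpow (n := n) 0

lemma rpow_mul_exp_neg_le {κ y : ℝ} (hκ : 0 < κ) (hκ1 : κ ≤ 1) (hy : 0 ≤ y) :
    y ^ κ * Real.exp (-y) ≤ 1 := by
  have h1 : y ^ κ ≤ Real.exp y := by
    rcases le_total y 1 with h | h
    · exact (Real.rpow_le_one hy h hκ.le).trans (Real.one_le_exp hy)
    · calc y ^ κ ≤ y ^ (1 : ℝ) := Real.rpow_le_rpow_of_exponent_le h hκ1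
        _ = y := Real.rpow_one _
        _ ≤ y + 1 := by linarith
        _ ≤ _ := Real.add_one_le_exp y
  calc y ^ κ * Real.exp (-y) ≤ Real.exp y * Real.exp (-y) := by gcongr
    _ = 1 := by rw [← Real.exp_add, add_neg_cancel, Real.exp_zero]

/-- The measure `dρ dζ` on `(0,1] × ℝⁿ`. -/
def piV (n : ℕ) : Measure (ℝ × Spc n) := (volume.restrict (Set.Ioc (0 : ℝ) 1)).prod volume

/-- The measure `δ₁ ⊗ dζ`. -/
def piP (n : ℕ) : Measure (ℝ × Spc n) := (Measure.dirac (1 : ℝ)).prod volume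

lemma ae_piV : ∀ᵐ z ∂piV n, 0 < z.1 ∧ z.1 ≤ 1 :=
  (Measure.quasiMeasurePreserving_fst (μ := volume.restrict (Set.Ioc (0 : ℝ) 1))
    (ν := (volume : Measure (Spc n)))).ae (ae_restrict_mem measurableSet_Ioc)

lemma ae_piP : ∀ᵐ z ∂piP n, z.1 = 1 :=
  (Measure.quasiMeasurePreserving_fst (μ := Measure.dirac (1 : ℝ))
    (ν := (volume : Measure (Spc n)))).ae (p := fun r => r = 1)
    ((ae_dirac_iff (measurableSet_singleton 1)).2 rfl)

lemma hoKer_small {T β κ N : ℝ} (hT : 0 ≤ T) (hβ : 1 ≤ β) (hκ : 0 < κ) (hκ1 : κ < 1 / 2)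
    {a : ℝ → ℝ} {Q : ℝ × Spc n → ℝ} (ha0 : a 0 = 0)
    (ha : ∀ s t, 0 ≤ s → s ≤ t → t ≤ T → |a t - a s| ≤ (1 + T) * √(t - s))
    (hQ : AEStronglyMeasurable Q (piV n))
    (hint : Integrable (fun z => |Q z| * z.1 ^ (-κ) * (1 + ‖z.2‖) ^ (N + 1)) (piV n)) :
    HoKer (piV n) T β κ N a (fun r => (1 + T) ^ 2 * β ^ (-κ) * r ^ (-κ)) Q := by
  have key : ∀ r, 0 < r → r ≤ 1 → ∀ e, 0 ≤ e → e ≤ 1 - 2 * κ → ∀ s t, 0 ≤ s → s ≤ t → t ≤ T →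
      |a t - a s| * Real.exp (-(β * t * r)) ≤
        (1 + T) ^ 2 * β ^ (-κ) * r ^ (-κ) * (t - s) ^ (e / 2) := by
    intro r hr hr1 e he he1 s t hs hst ht
    have hts : 0 ≤ t - s := by linarith
    have ht0 : 0 ≤ t := by linarith
    have hβ0 : 0 < β := by linarith
    have h1 : √(t - s) ≤ (1 + T) * t ^ κ * (t - s) ^ (e / 2) := by
      have h2 : √(t - s) = (t - s) ^ (1 / 2 - e / 2 - κ) * (t - s) ^ κ * (t - s) ^ (e / 2) := by
        rw [Real.sqrt_eq_rpow, ← Real.rpow_add_of_nonneg hts (by linarith) hκ.le,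
          ← Real.rpow_add_of_nonneg hts (by linarith) (by linarith)]
        congr 1
        ring
      have h3 : (t - s) ^ (1 / 2 - e / 2 - κ) ≤ 1 + T :=
        calc (t - s) ^ (1 / 2 - e / 2 - κ) ≤ (1 + T) ^ (1 / 2 - e / 2 - κ) :=
              Real.rpow_le_rpow hts (by linarith) (by linarith)
          _ ≤ (1 + T) ^ (1 : ℝ) := Real.rpow_le_rpow_of_exponent_le (by linarith) (by linarith)
          _ = 1 + T := Real.rpow_one _
      have h4 : (t - s) ^ κ ≤ t ^ κ := Real.rpow_le_rpow hts (by linarith) hκ.le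
      rw [h2]
      gcongr
    have h5 : t ^ κ * Real.exp (-(β * t * r)) ≤ β ^ (-κ) * r ^ (-κ) := by
      have h6 := rpow_mul_exp_neg_le hκ (by linarith) (y := β * t * r) (by positivity)
      rw [Real.mul_rpow (by positivity) hr.le, Real.mul_rpow hβ0.le ht0] at h6
      rw [Real.rpow_neg hβ0.le, Real.rpow_neg hr.le, ← mul_inv, ← one_div,
        le_div_iff₀ (by positivity)]
      linarith
    calc |a t - a s| * Real.exp (-(β * t * r))
        ≤ ((1 + T) * ((1 + T) * t ^ κ * (t - s) ^ (e / 2))) * Real.exp (-(β * t * r)) := by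
          gcongr
          exact (ha s t hs hst ht).trans (by gcongr)
      _ = (1 + T) ^ 2 * (t ^ κ * Real.exp (-(β * t * r))) * (t - s) ^ (e / 2) := by ring
      _ ≤ (1 + T) ^ 2 * (β ^ (-κ) * r ^ (-κ)) * (t - s) ^ (e / 2) := by gcongr
      _ = _ := by ring
  refine ⟨ae_piV, hQ, ?_, fun r hr hr1 t ht => ?_, key⟩
  · refine (hint.const_mul ((1 + T) ^ 2 * β ^ (-κ))).congr (Eventually.of_forall fun z => ?_)
    simp only
    ring
  · have := key r hr hr1 0 le_rfl (by linarith) 0 t le_rfl ht.1 ht.2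
    simpa [ha0] using this

lemma integrable_rpow_Ioc {a : ℝ} (ha : -1 < a) :
    Integrable (fun r : ℝ => r ^ a) (volume.restrict (Set.Ioc (0 : ℝ) 1)) := by
  have h := intervalIntegral.intervalIntegrable_rpow' (a := 0) (b := 1) ha
  rwa [intervalIntegrable_iff_integrableOn_Ioc_of_le zero_le_one] at h

/-- Heat potential of a source term. -/
def heatV (μ T : ℝ) (h : ℝ → Spc n → ℝ) : ℝ → Spc n → ℝ :=
  hop (piV n) (2 * μ) T (fun t => t) (fun z => gk z.2) h

/-- Spatial derivative of the heat potential of a source term. -/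
def heatVD (μ T : ℝ) (i : Fin n) (h : ℝ → Spc n → ℝ) : ℝ → Spc n → ℝ :=
  hop (piV n) (2 * μ) T (fun t => √t) (fun z => (√(2 * μ))⁻¹ * (√z.1)⁻¹ * (z.2 i * gk z.2)) h

/-- Heat evolution of an initial value. -/
def heatP (μ T : ℝ) (g : Spc n → ℝ) : ℝ → Spc n → ℝ :=
  hop (piP n) (2 * μ) T (fun _ => 1) (fun z => gk z.2) (fun _ => g)

lemma measurable_gk_snd : Measurable fun z : ℝ × Spc n => gk z.2 :=
  continuous_gk.measurable.comp measurable_snd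

lemma heatV_ker {T κ : ℝ} (hT : 0 ≤ T) (hκ : 0 < κ) (hκ1 : κ < 1 / 2) (N : ℝ) {β : ℝ}
    (hβ : 1 ≤ β) : HoKer (piV n) T β κ N (fun t => t)
      (fun r => (1 + T) ^ 2 * β ^ (-κ) * r ^ (-κ)) (fun z => gk z.2) := by
  refine hoKer_small hT hβ hκ hκ1 rfl (fun s t hs hst ht => ?_)
    measurable_gk_snd.aestronglyMeasurable ?_
  · have hts : 0 ≤ t - s := by linarith
    have h1 : √(t - s) ≤ 1 + T := Real.sqrt_le_iff.2 ⟨by linarith, by nlinarith⟩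
    rw [abs_of_nonneg hts]
    calc t - s = √(t - s) * √(t - s) := (Real.mul_self_sqrt hts).symm
      _ ≤ _ := by gcongr
  · refine ((integrable_rpow_Ioc (a := -κ) (by linarith)).mul_prod
      (integrable_gk_mul_rpow (n := n) (N + 1))).congr (Eventually.of_forall fun z => ?_)
    simp only [abs_of_pos (gk_pos z.2)]
    ring

lemma heatVD_ker {T κ : ℝ} (hT : 0 ≤ T) (hκ : 0 < κ) (hκ1 : κ < 1 / 2) (N μ : ℝ) {β : ℝ}
    (hβ : 1 ≤ β) (i : Fin n) : HoKer (piV n) T β κ N (fun t => √t)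
      (fun r => (1 + T) ^ 2 * β ^ (-κ) * r ^ (-κ))
      (fun z => (√(2 * μ))⁻¹ * (√z.1)⁻¹ * (z.2 i * gk z.2)) := by
  have hm : Measurable fun z : ℝ × Spc n => (√(2 * μ))⁻¹ * (√z.1)⁻¹ * (z.2 i * gk z.2) := by
    have h1 : Measurable fun z : ℝ × Spc n => z.2 i :=
      (EuclideanSpace.proj i : Spc n →L[ℝ] ℝ).continuous.measurable.comp measurable_snd
    have h2 : Measurable fun z : ℝ × Spc n => (√z.1)⁻¹ :=
      (Real.continuous_sqrt.measurable.comp measurable_fst).inv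
    exact (h2.const_mul _).mul (h1.mul measurable_gk_snd)
  refine hoKer_small hT hβ hκ hκ1 Real.sqrt_zero (fun s t hs hst ht => ?_)
    hm.aestronglyMeasurable ?_
  · rw [abs_of_nonneg (sub_nonneg.2 (Real.sqrt_le_sqrt hst))]
    refine (sqrt_sub_sqrt_le hs hst).trans ?_
    nlinarith [Real.sqrt_nonneg (t - s)]
  · refine Integrable.mono' (((integrable_rpow_Ioc (a := -(1 / 2) - κ) (by linarith)).mul_prod
      (integrable_gk_mul_rpow (n := n) (N + 2))).const_mul (√(2 * μ))⁻¹) ?_ ?_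
    · refine Measurable.aestronglyMeasurable ?_
      have h3 : Measurable fun z : ℝ × Spc n => z.1 ^ (-κ) := measurable_fst.pow_const _
      have h4 : Measurable fun z : ℝ × Spc n => (1 + ‖z.2‖) ^ (N + 1) :=
        (measurable_snd.norm.const_add 1).pow_const _
      exact ((measurable_norm.comp hm).mul h3).mul h4
    · filter_upwards [ae_piV] with z hz
      have hg := (gk_pos z.2).le
      have h5 : |z.2 i| ≤ 1 + ‖z.2‖ := by
        have := PiLp.norm_apply_le z.2 i
        rw [Real.norm_eq_abs] at this
        linarith
      have h6 : z.1 ^ (-(1 / 2) - κ) = (√z.1)⁻¹ * z.1 ^ (-κ) := by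
        rw [sub_eq_add_neg, Real.rpow_add hz.1, Real.rpow_neg hz.1.le, ← Real.sqrt_eq_rpow]
      have h7 : (1 + ‖z.2‖) ^ (N + 2) = (1 + ‖z.2‖) * (1 + ‖z.2‖) ^ (N + 1) := by
        rw [show N + 2 = 1 + (N + 1) by ring, Real.rpow_add (by positivity), Real.rpow_one]
      have h8 : 0 ≤ z.1 ^ (-κ) := Real.rpow_nonneg hz.1.le _
      rw [norm_mul, norm_mul, Real.norm_eq_abs, Real.norm_eq_abs, Real.norm_eq_abs, abs_abs,
        abs_mul, abs_mul, abs_mul, abs_of_nonneg hg, abs_of_nonneg h8, abs_of_nonneg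
        (inv_nonneg.2 (Real.sqrt_nonneg _)), abs_of_nonneg (inv_nonneg.2 (Real.sqrt_nonneg _)),
        abs_of_nonneg (by positivity : 0 ≤ (1 + ‖z.2‖) ^ (N + 1)), h6, h7]
      calc (√(2 * μ))⁻¹ * (√z.1)⁻¹ * (|z.2 i| * gk z.2) * z.1 ^ (-κ) * (1 + ‖z.2‖) ^ (N + 1)
          ≤ (√(2 * μ))⁻¹ * (√z.1)⁻¹ * ((1 + ‖z.2‖) * gk z.2) * z.1 ^ (-κ) *
              (1 + ‖z.2‖) ^ (N + 1) := by gcongr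
        _ = _ := by ring

lemma heatP_ker {T κ : ℝ} (N : ℝ) : HoKer (piP n) T 0 κ N (fun _ => 1) (fun _ => 1)
    (fun z => gk z.2) := by
  refine ⟨?_, measurable_gk_snd.aestronglyMeasurable, ?_, fun r hr hr1 t ht => by simp,
    fun r hr hr1 e he he1 s t hs hst ht => ?_⟩
  · filter_upwards [ae_piP] with z hz
    rw [hz]
    norm_num
  · have h1 : Integrable (fun _ : ℝ => (1 : ℝ)) (Measure.dirac (1 : ℝ)) := integrable_const _
    refine (h1.mul_prod (integrable_gk_mul_rpow (n := n) (N + 1))).congr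
      (Eventually.of_forall fun z => ?_)
    simp only [abs_of_pos (gk_pos z.2)]
    ring
  · have : 0 ≤ t - s := by linarith
    simp only [sub_self, abs_zero, zero_mul, one_mul]
    positivity

/-- Smallness of the heat potential operators in exponentially weighted norms. -/
lemma xs_heatV {T κ μ : ℝ} {ex : ℕ → ℝ} (hT : 0 ≤ T) (hμ : 0 < μ) (hex : GoodEx ex κ) (N : ℝ) :
    ∃ K, 0 ≤ K ∧ ∀ β, 1 ≤ β → ∀ (m : ℕ) p C (h : ℝ → Spc n → ℝ), 0 ≤ p → p + m + 1 ≤ N →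
      XS T β ex m p C h →
      XS T β ex m p (K * β ^ (-κ) * C) (heatV μ T h) ∧
      ∀ i, XS T β ex m p (K * β ^ (-κ) * C) (heatVD μ T i h) := by
  have hc : 0 ≤ 2 * μ := by linarith
  set J : (ℝ × Spc n → ℝ) → ℝ := fun Q => hoC (2 * μ) T N *
    ∫ z, |Q z| * ((1 + T) ^ 2 * z.1 ^ (-κ)) * (1 + ‖z.2‖) ^ (N + 1) ∂piV n with hJ
  have hJ0 : ∀ Q, 0 ≤ J Q := by
    intro Q
    refine mul_nonneg (hoC_pos hc N).le (integral_nonneg_of_ae ?_)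
    filter_upwards [ae_piV] with z hz
    have := Real.rpow_nonneg hz.1.le (-κ)
    simp only [Pi.zero_apply]
    positivity
  have hJβ : ∀ Q (β : ℝ), hoC (2 * μ) T N * (∫ z, |Q z| * ((1 + T) ^ 2 * β ^ (-κ) * z.1 ^ (-κ)) *
      (1 + ‖z.2‖) ^ (N + 1) ∂piV n) = J Q * β ^ (-κ) := by
    intro Q β
    simp only [hJ]
    rw [mul_assoc, ← integral_mul_const]
    congr 2
    ext1 z
    ring
  refine ⟨J (fun z => gk z.2) + ∑ i, J (fun z => (√(2 * μ))⁻¹ * (√z.1)⁻¹ * (z.2 i * gk z.2)),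
    add_nonneg (hJ0 _) (Finset.sum_nonneg fun i _ => hJ0 _), fun β hβ m p C h hp hN hh => ?_⟩
  have hC := hh.const_nonneg hT
  have hβ0 : 0 ≤ β := by linarith
  constructor
  · have h1 := xs_hop (heatV_ker hT hex.kpos hex.klt N hβ) hex hc hT hβ0 hp hN hh
    refine h1.mono ?_
    rw [hJβ]
    gcongr
    exact le_add_of_nonneg_right (Finset.sum_nonneg fun i _ => hJ0 _)
  · intro i
    have h1 := xs_hop (heatVD_ker hT hex.kpos hex.klt N μ hβ i) hex hc hT hβ0 hp hN hh
    refine h1.mono ?_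
    rw [hJβ]
    gcongr
    refine (Finset.single_le_sum (f := fun i => J (fun z : ℝ × Spc n => (√(2 * μ))⁻¹ *
      (√z.1)⁻¹ * (z.2 i * gk z.2))) (fun i _ => hJ0 _) (Finset.mem_univ i)).trans ?_
    exact le_add_of_nonneg_left (hJ0 _)

lemma xs_heatP {T κ μ : ℝ} {ex : ℕ → ℝ} (hT : 0 ≤ T) (hμ : 0 < μ) (hex : GoodEx ex κ) (N : ℝ) :
    ∃ K, 0 ≤ K ∧ ∀ (m : ℕ) p C (g : Spc n → ℝ), 0 ≤ p → p + m + 1 ≤ N →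
      XS T 0 ex m p C (fun _ => g) → XS T 0 ex m p (K * C) (heatP μ T g) := by
  have hc : 0 ≤ 2 * μ := by linarith
  refine ⟨_, ?_, fun m p C g hp hN hh => xs_hop (heatP_ker N) hex hc hT le_rfl hp hN hh⟩
  refine mul_nonneg (hoC_pos hc N).le (integral_nonneg fun z => ?_)
  simp only [Pi.zero_apply]
  positivity

/-! ### Differentiating the Gaussian kernel -/

lemma norm_sq_eq_sum (y : Spc n) : ‖y‖ ^ 2 = ∑ i, y i ^ 2 := by
  rw [EuclideanSpace.norm_sq_eq]
  simp

lemma hasFDerivAt_gk (y : Spc n) : HasFDerivAt gk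
    (∑ i, (-(y i * gk y)) • (EuclideanSpace.proj i : Spc n →L[ℝ] ℝ)) y := by
  have h1 : HasFDerivAt (fun y : Spc n => -(1 / 2) * ‖y‖ ^ 2)
      (∑ i, (-(y i)) • (EuclideanSpace.proj i : Spc n →L[ℝ] ℝ)) y := by
    simp only [norm_sq_eq_sum, Finset.mul_sum]
    refine HasFDerivAt.fun_sum fun i _ => ?_
    have h2 : HasFDerivAt (fun y : Spc n => y i) (EuclideanSpace.proj i : Spc n →L[ℝ] ℝ) y :=
      (EuclideanSpace.proj i : Spc n →L[ℝ] ℝ).hasFDerivAt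
    refine ((h2.pow 2).const_mul (-(1 / 2))).congr_fderiv ?_
    ext v
    simp
    ring
  refine (h1.exp.mul_const (gMass n)⁻¹).congr_fderiv ?_
  rw [Finset.smul_sum, Finset.smul_sum]
  refine Finset.sum_congr rfl fun i _ => ?_
  rw [smul_smul, smul_smul]
  congr 1
  unfold gk
  ring

lemma abs_apply_mul_gk_le (i : Fin n) (y : Spc n) :
    |y i * gk y| ≤ Real.exp (-(1 / 4) * ‖y‖ ^ 2) / gMass n := by
  have h1 : |y i| ≤ ‖y‖ := PiLp.norm_apply_le y i
  have h2 : ‖y‖ ≤ Real.exp (‖y‖ ^ 2 / 4) := by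
    refine le_trans ?_ (Real.add_one_le_exp _)
    nlinarith [sq_nonneg (‖y‖ / 2 - 1)]
  have hM := gMass_pos (n := n)
  rw [abs_mul, abs_of_pos (gk_pos y)]
  unfold gk
  calc |y i| * (Real.exp (-(1 / 2) * ‖y‖ ^ 2) / gMass n)
      ≤ Real.exp (‖y‖ ^ 2 / 4) * (Real.exp (-(1 / 2) * ‖y‖ ^ 2) / gMass n) := by
        gcongr
        exact h1.trans h2
    _ = _ := by
        rw [← mul_div_assoc, ← Real.exp_add]
        congr 2
        ring

lemma continuous_apply_mul_gk (i : Fin n) : Continuous fun ζ : Spc n => ζ i * gk ζ :=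
  (EuclideanSpace.proj i : Spc n →L[ℝ] ℝ).continuous.mul continuous_gk

lemma integrable_apply_mul_gk (i : Fin n) : Integrable fun ζ : Spc n => ζ i * gk ζ :=
  Integrable.mono' ((integrable_exp (by norm_num : (0 : ℝ) < 1 / 4)).div_const (gMass n))
    (continuous_apply_mul_gk i).aestronglyMeasurable
    (Eventually.of_forall fun y => abs_apply_mul_gk_le i y)

lemma Integrable.mul_bdd_continuous {q f : Spc n → ℝ} {B : ℝ} (hq : Integrable q)
    (hf : Continuous f) (hB : ∀ x, |f x| ≤ B) : Integrable fun x => q x * f x :=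
  hq.mul_bdd hf.aestronglyMeasurable (Eventually.of_forall hB)

lemma hasFDerivAt_gauss {σ B : ℝ} (hσ : 0 < σ) {f : Spc n → ℝ} (hf : Continuous f)
    (hB : ∀ x, |f x| ≤ B) (x : Spc n) :
    HasFDerivAt (fun x => ∫ ζ, gk ζ * f (x + σ • ζ))
      (∑ i, (∫ ζ, σ⁻¹ * (ζ i * gk ζ) * f (x + σ • ζ)) •
        (EuclideanSpace.proj i : Spc n →L[ℝ] ℝ)) x := by
  have htr : ∀ (q : Spc n → ℝ) (x : Spc n), ∫ ζ, q ζ * f (x + σ • ζ) =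
      ∫ ξ, q (ξ - σ⁻¹ • x) * f (σ • ξ) := by
    intro q x
    rw [← integral_sub_right_eq_self (fun ζ => q ζ * f (x + σ • ζ)) (σ⁻¹ • x)]
    congr 1
    ext1 ξ
    congr 2
    rw [smul_sub, smul_smul, mul_inv_cancel₀ hσ.ne', one_smul]
    abel
  have hfun : (fun x => ∫ ζ, gk ζ * f (x + σ • ζ)) =
      fun x => ∫ ξ, gk (ξ - σ⁻¹ • x) * f (σ • ξ) := by
    ext1 x
    exact htr gk x
  have hfσ : Continuous fun ξ : Spc n => f (σ • ξ) := hf.comp (continuous_const_smul σ)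
  have hB0 : 0 ≤ B := (abs_nonneg _).trans (hB 0)
  set L : Spc n → Spc n → (Spc n →L[ℝ] ℝ) := fun x ξ =>
    ∑ i, (σ⁻¹ * ((ξ - σ⁻¹ • x) i * gk (ξ - σ⁻¹ • x)) * f (σ • ξ)) •
      (EuclideanSpace.proj i : Spc n →L[ℝ] ℝ) with hL
  have hcoef : ∀ i x, Continuous fun ξ : Spc n =>
      σ⁻¹ * ((ξ - σ⁻¹ • x) i * gk (ξ - σ⁻¹ • x)) * f (σ • ξ) := fun i x =>
    (continuous_const.mul ((continuous_apply_mul_gk i).comp (by fun_prop :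
      Continuous fun ξ : Spc n => ξ - σ⁻¹ • x))).mul hfσ
  have hbound : ∀ ξ, ∀ y ∈ Metric.ball x σ, ‖L y ξ‖ ≤
      (∑ _i : Fin n, σ⁻¹ * (Real.exp (1 / 4) / gMass n) * B) *
        Real.exp (-(1 / 8) * ‖ξ - σ⁻¹ • x‖ ^ 2) := by
    intro ξ y hy
    refine (norm_sum_smul_proj_le _).trans ?_
    rw [Finset.sum_mul]
    refine Finset.sum_le_sum fun i _ => ?_
    have h1 : ‖ξ - σ⁻¹ • x‖ ≤ ‖ξ - σ⁻¹ • y‖ + 1 := by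
      have h2 : ξ - σ⁻¹ • x = (ξ - σ⁻¹ • y) + σ⁻¹ • (y - x) := by
        rw [smul_sub]; abel
      rw [h2]
      refine (norm_add_le _ _).trans ?_
      gcongr
      rw [norm_smul, norm_inv, Real.norm_of_nonneg hσ.le, inv_mul_le_iff₀ hσ, mul_one]
      exact (mem_ball_iff_norm.1 hy).le
    have h3 : Real.exp (-(1 / 4) * ‖ξ - σ⁻¹ • y‖ ^ 2) ≤
        Real.exp (1 / 4) * Real.exp (-(1 / 8) * ‖ξ - σ⁻¹ • x‖ ^ 2) := by
      rw [← Real.exp_add]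
      refine Real.exp_le_exp.2 ?_
      nlinarith [sq_nonneg (‖ξ - σ⁻¹ • y‖ - 1), norm_nonneg (ξ - σ⁻¹ • y),
        norm_nonneg (ξ - σ⁻¹ • x)]
    rw [abs_mul, abs_mul, abs_of_pos (inv_pos.2 hσ)]
    have hM := gMass_pos (n := n)
    calc σ⁻¹ * |(ξ - σ⁻¹ • y) i * gk (ξ - σ⁻¹ • y)| * |f (σ • ξ)|
        ≤ σ⁻¹ * (Real.exp (1 / 4) * Real.exp (-(1 / 8) * ‖ξ - σ⁻¹ • x‖ ^ 2) / gMass n) * B := by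
          gcongr
          · exact (abs_apply_mul_gk_le i _).trans (by gcongr)
          · exact hB _
      _ = _ := by ring
  have hgkx : ∀ y, Continuous fun ξ : Spc n => gk (ξ - σ⁻¹ • y) * f (σ • ξ) := fun y =>
    (continuous_gk.comp (by fun_prop : Continuous fun ξ : Spc n => ξ - σ⁻¹ • y)).mul hfσ
  have hder := hasFDerivAt_integral_of_dominated_of_fderiv_le (𝕜 := ℝ)
    (μ := (volume : Measure (Spc n))) (s := Metric.ball x σ)
    (F := fun y ξ => gk (ξ - σ⁻¹ • y) * f (σ • ξ)) (F' := L) (x₀ := x)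
    (bound := fun ξ => (∑ _i : Fin n, σ⁻¹ * (Real.exp (1 / 4) / gMass n) * B) *
        Real.exp (-(1 / 8) * ‖ξ - σ⁻¹ • x‖ ^ 2)) (Metric.ball_mem_nhds x hσ)
    (Eventually.of_forall fun y => (hgkx y).aestronglyMeasurable)
    (Integrable.mul_bdd_continuous (integrable_gk.comp_sub_right _) hfσ fun ξ => hB _)
    (Continuous.aestronglyMeasurable (continuous_finsetSum _ fun i _ =>
      (hcoef i x).smul continuous_const))
    (Eventually.of_forall hbound)
    (((integrable_exp (by norm_num : (0 : ℝ) < 1 / 8)).comp_sub_right (σ⁻¹ • x)).const_mul _)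
    (Eventually.of_forall fun ξ y _ => ?_)
  · rw [hfun]
    refine hder.congr_fderiv ?_
    simp only [hL]
    rw [integral_finsetSum]
    · refine Finset.sum_congr rfl fun i _ => ?_
      rw [integral_smul_const]
      congr 1
      exact (htr (fun ζ => σ⁻¹ * (ζ i * gk ζ)) x).symm
    · intro i _
      refine Integrable.smul_const ?_ _
      exact Integrable.mul_bdd_continuous
        (((integrable_apply_mul_gk i).const_mul σ⁻¹).comp_sub_right (σ⁻¹ • x)) hfσ fun ξ => hB _
  · have h1 : HasFDerivAt (fun y : Spc n => ξ - σ⁻¹ • y)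
        (-(σ⁻¹ • ContinuousLinearMap.id ℝ (Spc n))) y := by
      simpa using ((hasFDerivAt_id (𝕜 := ℝ) y).const_smul σ⁻¹).const_sub ξ
    have h2 := ((hasFDerivAt_gk (ξ - σ⁻¹ • y)).comp y h1).mul_const (f (σ • ξ))
    refine h2.congr_fderiv ?_
    ext v
    simp [hL, Finset.mul_sum]
    refine Finset.sum_congr rfl fun i _ => ?_
    ring

lemma hasFDerivAt_heatV {T β e p C κ μ : ℝ} {h : ℝ → Spc n → ℝ} (hμ : 0 < μ) (hT : 0 ≤ T)
    (hβ : 1 ≤ β) (he : 0 < e) (hκ : 0 < κ) (he1 : e ≤ 1 - 2 * κ) (hp : 0 ≤ p)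
    (hh : HB T β e p C h) {t : ℝ} (ht : t ∈ Set.Icc 0 T) (x : Spc n) :
    HasFDerivAt (heatV μ T h t) (∑ i, heatVD μ T i h t x •
      (EuclideanSpace.proj i : Spc n →L[ℝ] ℝ)) x := by
  have hβ0 : 0 ≤ β := by linarith
  have hC := hh.const_nonneg hT
  rcases ht.1.eq_or_lt with h0 | h0
  · have h1 : heatV μ T h t = fun _ => 0 := by
      ext1 y
      simp [heatV, hop, ho, ← h0]
    have h2 : ∀ i, heatVD μ T i h t x = 0 := fun i => by simp [heatVD, hop, ho, ← h0]
    rw [h1]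
    simpa [h2] using hasFDerivAt_const (0 : ℝ) x
  have hbd : ∀ r, 0 < r → r ≤ 1 → ∀ y, |h (t * (1 - r)) y| ≤ C * Real.exp (β * T) := by
    intro r hr hr1 y
    have hm := mul_one_sub_mem ht hr hr1
    refine (hh.bd _ hm y).trans ?_
    have hw : wt y ^ (-p) ≤ 1 :=
      Real.rpow_le_one_of_one_le_of_nonpos (one_le_wt y) (by linarith)
    have hw0 := (Real.rpow_pos_of_pos (wt_pos y) (-p)).le
    have hm2 := hm.2
    calc C * Real.exp (β * (t * (1 - r))) * wt y ^ (-p) ≤ C * Real.exp (β * T) * 1 := by gcongr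
      _ = _ := mul_one _
  have hco : ∀ r, 0 < r → r ≤ 1 → Continuous (h (t * (1 - r))) := by
    intro r hr hr1
    have hm := mul_one_sub_mem ht hr hr1
    have := continuous_comp_cl hT (hh.continuousOn he hp hβ0)
      (continuous_const (y := t * (1 - r))) (continuous_id (X := Spc n))
    simpa [cl_eq hm] using this
  have hκ1 : κ < 1 / 2 := by linarith
  obtain ⟨-, hint⟩ := hb_hop_aux (c := 2 * μ) (heatV_ker hT hκ hκ1 (p + e) hβ) (by linarith) hT hβ0
    he hκ he1 hp le_rfl hh
  have hD := fun i => hb_hop_aux (c := 2 * μ) (heatVD_ker hT hκ hκ1 (p + e) μ hβ i) (by linarith)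
    hT hβ0 he hκ he1 hp le_rfl hh
  set QD : Fin n → ℝ × Spc n → ℝ := fun i z =>
    (√(2 * μ))⁻¹ * (√z.1)⁻¹ * (z.2 i * gk z.2) with hQD
  set w : Fin n → ℝ → Spc n → ℝ := fun i r y =>
    ∫ ζ, ho (2 * μ) T (fun t => √t) (QD i) h (r, ζ) t y with hw
  have hwint : ∀ i y, Integrable (fun r => w i r y) (volume.restrict (Set.Ioc (0 : ℝ) 1)) :=
    fun i y => ((hD i).2 t ht y).integral_prod_left
  set bd : Fin n → ℝ × Spc n → ℝ := fun i z => hoC (2 * μ) T (p + e) * (|QD i z| *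
    ((1 + T) ^ 2 * β ^ (-κ) * z.1 ^ (-κ)) * (1 + ‖z.2‖) ^ (p + e + 1)) * C *
      (Real.exp (β * t) * 1) with hbdd
  have hbint : ∀ i, Integrable (bd i) (piV n) := fun i =>
    (((heatVD_ker hT hκ hκ1 (p + e) μ hβ i).int.const_mul _).mul_const _).mul_const _
  have hwbd : ∀ i, ∀ᵐ r ∂(volume.restrict (Set.Ioc (0 : ℝ) 1)), ∀ y,
      |w i r y| ≤ ∫ ζ, bd i (r, ζ) := by
    intro i
    filter_upwards [Measure.ae_ae_of_ae_prod (hD i).1, (hbint i).prod_right_ae] with r h1 h2 y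
    rw [← Real.norm_eq_abs]
    refine norm_integral_le_of_norm_le (G := ℝ) h2 ?_
    filter_upwards [h1] with ζ h3
    refine (h3.bd t ht y).trans ?_
    have h4 : wt y ^ (-p) ≤ 1 :=
      Real.rpow_le_one_of_one_le_of_nonpos (one_le_wt y) (by linarith)
    have h5 := h3.const_nonneg hT
    calc _ ≤ _ * Real.exp (β * t) * 1 := mul_le_mul_of_nonneg_left h4
          (mul_nonneg h5 (Real.exp_pos _).le)
      _ = _ := mul_assoc _ _ _
  have hV : ∀ y, heatV μ T h t y = ∫ r in Set.Ioc (0 : ℝ) 1, ∫ ζ,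
      ho (2 * μ) T (fun t => t) (fun z => gk z.2) h (r, ζ) t y := fun y =>
    integral_prod _ (hint t ht y)
  have hVD : ∀ i, heatVD μ T i h t x = ∫ r in Set.Ioc (0 : ℝ) 1, w i r x := fun i =>
    integral_prod _ ((hD i).2 t ht x)
  have hfun : heatV μ T h t = fun y => ∫ r in Set.Ioc (0 : ℝ) 1, ∫ ζ,
      ho (2 * μ) T (fun t => t) (fun z => gk z.2) h (r, ζ) t y := funext hV
  have hder := hasFDerivAt_integral_of_dominated_of_fderiv_le (𝕜 := ℝ)
    (μ := volume.restrict (Set.Ioc (0 : ℝ) 1)) (s := Set.univ)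
    (F := fun y r => ∫ ζ, ho (2 * μ) T (fun t => t) (fun z => gk z.2) h (r, ζ) t y)
    (F' := fun y r => ∑ i, w i r y • (EuclideanSpace.proj i : Spc n →L[ℝ] ℝ)) (x₀ := x)
    (bound := fun r => ∑ i, ∫ ζ, bd i (r, ζ)) Filter.univ_mem
    (Eventually.of_forall fun y => (hint t ht y).integral_prod_left.aestronglyMeasurable)
    (hint t ht x).integral_prod_left
    (Finset.aestronglyMeasurable_fun_sum _ fun i _ =>
      (hwint i x).aestronglyMeasurable.smul_const _)
    ?_ (integrable_finsetSum _ fun i _ => (hbint i).integral_prod_left) ?_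
  · rw [hfun]
    refine hder.congr_fderiv ?_
    rw [integral_finsetSum _ fun i _ => (hwint i x).smul_const _]
    refine Finset.sum_congr rfl fun i _ => ?_
    rw [integral_smul_const, hVD]
  · filter_upwards [ae_all_iff.2 hwbd] with r hr y _
    exact (norm_sum_smul_proj_le _).trans (Finset.sum_le_sum fun i _ => hr i y)
  · filter_upwards [ae_restrict_mem measurableSet_Ioc] with r hr y _
    have hσ : 0 < √(2 * μ * t * r) := Real.sqrt_pos.2 (by have := hr.1; positivity)
    have hm := mul_one_sub_mem ht hr.1 hr.2
    have h1 := (hasFDerivAt_gauss hσ (hco r hr.1 hr.2) (hbd r hr.1 hr.2) y).const_mul t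
    have h2 : (fun y => ∫ ζ, ho (2 * μ) T (fun t => t) (fun z => gk z.2) h (r, ζ) t y) =
        fun y => t * ∫ ζ, gk ζ * h (t * (1 - r)) (y + √(2 * μ * t * r) • ζ) := by
      ext1 y
      rw [← integral_const_mul]
      simp only [ho, cl_eq hm, mul_assoc]
    rw [h2]
    refine h1.congr_fderiv ?_
    rw [Finset.smul_sum]
    refine Finset.sum_congr rfl fun i _ => ?_
    rw [smul_smul]
    congr 1
    rw [← integral_const_mul]
    simp only [hw, ho, cl_eq hm, hQD]
    congr 1
    ext1 ζ
    have h3 : t * (√(2 * μ * t * r))⁻¹ = √t * ((√(2 * μ))⁻¹ * (√r)⁻¹) := by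
      rw [Real.sqrt_mul (by positivity), Real.sqrt_mul (by positivity), mul_inv, mul_inv]
      have h4 : √t ≠ 0 := (Real.sqrt_pos.2 h0).ne'
      nth_rewrite 1 [← Real.mul_self_sqrt h0.le]
      field_simp
    calc _ = (t * (√(2 * μ * t * r))⁻¹) * (ζ i * gk ζ) *
          h (t * (1 - r)) (y + √(2 * μ * t * r) • ζ) := by ring
      _ = _ := by rw [h3]; ring

lemma xs_heatV_gain {T κ μ : ℝ} {ex : ℕ → ℝ} (hT : 0 ≤ T) (hμ : 0 < μ) (hex : GoodEx ex κ)
    (N : ℝ) : ∃ K, 0 ≤ K ∧ ∀ β, 1 ≤ β → ∀ (m : ℕ) p C (h : ℝ → Spc n → ℝ), 0 ≤ p →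
      p + m + 2 ≤ N → ex (m + 1) = ex m → XS T β ex m (p + 1) C h →
      XS T β ex (m + 1) p (K * β ^ (-κ) * C) (heatV μ T h) := by
  obtain ⟨K, hK, H⟩ := xs_heatV (n := n) hT hμ hex N
  refine ⟨K, hK, fun β hβ m p C h hp hN hm hh => ?_⟩
  obtain ⟨h1, h2⟩ := H β hβ m (p + 1) C h (by linarith) (by linarith) hh
  have h3 : ∀ t ∈ Set.Icc 0 T, ∀ x, _ := fun t ht x =>
    hasFDerivAt_heatV hμ hT hβ (hex.pos m) hex.kpos (hex.le m) (by linarith) hh.hb ht x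
  refine ⟨?_, fun t ht x => (h3 t ht x).differentiableAt, fun i => (h2 i).congr fun t ht x => ?_⟩
  · rw [hm]
    exact h1.hb.weight_mono (by linarith) hT
  · unfold dx pd
    rw [(h3 t ht x).fderiv]
    simp

/-! ### The heat equation -/

/-- Bounded continuous functions with `m` bounded continuous derivatives. -/
def CB : ℕ → (Spc n → ℝ) → Prop
  | 0, f => Continuous f ∧ ∃ B, ∀ x, |f x| ≤ B
  | m + 1, f => (Continuous f ∧ ∃ B, ∀ x, |f x| ≤ B) ∧ Differentiable ℝ f ∧ ∀ i, CB m (pd i f)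

lemma CB.zero_of {m : ℕ} {f : Spc n → ℝ} (h : CB m f) : Continuous f ∧ ∃ B, ∀ x, |f x| ≤ B := by
  cases m with
  | zero => exact h
  | succ m => exact h.1

lemma XS.cB {T β p κ C : ℝ} {ex : ℕ → ℝ} (hex : GoodEx ex κ) (hp : 0 ≤ p) (hβ : 0 ≤ β) {m : ℕ}
    {h : ℝ → Spc n → ℝ} (hh : XS T β ex m p C h) {t : ℝ} (ht : t ∈ Set.Icc 0 T) : CB m (h t) := by
  have H : ∀ {m : ℕ} {p : ℝ} {h : ℝ → Spc n → ℝ}, 0 ≤ p → XS T β ex m p C h →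
      Continuous (h t) ∧ ∃ B, ∀ x, |h t x| ≤ B := by
    intro m p h hp hh
    have hT := ht.1.trans ht.2
    have hC := hh.const_nonneg hT
    constructor
    · have := continuous_comp_cl hT (hh.hb.continuousOn (hex.pos m) hp hβ)
        (continuous_const (y := t)) (continuous_id (X := Spc n))
      simpa [cl_eq ht] using this
    · refine ⟨C * Real.exp (β * t), fun x => (hh.hb.bd t ht x).trans ?_⟩
      exact mul_le_of_le_one_right (by positivity)
        (Real.rpow_le_one_of_one_le_of_nonpos (one_le_wt x) (by linarith))
  induction m generalizing p h with
  | zero => exact H hp hh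
  | succ m ih => exact ⟨H hp hh, hh.diff t ht, fun i => ih (by linarith) (hh.dx i)⟩

lemma hasDerivAt_gauss_line {f : Spc n → ℝ} (hf : CB 1 f) (x a : Spc n) (σ b s₀ : ℝ) :
    HasDerivAt (fun s : ℝ => ∫ ζ, gk ζ * f (x + s • a + (σ + s * b) • ζ))
      (∫ ζ, gk ζ * ∑ i, pd i f (x + s₀ • a + (σ + s₀ * b) • ζ) * (a i + b * ζ i)) s₀ := by
  obtain ⟨⟨hfc, B, hB⟩, hfd, hfi⟩ := hf
  choose hic D hD using hfi
  have hD0 : ∀ i, 0 ≤ D i := fun i => (abs_nonneg _).trans (hD i 0)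
  have hl : ∀ s : ℝ, Continuous fun ζ : Spc n => x + s • a + (σ + s * b) • ζ := fun s => by fun_prop
  refine (hasDerivAt_integral_of_dominated_loc_of_deriv_le (μ := (volume : Measure (Spc n)))
    (s := Set.univ) (bound := fun ζ => ∑ i, D i * (|a i| * gk ζ + |b| * |ζ i * gk ζ|))
    (F' := fun s ζ => gk ζ * ∑ i, pd i f (x + s • a + (σ + s * b) • ζ) * (a i + b * ζ i))
    Filter.univ_mem ?_ ?_ ?_ ?_ ?_ ?_).2
  · exact Eventually.of_forall fun s =>
      (continuous_gk.mul (hfc.comp (hl s))).aestronglyMeasurable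
  · exact Integrable.mul_bdd_continuous integrable_gk (hfc.comp (hl s₀)) fun ζ => hB _
  · refine (continuous_gk.mul (continuous_finsetSum _ fun i _ =>
      ((hic i).comp (hl s₀)).mul ?_)).aestronglyMeasurable
    exact continuous_const.add
      (continuous_const.mul (EuclideanSpace.proj i : Spc n →L[ℝ] ℝ).continuous)
  · refine Eventually.of_forall fun ζ s _ => ?_
    rw [Real.norm_eq_abs, Finset.mul_sum]
    refine (Finset.abs_sum_le_sum_abs _ _).trans (Finset.sum_le_sum fun i _ => ?_)
    have hg := gk_pos ζ
    rw [abs_mul, abs_mul, abs_mul, abs_of_pos hg]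
    have h1 : |a i + b * ζ i| ≤ |a i| + |b| * |ζ i| := (abs_add_le _ _).trans_eq (by rw [abs_mul])
    calc gk ζ * (|pd i f (x + s • a + (σ + s * b) • ζ)| * |a i + b * ζ i|)
        ≤ gk ζ * (D i * (|a i| + |b| * |ζ i|)) := by
          gcongr
          · exact hD0 i
          · exact hD i _
      _ = _ := by ring
  · refine integrable_finsetSum _ fun i _ => Integrable.const_mul ?_ _
    exact (integrable_gk.const_mul _).add ((integrable_apply_mul_gk i).abs.const_mul _)
  · refine Eventually.of_forall fun ζ s _ => HasDerivAt.const_mul _ ?_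
    have h1 : HasDerivAt (fun s : ℝ => x + s • a + (σ + s * b) • ζ) (a + b • ζ) s := by
      have h2 : HasDerivAt (fun s : ℝ => s • a) a s := by
        simpa using (hasDerivAt_id s).smul_const a
      have h3 : HasDerivAt (fun s : ℝ => (σ + s * b) • ζ) (b • ζ) s := by
        simpa using (((hasDerivAt_id s).mul_const b).const_add σ).smul_const ζ
      exact (h2.const_add x).add h3
    refine ((hfd _).hasFDerivAt.comp_hasDerivAt s h1).congr_deriv ?_
    rw [fderiv_eq_sum_pd]
    simp

/-- Gaussian average. -/
def ga (μ : ℝ) (f : Spc n → ℝ) (ρ : ℝ) (x : Spc n) : ℝ := ∫ ζ, gk ζ * f (x + √(2 * μ * ρ) • ζ)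

lemma integral_apply_gk_pd {f : Spc n → ℝ} (hf : CB 1 f) (i : Fin n) {σ : ℝ} (hσ : 0 < σ)
    (x : Spc n) : ∫ ζ, gk ζ * (f (x + σ • ζ) * ζ i) = σ * ∫ ζ, gk ζ * pd i f (x + σ • ζ) := by
  obtain ⟨⟨hfc, B, hB⟩, -, -⟩ := id hf
  have h1 := hasDerivAt_gauss_line hf x (EuclideanSpace.single i 1) σ 0 0
  have h2 := hasFDerivAt_gauss hσ hfc hB x
  have hl : HasDerivAt (fun s : ℝ => x + s • (EuclideanSpace.single i 1 : Spc n))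
      (EuclideanSpace.single i 1 : Spc n) 0 := by
    simpa using ((hasDerivAt_id (0 : ℝ)).smul_const (EuclideanSpace.single i 1 : Spc n)).const_add x
  have h3 := HasFDerivAt.comp_hasDerivAt (x := (0 : ℝ)) (f := fun s : ℝ =>
    x + s • (EuclideanSpace.single i 1 : Spc n)) (l := fun x => ∫ ζ, gk ζ * f (x + σ • ζ))
    (by simpa using h2) hl
  simp only [mul_zero, add_zero] at h1
  have h4 := h1.unique h3
  simp only [zero_smul, add_zero, zero_mul] at h4
  have h5 : ∀ ζ : Spc n, ∑ j, pd j f (x + σ • ζ) * (EuclideanSpace.single i (1 : ℝ) : Spc n) j =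
      pd i f (x + σ • ζ) := fun ζ => by
    simp [PiLp.single_apply]
  simp only [h5] at h4
  have h6 : ∀ c : Fin n → ℝ, (∑ j, c j • (EuclideanSpace.proj j : Spc n →L[ℝ] ℝ))
      (EuclideanSpace.single i 1) = c i := fun c => by simp [PiLp.single_apply]
  rw [h4, h6]
  rw [← integral_const_mul]
  congr 1
  ext1 ζ
  field_simp

lemma hasDerivAt_ga {μ : ℝ} (hμ : 0 < μ) {f : Spc n → ℝ} (hf : CB 2 f) (x : Spc n) {ρ : ℝ}
    (hρ : 0 < ρ) : HasDerivAt (fun ρ => ga μ f ρ x) (μ * ∑ i, ga μ (pd i (pd i f)) ρ x) ρ := by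
  have hf1 : CB 1 f := ⟨hf.1, hf.2.1, fun i => (hf.2.2 i).zero_of⟩
  have hσ : 0 < √(2 * μ * ρ) := Real.sqrt_pos.2 (by positivity)
  have h1 := hasDerivAt_gauss_line hf1 x 0 0 1 (√(2 * μ * ρ))
  have h2 : HasDerivAt (fun ρ => √(2 * μ * ρ)) (2 * μ / (2 * √(2 * μ * ρ))) ρ := by
    have h3 : HasDerivAt (fun ρ : ℝ => 2 * μ * ρ) (2 * μ) ρ := by
      simpa using (hasDerivAt_id ρ).const_mul (2 * μ)
    exact h3.sqrt (by positivity)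
  have h3 := HasDerivAt.comp ρ h1 h2
  simp only [smul_zero, add_zero, zero_add, mul_one, one_mul, PiLp.zero_apply] at h3
  refine h3.congr_deriv ?_
  have h4 : ∫ ζ, gk ζ * ∑ i, pd i f (x + √(2 * μ * ρ) • ζ) * ζ i =
      ∑ i, √(2 * μ * ρ) * ga μ (pd i (pd i f)) ρ x := by
    simp only [Finset.mul_sum]
    rw [integral_finsetSum]
    · exact Finset.sum_congr rfl fun i _ => integral_apply_gk_pd (hf.2.2 i) i hσ x
    · intro i _
      obtain ⟨hc, B, hB⟩ := (hf.2.2 i).zero_of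
      have hl : Continuous fun ζ : Spc n => x + √(2 * μ * ρ) • ζ := by fun_prop
      refine (Integrable.mul_bdd_continuous (integrable_apply_mul_gk i) (hc.comp hl)
        fun ζ => hB _).congr (Eventually.of_forall fun ζ => ?_)
      simp only [Function.comp]
      ring
  rw [h4, ← Finset.mul_sum]
  field_simp

lemma ga_zero (μ : ℝ) (f : Spc n → ℝ) (x : Spc n) : ga μ f 0 x = f x := by
  simp [ga, integral_mul_const, integral_gk]

section timeAvg

variable {T : ℝ} {h : ℝ → Spc n → ℝ}

lemma continuous_ga_cl (μ : ℝ) (hT : 0 ≤ T) {B : ℝ}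
    (hh : ContinuousOn (fun q : ℝ × Spc n => h q.1 q.2) (Set.Icc 0 T ×ˢ Set.univ))
    (hB : ∀ t ∈ Set.Icc 0 T, ∀ x, |h t x| ≤ B) (x : Spc n) :
    Continuous fun q : ℝ × ℝ => ga μ (h (cl T q.2)) q.1 x := by
  refine continuous_of_dominated (bound := fun ζ => gk ζ * B) (fun q => ?_) (fun q => ?_)
    (integrable_gk.mul_const B) ?_
  · exact (continuous_gk.mul (continuous_comp_cl hT hh continuous_const
      (by fun_prop))).aestronglyMeasurable
  · refine Eventually.of_forall fun ζ => ?_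
    rw [Real.norm_eq_abs, abs_mul, abs_of_pos (gk_pos ζ)]
    exact mul_le_mul_of_nonneg_left (hB _ (cl_mem hT _) _) (gk_pos ζ).le
  · exact Eventually.of_forall fun ζ => continuous_const.mul
      (continuous_comp_cl hT hh continuous_snd (by fun_prop))

end timeAvg

lemma ga_sub {μ : ℝ} {f : Spc n → ℝ} (hμ : 0 < μ) (hf : CB 2 f) (x : Spc n) {ρ : ℝ}
    (hρ : 0 ≤ ρ) :
    ga μ f ρ x = f x + ∑ i, μ * ∫ r in (0 : ℝ)..ρ, ga μ (pd i (pd i f)) r x := by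
  have hc : ∀ f : Spc n → ℝ, CB 0 f → Continuous fun r => ga μ f r x := by
    rintro f ⟨hfc, B, hB⟩
    have := continuous_ga_cl (T := 0) (h := fun _ => f) μ le_rfl
      (hfc.comp continuous_snd).continuousOn (fun _ _ => hB) x
    exact this.comp (by fun_prop : Continuous fun r : ℝ => (r, (0 : ℝ)))
  have hci := fun i => hc _ ((hf.2.2 i).2.2 i)
  have h1 := intervalIntegral.integral_eq_sub_of_hasDerivAt_of_le hρ
    (hc f hf.zero_of).continuousOn (fun r hr => hasDerivAt_ga hμ hf x hr.1)
    (Continuous.intervalIntegrable (continuous_const.mul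
      (continuous_finsetSum _ fun i _ => hci i)) _ _)
  rw [ga_zero] at h1
  rw [← Finset.mul_sum, ← intervalIntegral.integral_finsetSum fun i _ =>
    (hci i).intervalIntegrable _ _, ← intervalIntegral.integral_const_mul, h1]
  ring

lemma integral_triangle_swap {Φ : ℝ × ℝ → ℝ} (hΦ : Continuous Φ) {t : ℝ} (ht : 0 ≤ t) :
    ∫ τ in (0 : ℝ)..t, ∫ σ in τ..t, Φ (σ, τ) = ∫ σ in (0 : ℝ)..t, ∫ τ in (0 : ℝ)..σ, Φ (σ, τ) := by
  set S : Set (ℝ × ℝ) := {q | q.1 < q.2} with hS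
  have hSm : MeasurableSet S := measurableSet_lt measurable_fst measurable_snd
  have h1 : ∀ τ ∈ Set.Ioc 0 t, ∫ σ in τ..t, Φ (σ, τ) =
      ∫ σ in Set.Ioc 0 t, S.indicator (fun q => Φ (q.2, q.1)) (τ, σ) := by
    intro τ hτ
    have : (fun σ => S.indicator (fun q => Φ (q.2, q.1)) (τ, σ)) =
        (Set.Ioi τ).indicator fun σ => Φ (σ, τ) := by
      ext σ
      simp [Set.indicator_apply, hS]
    rw [this, setIntegral_indicator measurableSet_Ioi, intervalIntegral.integral_of_le hτ.2]
    congr 2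
    ext σ
    simp only [Set.mem_Ioc, Set.mem_inter_iff, Set.mem_Ioi]
    exact ⟨fun h => ⟨⟨hτ.1.trans h.1, h.2⟩, h.1⟩, fun h => ⟨h.2, h.1.2⟩⟩
  have h2 : ∀ σ ∈ Set.Ioc 0 t, ∫ τ in (0 : ℝ)..σ, Φ (σ, τ) =
      ∫ τ in Set.Ioc 0 t, S.indicator (fun q => Φ (q.2, q.1)) (τ, σ) := by
    intro σ hσ
    have : (fun τ => S.indicator (fun q => Φ (q.2, q.1)) (τ, σ)) =
        (Set.Iio σ).indicator fun τ => Φ (σ, τ) := by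
      ext τ
      simp [Set.indicator_apply, hS]
    rw [this, setIntegral_indicator measurableSet_Iio, intervalIntegral.integral_of_le hσ.1.le,
      integral_Ioc_eq_integral_Ioo]
    congr 2
    ext τ
    simp only [Set.mem_Ioc, Set.mem_inter_iff, Set.mem_Iio, Set.mem_Ioo]
    exact ⟨fun h => ⟨⟨h.1, h.2.le.trans hσ.2⟩, h.2⟩, fun h => ⟨h.1.1, h.2⟩⟩
  rw [intervalIntegral.integral_of_le ht, intervalIntegral.integral_of_le ht,
    setIntegral_congr_fun measurableSet_Ioc h1, setIntegral_congr_fun measurableSet_Ioc h2]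
  refine integral_integral_swap ?_
  refine Integrable.indicator ?_ hSm
  have hc : Continuous fun q : ℝ × ℝ => Φ (q.2, q.1) := by fun_prop
  rw [Measure.prod_restrict]
  exact (hc.continuousOn.integrableOn_compact (isCompact_Icc.prod isCompact_Icc)).mono_set
    (Set.prod_mono Set.Ioc_subset_Icc_self Set.Ioc_subset_Icc_self)

section heat

variable {T β p κ C μ : ℝ} {ex : ℕ → ℝ} {h : ℝ → Spc n → ℝ}

lemma heatV_eq_integral (hμ : 0 < μ) (hT : 0 ≤ T) (hex : GoodEx ex κ) (hβ : 1 ≤ β) (hp : 0 ≤ p)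
    {m : ℕ} (hh : XS T β ex m p C h) {t : ℝ} (ht : t ∈ Set.Icc 0 T) (x : Spc n) :
    heatV μ T h t x = ∫ τ in (0 : ℝ)..t, ga μ (h (cl T τ)) (t - τ) x := by
  obtain ⟨-, hint⟩ := hb_hop_aux (c := 2 * μ) (heatV_ker hT hex.kpos hex.klt (p + ex m) hβ)
    (by linarith) hT (by linarith) (hex.pos m) hex.kpos (hex.le m) hp le_rfl hh.hb
  have h1 : heatV μ T h t x = ∫ r in Set.Ioc (0 : ℝ) 1, ∫ ζ,
      ho (2 * μ) T (fun t => t) (fun z => gk z.2) h (r, ζ) t x := integral_prod _ (hint t ht x)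
  have h2 : ∀ r, ∫ ζ, ho (2 * μ) T (fun t => t) (fun z => gk z.2) h (r, ζ) t x =
      t * ga μ (h (cl T (t - t * r))) (t * r) x := by
    intro r
    unfold ga
    rw [← integral_const_mul]
    congr 1
    ext1 ζ
    simp only [ho]
    rw [mul_one_sub, mul_assoc, mul_assoc (2 * μ)]
  rw [h1]
  simp only [h2]
  rw [← intervalIntegral.integral_of_le zero_le_one, intervalIntegral.integral_const_mul,
    intervalIntegral.mul_integral_comp_mul_left (f := fun ρ => ga μ (h (cl T (t - ρ))) ρ x)]
  have h3 := intervalIntegral.integral_comp_sub_left (a := 0) (b := t)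
    (fun ρ => ga μ (h (cl T (t - ρ))) ρ x) t
  simp only [sub_sub_cancel, sub_self, sub_zero] at h3
  rw [mul_zero, mul_one, h3]

lemma heatP_eq_ga (g : Spc n → ℝ) (t : ℝ) (x : Spc n) : heatP μ T g t x = ga μ g t x := by
  unfold heatP hop ga piP
  rw [Measure.dirac_prod, (measurableEmbedding_prodMk_left (1 : ℝ)).integral_map]
  simp [ho]

lemma lap_heatV (hμ : 0 < μ) (hT : 0 ≤ T) (hex : GoodEx ex κ) (hβ : 1 ≤ β) (hp : 0 ≤ p)
    (hh : XS T β ex 2 p C h) {t : ℝ} (ht : t ∈ Set.Icc 0 T) (x : Spc n) :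
    lap (heatV μ T h t) x = ∑ i, heatV μ T (dx i (dx i h)) t x := by
  have H : ∀ {m : ℕ} {p : ℝ} {h : ℝ → Spc n → ℝ} (_ : 0 ≤ p) (_ : XS T β ex (m + 1) p C h)
      (i : Fin n) (x : Spc n), pd i (heatV μ T h t) x = heatV μ T (dx i h) t x := by
    intro m p h hp hh i x
    have h1 := hex.pos (m + 1)
    exact (hasFDerivAt_hop (c := 2 * μ) (heatV_ker hT hex.kpos hex.klt (p + 1 + ex (m + 1)) hβ)
      (by linarith) hT (by linarith) (hex.pos _) hex.kpos (hex.le _) hp le_rfl hh.hb (hex.pos m)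
      (by linarith) hh.diff (fun i => (hh.dx i).hb) ht x).2 i
  unfold lap
  refine Finset.sum_congr rfl fun i _ => ?_
  rw [funext fun x => H hp hh i x]
  exact H (by linarith) (hh.dx i) i x

lemma lap_heatP (hμ : 0 < μ) (hT : 0 ≤ T) (hex : GoodEx ex κ) (hp : 0 ≤ p) {g : Spc n → ℝ}
    (hh : XS T 0 ex 2 p C fun _ => g) {t : ℝ} (ht : t ∈ Set.Icc 0 T) (x : Spc n) :
    lap (heatP μ T g t) x = ∑ i, heatP μ T (pd i (pd i g)) t x := by
  have H : ∀ {m : ℕ} {p : ℝ} {g : Spc n → ℝ} (_ : 0 ≤ p) (_ : XS T 0 ex (m + 1) p C fun _ => g)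
      (i : Fin n) (x : Spc n), pd i (heatP μ T g t) x = heatP μ T (pd i g) t x := by
    intro m p g hp hh i x
    have h1 := hex.pos (m + 1)
    exact (hasFDerivAt_hop (c := 2 * μ) (heatP_ker (κ := κ) (p + 1 + ex (m + 1)))
      (by linarith) hT le_rfl (hex.pos _) hex.kpos (hex.le _) hp le_rfl hh.hb (hex.pos m)
      (by linarith) hh.diff (fun i => (hh.dx i).hb) ht x).2 i
  unfold lap
  refine Finset.sum_congr rfl fun i _ => ?_
  rw [funext fun x => H hp hh i x]
  exact H (by linarith) (hh.dx i) i x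

lemma HB.continuous_cl_time {e : ℝ} (hT : 0 ≤ T) (hh : HB T β e p C h) (he : 0 < e)
    (hp : 0 ≤ p) (hβ : 0 ≤ β) (x : Spc n) : Continuous fun t => h (cl T t) x :=
  continuous_comp_cl hT (hh.continuousOn he hp hβ) continuous_id continuous_const

lemma continuous_heatV_cl (hμ : 0 < μ) (hT : 0 ≤ T) (hex : GoodEx ex κ) (hβ : 1 ≤ β)
    (hp : 0 ≤ p) {m : ℕ} (hh : XS T β ex m p C h) (x : Spc n) :
    Continuous fun σ => heatV μ T h (cl T σ) x :=
  (hb_hop (c := 2 * μ) (heatV_ker hT hex.kpos hex.klt (p + ex m) hβ) (by linarith) hT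
    (by linarith) (hex.pos m) hex.kpos (hex.le m) hp le_rfl hh.hb).continuous_cl_time hT
    (hex.pos m) hp (by linarith) x

lemma continuous_heatP_cl (hμ : 0 < μ) (hT : 0 ≤ T) (hex : GoodEx ex κ) (hp : 0 ≤ p) {m : ℕ}
    {g : Spc n → ℝ} (hh : XS T 0 ex m p C fun _ => g) (x : Spc n) :
    Continuous fun σ => heatP μ T g (cl T σ) x :=
  (hb_hop (c := 2 * μ) (heatP_ker (κ := κ) (p + ex m)) (by linarith) hT le_rfl (hex.pos m)
    hex.kpos (hex.le m) hp le_rfl hh.hb).continuous_cl_time hT (hex.pos m) hp le_rfl x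

/-- The heat potential of a source term solves the inhomogeneous heat equation. -/
lemma heatV_integral_eq (hμ : 0 < μ) (hT : 0 ≤ T) (hex : GoodEx ex κ) (hβ : 1 ≤ β) (hp : 0 ≤ p)
    (hh : XS T β ex 2 p C h) {t : ℝ} (ht : t ∈ Set.Icc 0 T) (x : Spc n) :
    heatV μ T h t x = ∫ σ in (0 : ℝ)..t,
      (h (cl T σ) x + μ * ∑ i, heatV μ T (dx i (dx i h)) (cl T σ) x) := by
  have hβ0 : 0 ≤ β := by linarith
  have hcont : ∀ {m : ℕ} {p : ℝ} {h : ℝ → Spc n → ℝ} (_ : 0 ≤ p) (_ : XS T β ex m p C h),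
      Continuous fun q : ℝ × ℝ => ga μ (h (cl T q.2)) q.1 x := by
    intro m p h hp hh
    have hC := hh.const_nonneg hT
    refine continuous_ga_cl (B := C * Real.exp (β * T)) μ hT
      (hh.hb.continuousOn (hex.pos m) hp hβ0) (fun s hs y => (hh.hb.bd s hs y).trans ?_) x
    have hw0 := (Real.rpow_pos_of_pos (wt_pos y) (-p)).le
    have hs2 := hs.2
    calc C * Real.exp (β * s) * wt y ^ (-p) ≤ C * Real.exp (β * T) * 1 := by
          gcongr
          exact Real.rpow_le_one_of_one_le_of_nonpos (one_le_wt y) (by linarith)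
      _ = _ := mul_one _
  have hG : ∀ i, Continuous fun q : ℝ × ℝ => ga μ (dx i (dx i h) (cl T q.2)) (q.1 - q.2) x :=
    fun i => (hcont (by linarith) ((hh.dx i).dx i)).comp
      (by fun_prop : Continuous fun q : ℝ × ℝ => (q.1 - q.2, q.2))
  have hhc := hh.hb.continuous_cl_time hT (hex.pos 2) hp hβ0 x
  have hVc : ∀ i, Continuous fun σ => heatV μ T (dx i (dx i h)) (cl T σ) x := fun i =>
    continuous_heatV_cl hμ hT hex hβ (by linarith) ((hh.dx i).dx i) x
  have h1 : heatV μ T h t x = ∫ τ in (0 : ℝ)..t, (h (cl T τ) x + ∑ i, μ * ∫ σ in τ..t,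
      ga μ (dx i (dx i h) (cl T τ)) (σ - τ) x) := by
    rw [heatV_eq_integral hμ hT hex hβ hp hh ht]
    refine intervalIntegral.integral_congr fun τ hτ => ?_
    rw [Set.uIcc_of_le ht.1] at hτ
    rw [ga_sub hμ (hh.cB hex hp hβ0 (cl_mem hT τ)) x (sub_nonneg.2 hτ.2)]
    congr 1
    refine Finset.sum_congr rfl fun i _ => ?_
    rw [intervalIntegral.integral_comp_sub_right
      (f := fun r => ga μ (dx i (dx i h) (cl T τ)) r x), sub_self]
    rfl
  have hin : ∀ i, Continuous fun τ => ∫ σ in τ..t,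
      ga μ (dx i (dx i h) (cl T τ)) (σ - τ) x := by
    intro i
    have h2 : (fun τ => ∫ σ in τ..t, ga μ (dx i (dx i h) (cl T τ)) (σ - τ) x) = fun τ =>
        -∫ σ in t..τ, ga μ (dx i (dx i h) (cl T τ)) (σ - τ) x :=
      funext fun τ => intervalIntegral.integral_symm _ _
    rw [h2]
    exact (intervalIntegral.continuous_parametric_intervalIntegral_of_continuous
      (f := fun τ σ => ga μ (dx i (dx i h) (cl T τ)) (σ - τ) x)
      ((hG i).comp continuous_swap) continuous_id).neg
  have hin' : ∀ i, Continuous fun τ => μ * ∫ σ in τ..t,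
      ga μ (dx i (dx i h) (cl T τ)) (σ - τ) x := fun i => continuous_const.mul (hin i)
  have hVs : Continuous fun σ => μ * ∑ i, heatV μ T (dx i (dx i h)) (cl T σ) x :=
    continuous_const.mul (continuous_finsetSum _ fun i _ => hVc i)
  rw [h1, intervalIntegral.integral_add (hhc.intervalIntegrable _ _)
    (Continuous.intervalIntegrable (continuous_finsetSum _ fun i _ => hin' i) _ _),
    intervalIntegral.integral_add (hhc.intervalIntegrable _ _)
    (hVs.intervalIntegrable _ _),
    intervalIntegral.integral_finsetSum fun i _ =>
      (hin' i).intervalIntegrable _ _,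
    intervalIntegral.integral_const_mul, intervalIntegral.integral_finsetSum fun i _ =>
      (hVc i).intervalIntegrable _ _, Finset.mul_sum]
  congr 1
  refine Finset.sum_congr rfl fun i _ => ?_
  rw [intervalIntegral.integral_const_mul, integral_triangle_swap (hG i) ht.1]
  congr 1
  refine intervalIntegral.integral_congr fun σ hσ => ?_
  rw [Set.uIcc_of_le ht.1] at hσ
  have hσT : σ ∈ Set.Icc 0 T := ⟨hσ.1, hσ.2.trans ht.2⟩
  rw [cl_eq hσT, heatV_eq_integral hμ hT hex hβ (by linarith) ((hh.dx i).dx i) hσT]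

lemma heatP_integral_eq (hμ : 0 < μ) (hT : 0 ≤ T) (hex : GoodEx ex κ) (hp : 0 ≤ p)
    {g : Spc n → ℝ} (hh : XS T 0 ex 2 p C fun _ => g) {t : ℝ} (ht : t ∈ Set.Icc 0 T)
    (x : Spc n) : heatP μ T g t x = g x + ∫ σ in (0 : ℝ)..t,
      μ * ∑ i, heatP μ T (pd i (pd i g)) (cl T σ) x := by
  have hVc : ∀ i, Continuous fun σ => heatP μ T (pd i (pd i g)) (cl T σ) x := fun i =>
    continuous_heatP_cl hμ hT hex (by linarith) ((hh.dx i).dx i) x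
  rw [heatP_eq_ga, ga_sub hμ (hh.cB hex hp le_rfl ht) x ht.1,
    intervalIntegral.integral_const_mul, intervalIntegral.integral_finsetSum fun i _ =>
      (hVc i).intervalIntegrable _ _, Finset.mul_sum]
  congr 1
  refine Finset.sum_congr rfl fun i _ => ?_
  congr 1
  refine intervalIntegral.integral_congr fun σ hσ => ?_
  rw [Set.uIcc_of_le ht.1] at hσ
  rw [cl_eq ⟨hσ.1, hσ.2.trans ht.2⟩, heatP_eq_ga]

lemma hasDerivWithinAt_of_integral_eq {φ ψ : ℝ → ℝ} {c : ℝ} (hψ : Continuous fun t => ψ (cl T t))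
    (h : ∀ t ∈ Set.Icc 0 T, φ t = c + ∫ σ in (0 : ℝ)..t, ψ (cl T σ)) {t : ℝ}
    (ht : t ∈ Set.Icc 0 T) : HasDerivWithinAt φ (ψ t) (Set.Icc 0 T) t := by
  have h1 := intervalIntegral.integral_hasDerivAt_right (hψ.intervalIntegrable 0 t)
    (hψ.stronglyMeasurableAtFilter _ _) hψ.continuousAt
  rw [cl_eq ht] at h1
  exact (h1.const_add c).hasDerivWithinAt.congr h (h t ht)

lemma heatV_hasDerivWithinAt (hμ : 0 < μ) (hT : 0 ≤ T) (hex : GoodEx ex κ) (hβ : 1 ≤ β)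
    (hp : 0 ≤ p) (hh : XS T β ex 2 p C h) {t : ℝ} (ht : t ∈ Set.Icc 0 T) (x : Spc n) :
    HasDerivWithinAt (fun τ => heatV μ T h τ x) (h t x + μ * lap (heatV μ T h t) x)
      (Set.Icc 0 T) t := by
  rw [lap_heatV hμ hT hex hβ hp hh ht]
  refine hasDerivWithinAt_of_integral_eq (c := 0)
    (ψ := fun t => h t x + μ * ∑ i, heatV μ T (dx i (dx i h)) t x) ?_ (fun t ht => ?_) ht
  · exact (hh.hb.continuous_cl_time hT (hex.pos 2) hp (by linarith) x).add
      (continuous_const.mul (continuous_finsetSum _ fun i _ =>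
        continuous_heatV_cl hμ hT hex hβ (by linarith) ((hh.dx i).dx i) x))
  · rw [zero_add]
    exact heatV_integral_eq hμ hT hex hβ hp hh ht x

lemma heatP_hasDerivWithinAt (hμ : 0 < μ) (hT : 0 ≤ T) (hex : GoodEx ex κ) (hp : 0 ≤ p)
    {g : Spc n → ℝ} (hh : XS T 0 ex 2 p C fun _ => g) {t : ℝ} (ht : t ∈ Set.Icc 0 T)
    (x : Spc n) : HasDerivWithinAt (fun τ => heatP μ T g τ x) (μ * lap (heatP μ T g t) x)
      (Set.Icc 0 T) t := by
  rw [lap_heatP hμ hT hex hp hh ht]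
  exact hasDerivWithinAt_of_integral_eq (c := g x)
    (ψ := fun t => μ * ∑ i, heatP μ T (pd i (pd i g)) t x)
    (continuous_const.mul (continuous_finsetSum _ fun i _ =>
      continuous_heatP_cl hμ hT hex (by linarith) ((hh.dx i).dx i) x))
    (fun t ht => heatP_integral_eq hμ hT hex hp hh ht x) ht

lemma heatV_zero_time (x : Spc n) : heatV μ T h 0 x = 0 := by
  simp [heatV, hop, ho]

lemma heatP_zero_time (g : Spc n → ℝ) (x : Spc n) : heatP μ T g 0 x = g x := by
  rw [heatP_eq_ga, ga_zero]

end heat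

/-! ### Uniqueness for the heat equation -/

lemma hasDerivAt_line {f : Spc n → ℝ} {x : Spc n} (i : Fin n) {s : ℝ}
    (hf : DifferentiableAt ℝ f (x + s • EuclideanSpace.single i 1)) :
    HasDerivAt (fun s : ℝ => f (x + s • EuclideanSpace.single i 1))
      (pd i f (x + s • EuclideanSpace.single i 1)) s := by
  have h1 : HasDerivAt (fun s : ℝ => x + s • (EuclideanSpace.single i 1 : Spc n))
      (EuclideanSpace.single i 1) s := by
    simpa using ((hasDerivAt_id s).smul_const (EuclideanSpace.single i 1 : Spc n)).const_add x
  exact hf.hasFDerivAt.comp_hasDerivAt s h1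

lemma pd_pd_nonpos_of_isLocalMax {f : Spc n → ℝ} {x : Spc n} (hf : Differentiable ℝ f)
    (i : Fin n) (hf2 : Differentiable ℝ (pd i f)) (hx : IsLocalMax f x) :
    pd i (pd i f) x ≤ 0 := by
  by_contra! hpos
  set e : Spc n := EuclideanSpace.single i 1
  set g : ℝ → ℝ := fun s => f (x + s • e) with hg
  have hg1 : deriv g = fun s => pd i f (x + s • e) :=
    funext fun s => (hasDerivAt_line i (hf _)).deriv
  have hg2 : deriv (deriv g) 0 = pd i (pd i f) x := by
    rw [hg1, (hasDerivAt_line i (hf2 _)).deriv]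
    simp
  have hmax : IsLocalMax g 0 := by
    have hc : ContinuousAt (fun s : ℝ => x + s • e) 0 := by fun_prop
    have : Tendsto (fun s : ℝ => x + s • e) (nhds 0) (nhds x) := by simpa using hc.tendsto
    have h2 := this.eventually hx
    filter_upwards [h2] with s hs
    simpa [hg] using hs
  have hmin : IsLocalMin g 0 :=
    isLocalMin_of_deriv_deriv_pos (by rw [hg2]; exact hpos) hmax.deriv_eq_zero
      (hasDerivAt_line i (hf _)).continuousAt
  have hcst : g =ᶠ[nhds 0] fun _ => g 0 := by
    filter_upwards [hmax, hmin] with s h1 h2 using le_antisymm h1 h2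
  have h0 : deriv (deriv g) 0 = 0 := by
    have h3 := hcst.deriv.deriv_eq
    simpa using h3
  rw [hg2] at h0
  exact hpos.ne' h0

lemma nonneg_of_hasDerivAt_of_le_left {φ : ℝ → ℝ} {D s t : ℝ} (hst : s < t)
    (h : HasDerivAt φ D t) (hle : ∀ τ ∈ Set.Ico s t, φ τ ≤ φ t) : 0 ≤ D := by
  have h1 := (hasDerivWithinAt_iff_tendsto_slope' (s := Set.Iio t) (by simp)).1
    (h.hasDerivWithinAt (s := Set.Iio t))
  refine ge_of_tendsto h1 ?_
  filter_upwards [Ico_mem_nhdsLT hst] with τ hτ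
  rw [slope_def_field]
  exact div_nonneg_of_nonpos (by linarith [hle τ hτ]) (by linarith [hτ.2])

lemma heat_nonpos {T μ δ C : ℝ} (hμ : 0 < μ) (hδ : 0 < δ) {w : ℝ → Spc n → ℝ}
    (hc : ContinuousOn (fun q : ℝ × Spc n => w q.1 q.2) (Set.Icc 0 T ×ˢ Set.univ))
    (hb : ∀ t ∈ Set.Icc 0 T, ∀ x, |w t x| ≤ C * wt x ^ (-δ))
    (hd : ∀ t ∈ Set.Icc 0 T, Differentiable ℝ (w t))
    (hd2 : ∀ t ∈ Set.Icc 0 T, ∀ i, Differentiable ℝ (pd i (w t)))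
    (hpde : ∀ t ∈ Set.Ioo 0 T, ∀ x, HasDerivAt (fun τ => w τ x) (μ * lap (w t) x) t)
    (h0 : ∀ x, w 0 x = 0) {t : ℝ} (ht : t ∈ Set.Ico 0 T) (x : Spc n) : w t x ≤ 0 := by
  by_contra! hpos
  set a := w t x
  have hT : 0 < T := ht.1.trans_lt ht.2
  obtain ⟨ρ, hρx, hρ⟩ : ∃ ρ, ‖x‖ ≤ ρ ∧ ∀ y : Spc n, ρ ≤ ‖y‖ → C * wt y ^ (-δ) ≤ a / 4 := by
    have h1 : Tendsto (fun r : ℝ => |C| * r ^ (-δ)) atTop (nhds (|C| * 0)) :=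
      (tendsto_rpow_neg_atTop hδ).const_mul _
    rw [mul_zero] at h1
    obtain ⟨ρ, hρ1, hρ2, hρ3⟩ := ((h1.eventually_lt_const (show 0 < a / 4 by positivity)).and
      ((eventually_ge_atTop ‖x‖).and (eventually_gt_atTop 0))).exists
    refine ⟨ρ, hρ2, fun y hy => le_trans ?_ hρ1.le⟩
    have h2 : wt y ^ (-δ) ≤ ρ ^ (-δ) :=
      Real.rpow_le_rpow_of_nonpos hρ3 (hy.trans (norm_le_wt y)) (by linarith)
    have h3 : 0 ≤ wt y ^ (-δ) := (Real.rpow_pos_of_pos (wt_pos y) _).le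
    calc C * wt y ^ (-δ) ≤ |C| * wt y ^ (-δ) := by gcongr; exact le_abs_self C
      _ ≤ _ := by gcongr
  set η := a / (2 * T) with hη
  have hη0 : 0 < η := by positivity
  have hηT : η * T = a / 2 := by rw [hη]; field_simp
  have hsub : Set.Icc 0 t ×ˢ Metric.closedBall (0 : Spc n) ρ ⊆ Set.Icc 0 T ×ˢ Set.univ :=
    Set.prod_mono (Set.Icc_subset_Icc_right ht.2.le) (Set.subset_univ _)
  obtain ⟨⟨t', x'⟩, ⟨ht', hx'⟩, hmax⟩ := (isCompact_Icc.prod (isCompact_closedBall (0 : Spc n) ρ)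
    ).exists_isMaxOn (f := fun q : ℝ × Spc n => w q.1 q.2 - η * q.1)
    ⟨(t, x), ⟨⟨ht.1, le_rfl⟩, by simpa using hρx⟩⟩
    ((hc.mono hsub).sub (by fun_prop))
  have hm : ∀ τ ∈ Set.Icc 0 t, ∀ y : Spc n, ‖y‖ ≤ ρ → w τ y - η * τ ≤ w t' x' - η * t' :=
    fun τ hτ y hy => hmax (a := (τ, y)) ⟨hτ, by simpa using hy⟩
  simp only at ht' hx'
  rw [mem_closedBall_zero_iff] at hx'
  have hbig : a / 2 ≤ w t' x' - η * t' := by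
    refine le_trans ?_ (hm t ⟨ht.1, le_rfl⟩ x hρx)
    have : η * t ≤ η * T := by gcongr; exact ht.2.le
    linarith
  have htT : t' ∈ Set.Icc 0 T := ⟨ht'.1, ht'.2.trans ht.2.le⟩
  have ht0 : 0 < t' := by
    rcases ht'.1.eq_or_lt with h | h
    · rw [← h, h0] at hbig
      linarith
    · exact h
  have hxρ : ‖x'‖ < ρ := by
    by_contra! h
    have h1 := hρ x' h
    have h2 := (le_abs_self _).trans (hb t' htT x')
    nlinarith
  have hlap : lap (w t') x' ≤ 0 := by
    refine Finset.sum_nonpos fun i _ => pd_pd_nonpos_of_isLocalMax (hd t' htT) i (hd2 t' htT i) ?_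
    filter_upwards [Metric.isOpen_ball.mem_nhds (mem_ball_zero_iff.2 hxρ)] with y hy
    have := hm t' ht' y (mem_ball_zero_iff.1 hy).le
    linarith
  have hD := hpde t' ⟨ht0, ht'.2.trans_lt ht.2⟩ x'
  have hD2 : HasDerivAt (fun τ => w τ x' - η * τ) (μ * lap (w t') x' - η) t' := by
    have := hD.sub ((hasDerivAt_id t').const_mul η)
    rw [mul_one] at this
    exact this
  have h3 := nonneg_of_hasDerivAt_of_le_left ht0 hD2
    fun τ hτ => hm τ ⟨hτ.1, hτ.2.le.trans ht'.2⟩ x' hx'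
  nlinarith

lemma heat_unique {T μ δ C : ℝ} (hT : 0 < T) (hμ : 0 < μ) (hδ : 0 < δ) {w : ℝ → Spc n → ℝ}
    (hc : ContinuousOn (fun q : ℝ × Spc n => w q.1 q.2) (Set.Icc 0 T ×ˢ Set.univ))
    (hb : ∀ t ∈ Set.Icc 0 T, ∀ x, |w t x| ≤ C * wt x ^ (-δ))
    (hd : ∀ t ∈ Set.Icc 0 T, Differentiable ℝ (w t))
    (hd2 : ∀ t ∈ Set.Icc 0 T, ∀ i, Differentiable ℝ (pd i (w t)))
    (hpde : ∀ t ∈ Set.Ioo 0 T, ∀ x, HasDerivAt (fun τ => w τ x) (μ * lap (w t) x) t)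
    (h0 : ∀ x, w 0 x = 0) : ∀ t ∈ Set.Icc 0 T, ∀ x, w t x = 0 := by
  have hneg : ∀ (f : Spc n → ℝ) i, pd i (fun y => -f y) = fun y => -pd i f y := by
    intro f i
    funext y
    unfold pd
    rw [fderiv_fun_neg]
    rfl
  have key : ∀ t ∈ Set.Ico 0 T, ∀ x, w t x = 0 := by
    intro t ht x
    refine le_antisymm (heat_nonpos hμ hδ hc hb hd hd2 hpde h0 ht x) ?_
    have := heat_nonpos (w := fun t x => -w t x) hμ hδ hc.neg (by simpa using hb)
      (fun t ht => (hd t ht).neg)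
      (fun t ht i => by
        rw [show (fun x => -w t x) = fun y => -w t y from rfl, hneg]
        exact (hd2 t ht i).neg)
      (fun t ht x => by
        have h1 := (hpde t ht x).neg
        have h2 : lap (fun y => -w t y) x = -lap (w t) x := by
          unfold lap
          simp only [hneg, Finset.sum_neg_distrib]
        rw [h2, mul_neg]
        exact h1)
      (by simpa using h0) ht x
    linarith
  intro t ht x
  rcases ht.2.eq_or_lt with h | h
  · subst h
    have hcx : ContinuousOn (fun τ => w τ x) (Set.Icc 0 t) :=
      hc.comp (f := fun τ => (τ, x)) (by fun_prop) fun τ hτ => ⟨hτ, trivial⟩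
    have h1 : Tendsto (fun τ => w τ x) (nhdsWithin t (Set.Ico 0 t)) (nhds (w t x)) :=
      (hcx t ht).mono Set.Ico_subset_Icc_self
    have hne : (nhdsWithin t (Set.Ico 0 t)).NeBot := by
      rw [← mem_closure_iff_nhdsWithin_neBot, closure_Ico hT.ne]
      exact ht
    refine tendsto_nhds_unique h1 (tendsto_const_nhds.congr' ?_)
    filter_upwards [self_mem_nhdsWithin] with τ hτ using (key τ hτ x).symm
  · exact key t ⟨ht.1, h⟩ x

/-! ### The nonlinearity -/

section nonlinearity

variable {q : ℕ}

/-- The symbol of `d ⊕ d^*`, acting on the array of first derivatives. -/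
def ddSym (G : Fin n → Fib n q) : Fib n (q + 1) × Fib n (q - 1) :=
  (fun J => ∑ i : Fin n,
    if h : i ∈ J.1 then
      (-1 : ℝ) ^ (J.1.filter fun j => j < i).card *
        G i ⟨J.1.erase i, by simp [Finset.card_erase_of_mem h, J.2]⟩
    else 0,
  fun K => -∑ i : Fin n,
    if h : i ∉ K.1 ∧ (insert i K.1).card = q then
      (-1 : ℝ) ^ (K.1.filter fun j => j < i).card * G i ⟨insert i K.1, h.2⟩
    else 0)

lemma ddSym_add (G H : Fin n → Fib n q) : ddSym (G + H) = ddSym G + ddSym H := by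
  refine Prod.ext (funext fun J => ?_) (funext fun J => ?_)
  · simp only [ddSym, Prod.fst_add, Pi.add_apply, ← Finset.sum_add_distrib]
    refine Finset.sum_congr rfl fun i _ => ?_
    split_ifs <;> ring
  · simp only [ddSym, Prod.snd_add, Pi.add_apply, ← neg_add, ← Finset.sum_add_distrib]
    congr 1
    refine Finset.sum_congr rfl fun i _ => ?_
    split_ifs <;> ring

lemma ddSym_smul (a : ℝ) (G : Fin n → Fib n q) : ddSym (a • G) = a • ddSym G := by
  refine Prod.ext (funext fun J => ?_) (funext fun J => ?_)
  · simp only [ddSym, Prod.smul_fst, Pi.smul_apply, smul_eq_mul, Finset.mul_sum]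
    refine Finset.sum_congr rfl fun i _ => ?_
    split_ifs <;> ring
  · simp only [ddSym, Prod.smul_snd, Pi.smul_apply, smul_eq_mul, mul_neg, Finset.mul_sum]
    congr 1
    refine Finset.sum_congr rfl fun i _ => ?_
    split_ifs <;> ring

/-- The nonlinearity as a bilinear map of the first derivatives and of the values. -/
def nlSym (M₁ : M1Type n q) (M₂ : M2Type n q) :
    (Fin n → Fib n q) →ₗ[ℝ] Fib n q →ₗ[ℝ] Fib n q :=
  LinearMap.mk₂ ℝ (fun G V J => M₁ (ddSym G) V J + ∑ i : Fin n,
    if h : i ∈ J.1 ∧ (J.1.erase i).card = q - 1 then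
      (-1 : ℝ) ^ (J.1.filter fun j => j < i).card *
        (M₂ (G i) V ⟨J.1.erase i, h.2⟩ + M₂ V (G i) ⟨J.1.erase i, h.2⟩)
    else 0)
  (by
    intro G H V
    funext J
    simp only [ddSym_add, map_add, LinearMap.add_apply, Pi.add_apply]
    rw [add_add_add_comm, ← Finset.sum_add_distrib]
    congr 1
    refine Finset.sum_congr rfl fun i _ => ?_
    split_ifs <;> ring)
  (by
    intro a G V
    funext J
    simp only [ddSym_smul, map_smul, LinearMap.smul_apply, Pi.smul_apply, smul_eq_mul, mul_add,
      Finset.mul_sum]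
    congr 1
    refine Finset.sum_congr rfl fun i _ => ?_
    split_ifs <;> ring)
  (by
    intro G V W
    funext J
    simp only [map_add, LinearMap.add_apply, Pi.add_apply]
    rw [add_add_add_comm, ← Finset.sum_add_distrib]
    congr 1
    refine Finset.sum_congr rfl fun i _ => ?_
    split_ifs <;> ring)
  (by
    intro a G V
    funext J
    simp only [map_smul, LinearMap.smul_apply, Pi.smul_apply, smul_eq_mul, mul_add,
      Finset.mul_sum]
    congr 1
    refine Finset.sum_congr rfl fun i _ => ?_
    split_ifs <;> ring)

lemma bilin_expand {ι κ' : Type*} [Fintype ι] [Fintype κ'] [DecidableEq ι]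
    [DecidableEq κ'] {M : Type*} [AddCommGroup M]
    [Module ℝ M] (B : (ι → ℝ) →ₗ[ℝ] (κ' → ℝ) →ₗ[ℝ] M) (V : ι → ℝ) (W : κ' → ℝ) :
    B V W = ∑ i, ∑ j, (V i * W j) • B (Pi.single i 1) (Pi.single j 1) := by
  conv_lhs => rw [pi_eq_sum_univ' V, pi_eq_sum_univ' W]
  simp only [map_sum, map_smul, LinearMap.sum_apply, LinearMap.smul_apply, Finset.smul_sum,
    smul_smul]
  rw [Finset.sum_comm]
  simp only [mul_comm]

lemma pd_bilin {ι : Type*} [Fintype ι] {ι' : Type*} (i : Fin n)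
    (B : (ι → ℝ) →ₗ[ℝ] (ι → ℝ) →ₗ[ℝ] (ι' → ℝ)) (P : ι') {f g : ι → Spc n → ℝ} {x : Spc n}
    (hf : ∀ I, DifferentiableAt ℝ (f I) x) (hg : ∀ I, DifferentiableAt ℝ (g I) x) :
    pd i (fun y => B (fun I => f I y) (fun I => g I y) P) x =
      B (fun I => pd i (f I) x) (fun I => g I x) P +
        B (fun I => f I x) (fun I => pd i (g I) x) P := by
  have hB : ∀ V W, B V W P = ∑ i, ∑ j, (V i * W j) * B (Pi.single i 1) (Pi.single j 1) P := by
    intro V W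
    rw [bilin_expand B V W]
    simp only [Finset.sum_apply, Pi.smul_apply, smul_eq_mul]
  rw [hB, hB]
  simp_rw [hB (fun I => f I _)]
  unfold pd
  rw [fderiv_fun_sum fun I _ => DifferentiableAt.fun_sum fun J _ =>
    ((hf I).fun_mul (hg J)).mul_const _]
  simp only [_root_.sum_apply]
  rw [← Finset.sum_add_distrib]
  refine Finset.sum_congr rfl fun I _ => ?_
  rw [fderiv_fun_sum fun J _ => ((hf I).fun_mul (hg J)).mul_const _]
  simp only [_root_.sum_apply]
  rw [← Finset.sum_add_distrib]
  refine Finset.sum_congr rfl fun J _ => ?_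
  rw [fderiv_mul_const ((hf I).fun_mul (hg J)), fderiv_fun_mul (hf I) (hg J)]
  simp only [_root_.add_apply, _root_.smul_apply, smul_eq_mul]
  ring

lemma Nop_eq_nlSym (M₁ : M1Type n q) (M₂ : M2Type n q) (u : FormT n q) (t : ℝ) (x : Spc n)
    (hu : ∀ I, DifferentiableAt ℝ (u I t) x) (K : Idx n q) :
    Nop M₁ M₂ u K t x = nlSym M₁ M₂ (fun i I => pd i (u I t) x) (fun I => u I t x) K := by
  unfold Nop nlSym
  rw [LinearMap.mk₂_apply]
  congr 1
  unfold dLowT dLowS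
  refine Finset.sum_congr rfl fun i _ => ?_
  split_ifs with h
  · congr 1
    exact pd_bilin i M₂ _ hu hu
  · rfl

/-- The bilinear first order operator with coefficients `c`. -/
def bil {ι : Type*} [Fintype ι] (c : ι → Fin n → ι → ι → ℝ) (U V : ι → ℝ → Spc n → ℝ) (K : ι)
    (t : ℝ) (x : Spc n) : ℝ :=
  ∑ i, ∑ I, ∑ J, c K i I J * (dx i (U I) t x * V J t x)

lemma exists_Nop_eq_bil (M₁ : M1Type n q) (M₂ : M2Type n q) :
    ∃ c : Idx n q → Fin n → Idx n q → Idx n q → ℝ, ∀ (u : FormT n q) (t : ℝ) (x : Spc n),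
      (∀ I, DifferentiableAt ℝ (u I t) x) → ∀ K, Nop M₁ M₂ u K t x = bil c u u K t x := by
  refine ⟨fun K i I J => nlSym M₁ M₂ (Pi.single i (Pi.single I 1)) (Pi.single J 1) K,
    fun u t x hu K => ?_⟩
  rw [Nop_eq_nlSym M₁ M₂ u t x hu K]
  have h1 : (fun i I => pd i (u I t) x : Fin n → Fib n q) =
      ∑ i, LinearMap.single ℝ (fun _ : Fin n => Fib n q) i (fun I => pd i (u I t) x) := by
    funext j
    simp [Finset.sum_apply, Pi.single_apply]
  rw [h1]
  simp only [map_sum, LinearMap.sum_apply, Finset.sum_apply]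
  unfold bil
  refine Finset.sum_congr rfl fun i _ => ?_
  have h2 := bilin_expand ((nlSym M₁ M₂).comp (LinearMap.single ℝ (fun _ : Fin n => Fib n q) i))
    (fun I => pd i (u I t) x) (fun I => u I t x)
  simp only [LinearMap.comp_apply] at h2
  rw [h2]
  simp only [Finset.sum_apply, Pi.smul_apply, smul_eq_mul, LinearMap.single_apply]
  refine Finset.sum_congr rfl fun I _ => Finset.sum_congr rfl fun J _ => ?_
  rw [mul_comm]
  rfl

end nonlinearity

/-! ### The quadratic fixed point problem -/

section picard

variable {T β p κ C μ A : ℝ} {ex : ℕ → ℝ} {m : ℕ} {ι : Type*} [Fintype ι]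
  {U V W : ι → ℝ → Spc n → ℝ}

lemma bil_sub_left (c : ι → Fin n → ι → ι → ℝ) {t : ℝ} {x : Spc n}
    (hU : ∀ I, DifferentiableAt ℝ (U I t) x) (hW : ∀ I, DifferentiableAt ℝ (W I t) x) (k : ι) :
    bil c (fun I t x => U I t x - W I t x) V k t x = bil c U V k t x - bil c W V k t x := by
  simp only [bil, dx, ← Finset.sum_sub_distrib]
  refine Finset.sum_congr rfl fun i _ => Finset.sum_congr rfl fun I _ =>
    Finset.sum_congr rfl fun J _ => ?_
  rw [pd_sub i (hU I) (hW I)]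
  ring

lemma bil_sub_right (c : ι → Fin n → ι → ι → ℝ) (t : ℝ) (x : Spc n) (k : ι) :
    bil c U (fun I t x => V I t x - W I t x) k t x = bil c U V k t x - bil c U W k t x := by
  simp only [bil, ← Finset.sum_sub_distrib]
  refine Finset.sum_congr rfl fun i _ => Finset.sum_congr rfl fun I _ =>
    Finset.sum_congr rfl fun J _ => ?_
  ring

lemma xs_bil (hex : GoodEx ex κ) (hT : 0 ≤ T) (hp : 0 ≤ p) (m : ℕ)
    (c : ι → Fin n → ι → ι → ℝ) : ∃ K, 0 ≤ K ∧ ∀ β, 0 ≤ β → ∀ A C (U V : ι → ℝ → Spc n → ℝ),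
      (∀ I, XS T 0 ex (m + 1) p A (U I)) → (∀ I, XS T β ex (m + 1) p C (V I)) → ∀ k,
      XS T β ex m (p + 1) (K * (A * C)) (bil c U V k) ∧
      XS T β ex m (p + 1) (K * (A * C)) (bil c V U k) := by
  set K₀ := 2 * (2 * (2 + T)) ^ m * (2 + T) with hK₀
  have hK₀0 : 0 ≤ K₀ := by positivity
  refine ⟨(∑ k, ∑ i, ∑ I, ∑ J, |c k i I J|) * K₀, by positivity,
    fun β hβ A C U V hU hV k => ?_⟩
  have hA : ∀ I : ι, 0 ≤ A := fun I => (hU I).const_nonneg hT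
  have hC : ∀ I : ι, 0 ≤ C := fun I => (hV I).const_nonneg hT
  have hAC := mul_nonneg (hA k) (hC k)
  have hle : (∑ i, ∑ I, ∑ J, |c k i I J| * (K₀ * (A * C))) ≤
      (∑ k, ∑ i, ∑ I, ∑ J, |c k i I J|) * K₀ * (A * C) := by
    simp only [← Finset.sum_mul, mul_assoc]
    gcongr
    exact Finset.single_le_sum (f := fun k => ∑ i, ∑ I, ∑ J, |c k i I J|)
      (fun _ _ => by positivity) (Finset.mem_univ k)
  constructor
  · refine XS.mono ?_ hle
    refine XS.sum _ fun i _ => XS.sum _ fun I _ => XS.sum _ fun J _ => XS.const_mul ?_ _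
    have h := ((hU I).dx i).mul hex ((hV J).pred hex hp hT) (by linarith) hp hβ hT
    refine XS.mono (h.weight_mono (by linarith) hT) (le_of_eq ?_)
    rw [hK₀]
    ring
  · refine XS.mono ?_ hle
    refine XS.sum _ fun i _ => XS.sum _ fun I _ => XS.sum _ fun J _ => XS.const_mul ?_ _
    have h := ((hU J).pred hex hp hT).mul hex ((hV I).dx i) hp (by linarith) hβ hT
    refine XS.mono ((h.weight_mono (p := p + 1) (by linarith) hT).congr
      fun t _ x => mul_comm _ _) (le_of_eq ?_)
    rw [hK₀]
    ring

lemma heatV_sub (hT : 0 ≤ T) (hμ : 0 < μ) (hex : GoodEx ex κ) (hβ : 1 ≤ β) (hp : 0 ≤ p) {C' : ℝ}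
    {h h' : ℝ → Spc n → ℝ} {m m' : ℕ} (hh : XS T β ex m p C h) (hh' : XS T β ex m' p C' h')
    {t : ℝ} (ht : t ∈ Set.Icc 0 T) (x : Spc n) :
    heatV μ T (fun t x => h t x - h' t x) t x = heatV μ T h t x - heatV μ T h' t x := by
  have hint : ∀ {k : ℕ} {C : ℝ} {h : ℝ → Spc n → ℝ}, XS T β ex k p C h →
      Integrable (fun z => ho (2 * μ) T (fun t => t) (fun z => gk z.2) h z t x) (piV n) :=
    fun {k} _ _ hh => (hb_hop_aux (c := 2 * μ) (heatV_ker hT hex.kpos hex.klt (p + ex k) hβ)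
      (by linarith) hT (by linarith) (hex.pos k) hex.kpos (hex.le k) hp le_rfl hh.hb).2 t ht x
  unfold heatV hop
  rw [← integral_sub (hint hh) (hint hh')]
  congr 1
  ext1 z
  simp only [ho]
  ring

/-- The quadratic expression in the perturbation equation. -/
def quad (c : ι → Fin n → ι → ι → ℝ) (U V : ι → ℝ → Spc n → ℝ) (k : ι) (t : ℝ) (x : Spc n) : ℝ :=
  bil c U V k t x + bil c V U k t x + bil c V V k t x

lemma quad_sub (c : ι → Fin n → ι → ι → ℝ) {t : ℝ} {x : Spc n}
    (hV : ∀ I, DifferentiableAt ℝ (V I t) x) (hW : ∀ I, DifferentiableAt ℝ (W I t) x) (k : ι) :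
    quad c U V k t x - quad c U W k t x =
      (bil c U (fun I t x => V I t x - W I t x) k t x
        + bil c (fun I t x => V I t x - W I t x) U k t x)
      + (bil c (fun I t x => V I t x - W I t x) V k t x
        + bil c W (fun I t x => V I t x - W I t x) k t x) := by
  rw [bil_sub_left c hV hW, bil_sub_right, bil_sub_left c hV hW, bil_sub_right]
  unfold quad
  ring

lemma xs_quad (hex : GoodEx ex κ) (hT : 0 ≤ T) (hp : 0 ≤ p) (c : ι → Fin n → ι → ι → ℝ)
    {A B : ℝ} (hU : ∀ I, XS T 0 ex (m + 1) p A (U I)) (hV : ∀ I, XS T 0 ex (m + 1) p B (V I))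
    (k : ι) : ∃ C, XS T 0 ex m (p + 1) C (quad c U V k) := by
  obtain ⟨K₁, hK₁, h₁⟩ := xs_bil hex hT hp m c
  exact ⟨_, ((h₁ 0 le_rfl _ _ _ _ hU hV k).1.add (h₁ 0 le_rfl _ _ _ _ hU hV k).2).add
    (h₁ 0 le_rfl _ _ _ _ hV hV k).1⟩

lemma heatV_quad_contract (hex : GoodEx ex κ) (hT : 0 ≤ T) (hμ : 0 < μ) (hp : 0 ≤ p)
    (hm : ex (m + 1) = ex m) (c : ι → Fin n → ι → ι → ℝ) (A B : ℝ)
    (hU : ∀ I, XS T 0 ex (m + 1) p A (U I)) :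
    ∃ β, 1 ≤ β ∧ ∀ (C : ℝ) (V W : ι → ℝ → Spc n → ℝ),
      (∀ I, XS T 0 ex (m + 1) p B (V I)) → (∀ I, XS T 0 ex (m + 1) p B (W I)) →
      (∀ I, XS T β ex (m + 1) p C (fun t x => V I t x - W I t x)) → ∀ k,
      XS T β ex (m + 1) p (C / 2) (fun t x =>
        heatV μ T (quad c U V k) t x - heatV μ T (quad c U W k) t x) := by
  obtain ⟨K₁, hK₁, h₁⟩ := xs_bil hex hT hp m c
  obtain ⟨K₂, hK₂, h₂⟩ := xs_heatV_gain (n := n) hT hμ hex (p + m + 2)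
  obtain ⟨β, hβ1, hβ⟩ : ∃ β, 1 ≤ β ∧ K₂ * β ^ (-κ) * (K₁ * (2 * A + 2 * B)) ≤ 1 / 2 := by
    have h1 : Tendsto (fun β : ℝ => K₂ * β ^ (-κ) * (K₁ * (2 * A + 2 * B))) atTop
        (nhds (K₂ * 0 * (K₁ * (2 * A + 2 * B)))) :=
      ((tendsto_rpow_neg_atTop hex.kpos).const_mul _).mul_const _
    simp only [mul_zero, zero_mul] at h1
    obtain ⟨β, h2, h3⟩ := ((h1.eventually_lt_const (show (0 : ℝ) < 1 / 2 by norm_num)).and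
      (eventually_ge_atTop 1)).exists
    exact ⟨β, h3, h2.le⟩
  refine ⟨β, hβ1, fun C V W hV hW hVW k => ?_⟩
  have hC : 0 ≤ C := (hVW k).const_nonneg hT
  have hβ0 : 0 ≤ β := by linarith
  have a1 := h₁ β hβ0 _ _ _ _ hU hVW k
  have a2 := h₁ β hβ0 _ _ _ _ hV hVW k
  have a3 := h₁ β hβ0 _ _ _ _ hW hVW k
  have h4 := (a1.1.add a1.2).add (a2.2.add a3.1)
  have h5 : XS T β ex m (p + 1) (K₁ * (2 * A + 2 * B) * C)
      (fun t x => quad c U V k t x - quad c U W k t x) :=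
    (h4.congr fun t ht x => quad_sub c (fun I => (hV I).diff t ht x)
      (fun I => (hW I).diff t ht x) k).mono (by linarith)
  have h6 := h₂ β hβ1 m p _ _ hp le_rfl hm h5
  obtain ⟨CV, hCV⟩ := xs_quad hex hT hp c hU hV k
  obtain ⟨CW, hCW⟩ := xs_quad hex hT hp c hU hW k
  refine (h6.congr fun t ht x => ?_).mono ?_
  · exact (heatV_sub hT hμ hex hβ1 (by linarith) (hCV.rate_mono hβ0 hT) (hCW.rate_mono hβ0 hT)
      ht x).symm
  · calc _ = K₂ * β ^ (-κ) * (K₁ * (2 * A + 2 * B)) * C := by ring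
      _ ≤ 1 / 2 * C := by gcongr
      _ = C / 2 := by ring

lemma heatV_zero_fun (t : ℝ) (x : Spc n) : heatV μ T (fun _ _ => 0) t x = 0 := by
  unfold heatV hop ho
  simp

lemma quad_zero (c : ι → Fin n → ι → ι → ℝ) (k : ι) (t : ℝ) (x : Spc n) :
    quad c U (fun _ _ _ => 0) k t x = 0 := by
  simp [quad, bil, dx, pd_zero]

lemma exists_fixed (hex : GoodEx ex κ) (hT : 0 ≤ T) (hμ : 0 < μ) (hp : 0 ≤ p)
    (hm : ex (m + 1) = ex m) (c : ι → Fin n → ι → ι → ℝ) (A : ℝ)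
    (hU : ∀ I, XS T 0 ex (m + 1) p A (U I)) :
    ∃ r, 0 < r ∧ ∀ D : ι → ℝ → Spc n → ℝ, (∀ I, XS T 0 ex (m + 1) p r (D I)) →
      ∃ V : ι → ℝ → Spc n → ℝ, (∀ I, ∃ C, XS T 0 ex (m + 1) p C (V I)) ∧
        ∀ I, ∀ t ∈ Set.Icc 0 T, ∀ x, V I t x = D I t x - heatV μ T (quad c U V I) t x := by
  obtain ⟨β, hβ1, hβ⟩ := heatV_quad_contract hex hT hμ hp hm c A 2 hU
  have hβ0 : 0 ≤ β := by linarith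
  set ρ := Real.exp (-(β * T)) with hρ
  have hρ0 : 0 < ρ := Real.exp_pos _
  have hρe : ρ * Real.exp (β * T) = 1 := by
    rw [hρ, ← Real.exp_add]
    simp
  refine ⟨ρ / 2, by positivity, fun D hD => ?_⟩
  set Φ : (ι → ℝ → Spc n → ℝ) → (ι → ℝ → Spc n → ℝ) :=
    fun V I t x => D I t x - heatV μ T (quad c U V I) t x with hΦ
  have hcon : ∀ (C : ℝ) (V W : ι → ℝ → Spc n → ℝ),
      (∀ I, XS T 0 ex (m + 1) p 2 (V I)) → (∀ I, XS T 0 ex (m + 1) p 2 (W I)) →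
      (∀ I, XS T β ex (m + 1) p C (fun t x => V I t x - W I t x)) → ∀ k,
      XS T β ex (m + 1) p (C / 2) (fun t x => Φ V k t x - Φ W k t x) := by
    intro C V W hV hW hVW k
    refine (hβ C V W hV hW hVW k).neg.congr fun t ht x => ?_
    simp only [hΦ]
    ring
  have hto0 : ∀ {C} {v : ℝ → Spc n → ℝ}, C ≤ 2 * ρ → XS T β ex (m + 1) p C v →
      XS T 0 ex (m + 1) p 2 v := by
    intro C v hC hv
    refine (hv.rate_zero hβ0 hT).mono ?_
    have := mul_le_mul_of_nonneg_right hC (Real.exp_pos (β * T)).le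
    rw [mul_assoc, hρe] at this
    linarith
  let v : ℕ → ι → ℝ → Spc n → ℝ := fun k => Φ^[k] (fun _ _ _ => 0)
  have hvs : ∀ k, v (k + 1) = Φ (v k) := fun k => Function.iterate_succ_apply' _ _ _
  have hz : ∀ I : ι, XS T 0 ex (m + 1) p 2 (fun _ _ => 0 : ℝ → Spc n → ℝ) :=
    fun I => XS.zero.mono (by norm_num)
  have hΦ0 : ∀ I t x, Φ (fun _ _ _ => 0) I t x = D I t x := by
    intro I t x
    have : quad c U (fun _ _ _ => 0) I = fun _ _ => 0 := by
      funext t x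
      exact quad_zero c I t x
    simp only [hΦ, this, heatV_zero_fun, sub_zero]
  have hvb : ∀ k I, XS T β ex (m + 1) p ρ (v k I) := by
    intro k
    induction k with
    | zero => exact fun I => XS.zero.mono hρ0.le
    | succ k ih =>
      intro I
      have h1 := hcon ρ (v k) (fun _ _ _ => 0) (fun I => hto0 (by linarith) (ih I)) hz
        (fun I => (ih I).congr fun t _ x => by simp) I
      have h2 := h1.add ((hD I).rate_mono hβ0 hT)
      rw [hvs]
      refine (h2.congr fun t _ x => ?_).mono (by linarith)
      rw [hΦ0]
      ring
  have hv2 : ∀ k I, XS T 0 ex (m + 1) p 2 (v k I) := fun k I => hto0 (by linarith) (hvb k I)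
  have hdiff : ∀ k l, k ≤ l → ∀ I,
      XS T β ex (m + 1) p (2 * ρ * (1 / 2) ^ k) (fun t x => v l I t x - v k I t x) := by
    intro k
    induction k with
    | zero => exact fun l _ I => ((hvb l I).sub (hvb 0 I)).mono (by linarith)
    | succ k ih =>
      intro l hl I
      obtain ⟨l, rfl⟩ : ∃ l', l = l' + 1 := ⟨l - 1, by omega⟩
      have h1 := hcon _ (v l) (v k) (hv2 l) (hv2 k) (ih l (by omega)) I
      rw [hvs, hvs]
      refine h1.mono (le_of_eq ?_)
      ring
  have ha : Tendsto (fun k : ℕ => 2 * ρ * (1 / 2 : ℝ) ^ k) atTop (nhds 0) := by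
    simpa using (tendsto_pow_atTop_nhds_zero_of_lt_one (by norm_num : (0 : ℝ) ≤ 1 / 2)
      (by norm_num)).const_mul (2 * ρ)
  set V : ι → ℝ → Spc n → ℝ := fun I t x => limUnder atTop fun k => v k I t x with hVdef
  have hlim : ∀ I k, XS T β ex (m + 1) p (2 * ρ * (1 / 2) ^ k)
      (fun t x => V I t x - v k I t x) := fun I =>
    XS.lim hp ha (fun k l hkl => hdiff k l hkl I) fun k => ⟨_, hvb k I⟩
  have hV2 : ∀ I, XS T 0 ex (m + 1) p 2 (V I) := fun I =>
    hto0 (C := 2 * ρ) le_rfl (((hlim I 0).congr fun t _ x => by simp [v]).mono (by simp))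
  refine ⟨V, fun I => ⟨2, hV2 I⟩, fun I t ht x => ?_⟩
  have htend : ∀ {a b : ℕ → ℝ} {y : ℝ}, Tendsto a atTop (nhds 0) →
      (∀ k, |y - b k| ≤ a k * Real.exp (β * t) * wt x ^ (-p)) → Tendsto b atTop (nhds y) := by
    intro a b y ha hb
    rw [tendsto_iff_dist_tendsto_zero]
    have h0 : Tendsto (fun k => a k * Real.exp (β * t) * wt x ^ (-p)) atTop (nhds 0) := by
      simpa using (ha.mul_const (Real.exp (β * t))).mul_const (wt x ^ (-p))
    refine squeeze_zero (fun _ => dist_nonneg) (fun k => ?_) h0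
    rw [dist_comm, Real.dist_eq]
    exact hb k
  have t1 : Tendsto (fun k => v k I t x) atTop (nhds (V I t x)) :=
    htend ha fun k => (hlim I k).hb.bd t ht x
  have t2 : Tendsto (fun k => v (k + 1) I t x) atTop (nhds (Φ V I t x)) := by
    refine htend (a := fun k => 2 * ρ * (1 / 2) ^ k / 2) (by simpa using ha.div_const 2)
      fun k => ?_
    rw [hvs]
    exact (hcon _ V (v k) hV2 (hv2 k) (fun I => hlim I k) I).hb.bd t ht x
  exact tendsto_nhds_unique ((tendsto_add_atTop_iff_nat 1).2 t1) t2

lemma quad_unique (hex : GoodEx ex κ) (hT : 0 ≤ T) (hμ : 0 < μ) (hp : 0 ≤ p)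
    (hm : ex (m + 1) = ex m) (c : ι → Fin n → ι → ι → ℝ) {A B : ℝ}
    (hU : ∀ I, XS T 0 ex (m + 1) p A (U I)) (hW : ∀ I, XS T 0 ex (m + 1) p B (W I))
    (h : ∀ I, ∀ t ∈ Set.Icc 0 T, ∀ x, W I t x = -heatV μ T (quad c U W I) t x) :
    ∀ I, ∀ t ∈ Set.Icc 0 T, ∀ x, W I t x = 0 := by
  obtain ⟨β, hβ1, hβ⟩ := heatV_quad_contract hex hT hμ hp hm c A B hU
  have hβ0 : 0 ≤ β := by linarith
  have hz : ∀ I : ι, XS T 0 ex (m + 1) p B (fun _ _ => 0 : ℝ → Spc n → ℝ) :=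
    fun I => XS.zero.mono ((hW I).const_nonneg hT)
  have hk : ∀ k : ℕ, ∀ I, XS T β ex (m + 1) p (B * (1 / 2) ^ k) (W I) := by
    intro k
    induction k with
    | zero => exact fun I => ((hW I).rate_mono hβ0 hT).mono (by simp)
    | succ k ih =>
      intro I
      have h1 := hβ _ W (fun _ _ _ => 0) hW hz
        (fun I => (ih I).congr fun t _ x => by simp) I
      refine (h1.neg.congr fun t ht x => ?_).mono (le_of_eq (by ring))
      have h2 : quad c U (fun _ _ _ => 0) I = fun _ _ => 0 := by
        funext t x
        exact quad_zero c I t x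
      rw [h2, heatV_zero_fun, sub_zero]
      exact h I t ht x
  intro I t ht x
  have h0 : Tendsto (fun k : ℕ => B * (1 / 2 : ℝ) ^ k * Real.exp (β * t) * wt x ^ (-p)) atTop
      (nhds 0) := by
    simpa using (((tendsto_pow_atTop_nhds_zero_of_lt_one (by norm_num : (0 : ℝ) ≤ 1 / 2)
      (by norm_num)).const_mul B).mul_const (Real.exp (β * t))).mul_const (wt x ^ (-p))
  exact norm_le_zero_iff.1 (ge_of_tendsto' h0 fun k => (hk k I).hb.bd t ht x)

end picard

/-! ### Weighted Hölder norms and pointwise bounds -/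

section hoelder

variable {F : Type*} [NormedAddCommGroup F] {lam δ N C T : ℝ} {g : Spc n → F}

lemma wtm_mul_rpow_neg_add {a : ℝ} (ha : 0 < a) (p e : ℝ) :
    a ^ (-p) = a ^ (-(p + e)) * a ^ e := by
  rw [← Real.rpow_add ha]
  congr 1
  ring

lemma norm_le_of_eWSup (h : eWSup δ g ≤ ENNReal.ofReal N) (hN : 0 ≤ N) (x : Spc n) :
    ‖g x‖ ≤ N * wt x ^ (-δ) := by
  have h1 := (le_iSup (fun x : Spc n => ENNReal.ofReal (wt x ^ δ * ‖g x‖)) x).trans h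
  rw [ENNReal.ofReal_le_ofReal_iff hN] at h1
  have hw := Real.rpow_pos_of_pos (wt_pos x) δ
  rw [Real.rpow_neg (wt_pos x).le, ← div_eq_mul_inv, le_div_iff₀ hw]
  linarith

lemma norm_sub_le_of_eWHold (h : eWHold lam δ g ≤ ENNReal.ofReal N) (hN : 0 ≤ N)
    (hd : 0 ≤ δ + lam) {x y : Spc n} (hxy : ‖x - y‖ ≤ ‖x‖ / 2) :
    ‖g x - g y‖ ≤ N * ‖x - y‖ ^ lam * wtm x y ^ (-(δ + lam)) := by
  rcases eq_or_ne x y with rfl | hne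
  · rw [sub_self, norm_zero]
    have := wtm_pos x x
    positivity
  have h1 := (le_iSup_of_le x (le_iSup_of_le y (le_iSup_of_le ⟨hne, hxy⟩ le_rfl))).trans h
  rw [ENNReal.ofReal_le_ofReal_iff hN] at h1
  have hr : 0 < ‖x - y‖ ^ lam := Real.rpow_pos_of_pos (norm_pos_iff.2 (sub_ne_zero.2 hne)) _
  rw [div_le_iff₀ hr] at h1
  have hw : 0 < wtm x y ^ (δ + lam) := Real.rpow_pos_of_pos (wtm_pos x y) _
  have h2 : wtm x y ^ (δ + lam) ≤ wt2 x y ^ (δ + lam) :=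
    Real.rpow_le_rpow (wtm_pos x y).le (min_le_max) hd
  rw [Real.rpow_neg (wtm_pos x y).le, ← div_eq_mul_inv, le_div_iff₀ hw]
  refine le_trans ?_ h1
  rw [mul_comm]
  gcongr

lemma norm_sub_le_of_eOHold (h : eOHold lam g ≤ ENNReal.ofReal N) (hN : 0 ≤ N) {x y : Spc n}
    (hx : ‖x‖ ≤ 1) (hy : ‖y‖ ≤ 1) : ‖g x - g y‖ ≤ N * ‖x - y‖ ^ lam := by
  rcases eq_or_ne x y with rfl | hne
  · rw [sub_self, norm_zero]
    positivity
  have h1 := ((le_iSup_of_le x (le_iSup_of_le y (le_iSup_of_le ⟨hx, hy, hne⟩ le_rfl))).trans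
    le_add_self).trans h
  rw [ENNReal.ofReal_le_ofReal_iff hN] at h1
  have hr : 0 < ‖x - y‖ ^ lam := Real.rpow_pos_of_pos (norm_pos_iff.2 (sub_ne_zero.2 hne)) _
  rwa [div_le_iff₀ hr] at h1

lemma wt_le_one_add (x : Spc n) : wt x ≤ 1 + ‖x‖ := by
  have h := wt_le_add x 0
  simpa [wt] using h

lemma norm_sub_le_of_far {e : ℝ} (he : 0 ≤ e) (he1 : e ≤ 1) (hδ : 0 ≤ δ) (hN : 0 ≤ N)
    (hb : ∀ x, ‖g x‖ ≤ N * wt x ^ (-δ)) {x y : Spc n} (hxy : wtm x y ≤ 4 * ‖x - y‖) :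
    ‖g x - g y‖ ≤ 8 * N * ‖x - y‖ ^ e * wtm x y ^ (-(δ + e)) := by
  have hw := wtm_pos x y
  have hx := wt_rpow_neg_le_wtm_left x y hδ
  have hy := wt_rpow_neg_le_wtm_right x y hδ
  have h1 : wtm x y ^ e ≤ 4 * ‖x - y‖ ^ e := by
    calc wtm x y ^ e ≤ (4 * ‖x - y‖) ^ e := Real.rpow_le_rpow hw.le hxy he
      _ = 4 ^ e * ‖x - y‖ ^ e := Real.mul_rpow (by norm_num) (norm_nonneg _)
      _ ≤ 4 ^ (1 : ℝ) * ‖x - y‖ ^ e := by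
        gcongr
        norm_num
      _ = _ := by rw [Real.rpow_one]
  have hp : 0 ≤ wtm x y ^ (-(δ + e)) := by positivity
  calc ‖g x - g y‖ ≤ ‖g x‖ + ‖g y‖ := norm_sub_le _ _
    _ ≤ N * wt x ^ (-δ) + N * wt y ^ (-δ) := add_le_add (hb x) (hb y)
    _ ≤ N * wtm x y ^ (-δ) + N * wtm x y ^ (-δ) := by gcongr
    _ = 2 * N * (wtm x y ^ (-(δ + e)) * wtm x y ^ e) := by
      rw [wtm_mul_rpow_neg_add hw δ e]
      ring
    _ ≤ 2 * N * (wtm x y ^ (-(δ + e)) * (4 * ‖x - y‖ ^ e)) := by gcongr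
    _ = _ := by ring

lemma norm_sub_le_of_eHol0 (hlam : 0 < lam) (hlam1 : lam ≤ 1) (hδ : 0 ≤ δ) (hN : 0 ≤ N)
    (h : eHol0 lam δ g ≤ ENNReal.ofReal N) (x y : Spc n) :
    ‖g x - g y‖ ≤ (8 + 2 ^ (δ + lam)) * N * ‖x - y‖ ^ lam * wtm x y ^ (-(δ + lam)) := by
  rw [eHol0, if_neg hlam.ne'] at h
  have hO : eOHold lam g ≤ ENNReal.ofReal N := (le_self_add.trans le_self_add).trans h
  have hS : eWSup δ g ≤ ENNReal.ofReal N := (le_add_self.trans le_self_add).trans h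
  have hH : eWHold lam δ g ≤ ENNReal.ofReal N := le_add_self.trans h
  have hb := norm_le_of_eWSup hS hN
  have hw := wtm_pos x y
  set B := ‖x - y‖ ^ lam * wtm x y ^ (-(δ + lam)) with hB
  have hB0 : 0 ≤ B := by positivity
  have h2 : (0 : ℝ) ≤ 2 ^ (δ + lam) := by positivity
  have goal : ∀ K, K ≤ 8 + 2 ^ (δ + lam) → ‖g x - g y‖ ≤ K * N * B →
      ‖g x - g y‖ ≤ (8 + 2 ^ (δ + lam)) * N * ‖x - y‖ ^ lam * wtm x y ^ (-(δ + lam)) := by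
    intro K hK h3
    rw [mul_assoc _ (‖x - y‖ ^ lam), ← hB]
    refine h3.trans ?_
    gcongr
  by_cases h3 : ‖x - y‖ ≤ ‖x‖ / 2
  · refine goal 1 (by linarith) ?_
    rw [one_mul, hB, ← mul_assoc]
    exact norm_sub_le_of_eWHold hH hN (by linarith) h3
  by_cases h4 : ‖y - x‖ ≤ ‖y‖ / 2
  · refine goal 1 (by linarith) ?_
    rw [one_mul, hB, ← mul_assoc, norm_sub_rev, norm_sub_rev x, wtm_comm]
    exact norm_sub_le_of_eWHold hH hN (by linarith) h4
  rw [norm_sub_rev] at h4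
  push Not at h3 h4
  by_cases h5 : ‖x‖ ≤ 1 ∧ ‖y‖ ≤ 1
  · refine goal (2 ^ (δ + lam)) (by linarith) ?_
    have h6 := norm_sub_le_of_eOHold hO hN h5.1 h5.2
    have h7 : wtm x y ≤ 2 := (min_le_left _ _).trans ((wt_le_one_add x).trans (by linarith [h5.1]))
    have h8 : wtm x y ^ (δ + lam) ≤ 2 ^ (δ + lam) := Real.rpow_le_rpow hw.le h7 (by linarith)
    have h9 : 1 ≤ 2 ^ (δ + lam) * wtm x y ^ (-(δ + lam)) := by
      rw [Real.rpow_neg hw.le, ← div_eq_mul_inv, one_le_div (Real.rpow_pos_of_pos hw _)]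
      exact h8
    calc _ ≤ N * ‖x - y‖ ^ lam := h6
      _ ≤ N * ‖x - y‖ ^ lam * (2 ^ (δ + lam) * wtm x y ^ (-(δ + lam))) :=
        le_mul_of_one_le_right (by positivity) h9
      _ = _ := by rw [hB]; ring
  · refine goal 8 (by linarith) ?_
    rw [hB, ← mul_assoc]
    refine norm_sub_le_of_far hlam.le hlam1 hδ hN hb ?_
    rw [not_and_or, not_le, not_le] at h5
    rcases h5 with h5 | h5
    · exact (min_le_left _ _).trans ((wt_le_one_add x).trans (by linarith))
    · exact (min_le_right _ _).trans ((wt_le_one_add y).trans (by linarith))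

lemma eHol0_le (hlam : 0 < lam) (hδ : 0 ≤ δ) (hb : ∀ x, ‖g x‖ ≤ C * wt x ^ (-δ))
    (hs : ∀ x y, ‖g x - g y‖ ≤ C * ‖x - y‖ ^ lam * wtm x y ^ (-(δ + lam))) :
    eHol0 lam δ g ≤ ENNReal.ofReal C + ENNReal.ofReal C + ENNReal.ofReal C +
      ENNReal.ofReal (C * 2 ^ (δ + lam)) := by
  have hC : 0 ≤ C := by
    have h1 := (norm_nonneg _).trans (hb 0)
    exact nonneg_of_mul_nonneg_left h1 (Real.rpow_pos_of_pos (wt_pos _) _)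
  rw [eHol0, if_neg hlam.ne']
  unfold eOHold eWSup eWHold
  refine add_le_add (add_le_add (add_le_add ?_ ?_) ?_) ?_
  · refine iSup₂_le fun x _ => ENNReal.ofReal_le_ofReal ((hb x).trans ?_)
    exact mul_le_of_le_one_right hC (Real.rpow_le_one_of_one_le_of_nonpos (one_le_wt x)
      (by linarith))
  · refine iSup₂_le fun x y => iSup_le fun hxy => ENNReal.ofReal_le_ofReal ?_
    have hr : 0 < ‖x - y‖ ^ lam :=
      Real.rpow_pos_of_pos (norm_pos_iff.2 (sub_ne_zero.2 hxy.2.2)) _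
    rw [div_le_iff₀ hr]
    refine (hs x y).trans (mul_le_of_le_one_right (by positivity) ?_)
    exact Real.rpow_le_one_of_one_le_of_nonpos (one_le_wtm x y) (by linarith)
  · refine iSup_le fun x => ENNReal.ofReal_le_ofReal ?_
    have hw := Real.rpow_pos_of_pos (wt_pos x) δ
    have := hb x
    rw [Real.rpow_neg (wt_pos x).le, ← div_eq_mul_inv, le_div_iff₀ hw] at this
    linarith
  · refine iSup₂_le fun x y => iSup_le fun hxy => ENNReal.ofReal_le_ofReal ?_
    have hr : 0 < ‖x - y‖ ^ lam :=
      Real.rpow_pos_of_pos (norm_pos_iff.2 (sub_ne_zero.2 hxy.1)) _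
    have hw := wtm_pos x y
    have h2 : wt2 x y ≤ 2 * wtm x y := by
      have a1 := wt_le_add x y
      have a2 := wt_le_add y x
      rw [norm_sub_rev] at a2
      have a3 := norm_le_wt x
      have a4 := norm_le_wt y
      have a5 : ‖x‖ ≤ ‖y‖ + ‖x - y‖ := by
        have := norm_add_le y (x - y)
        simpa using this
      have a6 := hxy.2
      unfold wt2 wtm
      rw [mul_min_of_nonneg _ _ (by norm_num)]
      refine max_le (le_min ?_ ?_) (le_min ?_ ?_) <;> linarith [wt_pos x, wt_pos y]
    rw [div_le_iff₀ hr]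
    have h3 : wt2 x y ^ (δ + lam) ≤ 2 ^ (δ + lam) * wtm x y ^ (δ + lam) := by
      rw [← Real.mul_rpow (by norm_num) hw.le]
      exact Real.rpow_le_rpow ((wt_pos x).le.trans (le_max_left _ _)) h2 (by linarith)
    have h4 : wtm x y ^ (δ + lam) * wtm x y ^ (-(δ + lam)) = 1 := by
      rw [← Real.rpow_add hw]
      simp
    calc wt2 x y ^ (δ + lam) * ‖g x - g y‖ ≤ (2 ^ (δ + lam) * wtm x y ^ (δ + lam)) *
          (C * ‖x - y‖ ^ lam * wtm x y ^ (-(δ + lam))) :=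
          mul_le_mul h3 (hs x y) (norm_nonneg _) (by positivity)
      _ = C * 2 ^ (δ + lam) * ‖x - y‖ ^ lam * (wtm x y ^ (δ + lam) * wtm x y ^ (-(δ + lam))) := by
          ring
      _ = _ := by rw [h4, mul_one]

lemma HB.of_eAniso0 (hlam : 0 < lam) (hlam1 : lam ≤ 1) (hδ : 0 ≤ δ) (hN : 0 ≤ N)
    {v : ℝ → Spc n → F} (h : eAniso0 T lam δ v ≤ ENNReal.ofReal N) :
    HB T 0 lam δ ((8 + 2 ^ (δ + lam)) * N) v := by
  rw [eAniso0, if_neg hlam.ne'] at h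
  have h0 : ∀ t ∈ Set.Icc 0 T, eHol0 lam δ (v t) ≤ ENNReal.ofReal N := fun t ht =>
    ((le_iSup (fun t : Set.Icc (0 : ℝ) T => eHol0 lam δ (v t)) ⟨t, ht⟩).trans le_self_add).trans h
  have h2 : (0 : ℝ) ≤ 2 ^ (δ + lam) := by positivity
  have hN8 : N ≤ (8 + 2 ^ (δ + lam)) * N := by nlinarith
  refine ⟨fun t ht x => ?_, fun t ht x y => ?_, fun s t hs hst ht x => ?_⟩
  · have h1 := h0 t ht
    rw [eHol0, if_neg hlam.ne'] at h1
    refine (norm_le_of_eWSup ((le_add_self.trans le_self_add).trans h1) hN x).trans ?_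
    have := wt_pos x
    simp only [zero_mul, Real.exp_zero, mul_one]
    gcongr
  · simp only [zero_mul, Real.exp_zero, mul_one]
    exact norm_sub_le_of_eHol0 hlam hlam1 hδ hN (h0 t ht) x y
  · simp only [zero_mul, Real.exp_zero, mul_one]
    have hw := wt_pos x
    rcases hst.eq_or_lt with rfl | hlt
    · rw [sub_self, norm_zero]
      positivity
    have h1 := ((le_iSup_of_le (⟨t, hs.trans hst, ht⟩ : Set.Icc (0 : ℝ) T)
      (le_iSup_of_le (⟨s, hs, hst.trans ht⟩ : Set.Icc (0 : ℝ) T)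
      (le_iSup_of_le hlt.ne' (le_iSup_of_le x le_rfl)))).trans le_add_self).trans h
    rw [ENNReal.ofReal_le_ofReal_iff hN, abs_of_pos (sub_pos.2 hlt),
      div_le_iff₀ (Real.rpow_pos_of_pos (sub_pos.2 hlt) _)] at h1
    rw [Real.rpow_neg hw.le, ← div_eq_mul_inv, le_div_iff₀ (Real.rpow_pos_of_pos hw _)]
    calc _ = wt x ^ δ * ‖v t x - v s x‖ := mul_comm _ _
      _ ≤ N * (t - s) ^ (lam / 2) := h1
      _ ≤ _ := by
        have := (Real.rpow_pos_of_pos (sub_pos.2 hlt) (lam / 2)).le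
        gcongr

lemma HB.eAniso0_ne_top (hlam : 0 < lam) (hδ : 0 ≤ δ) {v : ℝ → Spc n → F}
    (h : HB T 0 lam δ C v) : eAniso0 T lam δ v ≠ ⊤ := by
  rw [eAniso0, if_neg hlam.ne']
  refine (ENNReal.add_lt_top.2 ⟨?_, ?_⟩).ne
  · refine lt_of_le_of_lt (iSup_le fun t => eHol0_le hlam hδ (C := C) ?_ ?_) (by finiteness)
    · intro x
      simpa using h.bd t t.2 x
    · intro x y
      simpa using h.sp t t.2 x y
  · refine lt_of_le_of_lt (b := ENNReal.ofReal C) ?_ (by finiteness)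
    have key : ∀ s t, 0 ≤ s → s < t → t ≤ T → ∀ x,
        wt x ^ δ * ‖v t x - v s x‖ / (t - s) ^ (lam / 2) ≤ C := by
      intro s t hs hst ht x
      have h1 := h.tm s t hs hst.le ht x
      have hw := wt_pos x
      simp only [zero_mul, Real.exp_zero, mul_one] at h1
      rw [Real.rpow_neg hw.le, ← div_eq_mul_inv, le_div_iff₀ (Real.rpow_pos_of_pos hw _)] at h1
      rw [div_le_iff₀ (Real.rpow_pos_of_pos (sub_pos.2 hst) _)]
      linarith
    refine iSup₂_le fun t s => iSup₂_le fun hts x => ENNReal.ofReal_le_ofReal ?_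
    rcases hts.lt_or_gt with hlt | hlt
    · rw [norm_sub_rev, abs_sub_comm, abs_of_pos (sub_pos.2 hlt)]
      exact key t s t.2.1 hlt s.2.2 x
    · rw [abs_of_pos (sub_pos.2 hlt)]
      exact key s t s.2.1 hlt t.2.2 x

/-- A bound on the gradient yields Hölder bounds of any exponent. -/
lemma norm_sub_le_of_fderiv [NormedSpace ℝ F] {e : ℝ} (he : 0 ≤ e) (he1 : e ≤ 1) (hδ : 0 ≤ δ)
    (hN : 0 ≤ N) (hg : Differentiable ℝ g) (hb : ∀ x, ‖g x‖ ≤ N * wt x ^ (-δ))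
    (hd : ∀ x, ‖fderiv ℝ g x‖ ≤ N * wt x ^ (-(δ + 1))) (x y : Spc n) :
    ‖g x - g y‖ ≤ (8 + 2 ^ (δ + 1)) * N * ‖x - y‖ ^ e * wtm x y ^ (-(δ + e)) := by
  have hw := wtm_pos x y
  have h2 : (0 : ℝ) ≤ 2 ^ (δ + 1) := by positivity
  have hp : 0 ≤ ‖x - y‖ ^ e * wtm x y ^ (-(δ + e)) := by positivity
  by_cases hxy : wtm x y ≤ 2 * ‖x - y‖
  · refine (norm_sub_le_of_far he he1 hδ hN hb (by linarith [norm_nonneg (x - y)])).trans ?_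
    gcongr
    linarith
  push Not at hxy
  have h3 : ∀ z ∈ segment ℝ x y, ‖fderiv ℝ g z‖ ≤ N * (2 ^ (δ + 1) * wtm x y ^ (-(δ + 1))) := by
    intro z hz
    refine (hd z).trans ?_
    gcongr
    refine rpow_neg_le_of_le_mul hw (wt_pos z) (by norm_num) ?_ (by linarith) le_rfl
    have h4 := wt_le_add x z
    have h5 : ‖x - z‖ ≤ ‖x - y‖ := by
      have := norm_sub_le_of_mem_segment hz
      rwa [norm_sub_rev z x, norm_sub_rev y x] at this
    have h6 : wtm x y ≤ wt x := min_le_left _ _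
    linarith
  have h4 := (convex_segment x y).norm_image_sub_le_of_norm_fderiv_le (𝕜 := ℝ)
    (fun z _ => hg z) h3 (right_mem_segment ℝ x y) (left_mem_segment ℝ x y)
  have h5 : ‖x - y‖ * wtm x y ^ (-(δ + 1)) ≤ ‖x - y‖ ^ e * wtm x y ^ (-(δ + e)) := by
    have h6 : ‖x - y‖ = ‖x - y‖ ^ e * ‖x - y‖ ^ (1 - e) := by
      rw [← Real.rpow_add_of_nonneg (norm_nonneg _) he (by linarith)]
      simp
    have h7 : ‖x - y‖ ^ (1 - e) ≤ wtm x y ^ (1 - e) :=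
      Real.rpow_le_rpow (norm_nonneg _) (by linarith [norm_nonneg (x - y)]) (by linarith)
    have h8 : wtm x y ^ (-(δ + e)) = wtm x y ^ (1 - e) * wtm x y ^ (-(δ + 1)) := by
      rw [← Real.rpow_add hw]
      congr 1
      ring
    have h9 : 0 ≤ wtm x y ^ (-(δ + 1)) := by positivity
    rw [h8, ← mul_assoc]
    conv_lhs => rw [h6]
    gcongr
  calc ‖g x - g y‖ ≤ N * (2 ^ (δ + 1) * wtm x y ^ (-(δ + 1))) * ‖x - y‖ := h4
    _ = 2 ^ (δ + 1) * N * (‖x - y‖ * wtm x y ^ (-(δ + 1))) := by ring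
    _ ≤ (8 + 2 ^ (δ + 1)) * N * (‖x - y‖ ^ e * wtm x y ^ (-(δ + e))) := by
      gcongr
      linarith
    _ = _ := by ring

end hoelder

/-! ### Iterated Fréchet derivatives versus iterated partial derivatives -/

section iterated

variable {m : ℕ} {f g : Spc n → ℝ}

lemma norm_iteratedFDeriv_succ_sub (x y : Spc n) :
    ‖iteratedFDeriv ℝ (m + 1) f x - iteratedFDeriv ℝ (m + 1) g y‖ =
      ‖iteratedFDeriv ℝ m (fderiv ℝ f) x - iteratedFDeriv ℝ m (fderiv ℝ g) y‖ := by
  rw [iteratedFDeriv_succ_eq_comp_right, iteratedFDeriv_succ_eq_comp_right,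
    Function.comp_apply, Function.comp_apply]
  rw [← dist_eq_norm, ← dist_eq_norm]
  exact (continuousMultilinearCurryRightEquiv' ℝ m (Spc n) ℝ).symm.dist_map _ _

/-- Evaluation of a covector at a basis vector. -/
def evalBasis (i : Fin n) : (Spc n →L[ℝ] ℝ) →L[ℝ] ℝ :=
  ContinuousLinearMap.apply ℝ ℝ (EuclideanSpace.single i 1 : Spc n)

lemma norm_evalBasis_le (i : Fin n) : ‖evalBasis i‖ ≤ 1 :=
  ContinuousLinearMap.opNorm_le_bound _ zero_le_one fun L => by
    refine (L.le_opNorm _).trans ?_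
    simp

lemma contDiff_pd (hf : ContDiff ℝ (m + 1 : ℕ) f) (i : Fin n) : ContDiff ℝ m (pd i f) :=
  (evalBasis i).contDiff.comp (hf.fderiv_right (m := m) (by norm_cast))

lemma iteratedFDeriv_pd (hf : ContDiff ℝ (m + 1 : ℕ) f) (i : Fin n) (x : Spc n) :
    iteratedFDeriv ℝ m (pd i f) x =
      (evalBasis i).compContinuousMultilinearMap (iteratedFDeriv ℝ m (fderiv ℝ f) x) :=
  (evalBasis i).iteratedFDeriv_comp_left
    (hf.fderiv_right (m := m) (by norm_cast)).contDiffAt le_rfl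

lemma norm_iteratedFDeriv_pd_sub_le (hf : ContDiff ℝ (m + 1 : ℕ) f)
    (hg : ContDiff ℝ (m + 1 : ℕ) g) (i : Fin n) (x y : Spc n) :
    ‖iteratedFDeriv ℝ m (pd i f) x - iteratedFDeriv ℝ m (pd i g) y‖ ≤
      ‖iteratedFDeriv ℝ (m + 1) f x - iteratedFDeriv ℝ (m + 1) g y‖ := by
  rw [norm_iteratedFDeriv_succ_sub, iteratedFDeriv_pd hf, iteratedFDeriv_pd hg]
  have : (evalBasis i).compContinuousMultilinearMap (iteratedFDeriv ℝ m (fderiv ℝ f) x) -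
      (evalBasis i).compContinuousMultilinearMap (iteratedFDeriv ℝ m (fderiv ℝ g) y) =
      (evalBasis i).compContinuousMultilinearMap
        (iteratedFDeriv ℝ m (fderiv ℝ f) x - iteratedFDeriv ℝ m (fderiv ℝ g) y) := by
    ext w; simp
  rw [this]
  exact ((evalBasis i).norm_compContinuousMultilinearMap_le _).trans
    (mul_le_of_le_one_left (norm_nonneg _) (norm_evalBasis_le i))

/-- Multiples of a coordinate covector. -/
def coordCovector (i : Fin n) : ℝ →L[ℝ] (Spc n →L[ℝ] ℝ) :=
  ContinuousLinearMap.toSpanSingleton ℝ (EuclideanSpace.proj i : Spc n →L[ℝ] ℝ)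

lemma norm_coordCovector_le (i : Fin n) : ‖coordCovector i‖ ≤ 1 :=
  ContinuousLinearMap.opNorm_le_bound _ zero_le_one fun c => by
    simp only [coordCovector, ContinuousLinearMap.toSpanSingleton_apply, norm_smul, one_mul]
    exact mul_le_of_le_one_right (norm_nonneg _) (norm_proj_le i)

lemma fderiv_eq_sum_coordCovector (f : Spc n → ℝ) :
    fderiv ℝ f = fun x => ∑ i, (coordCovector i ∘ pd i f) x := by
  funext x
  rw [fderiv_eq_sum_pd]
  rfl

lemma contDiff_succ_of_pd (hf : Differentiable ℝ f) (h : ∀ i, ContDiff ℝ m (pd i f)) :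
    ContDiff ℝ (m + 1 : ℕ) f := by
  have : ((m + 1 : ℕ) : WithTop ℕ∞) = (m : WithTop ℕ∞) + 1 := by norm_cast
  rw [this, contDiff_succ_iff_fderiv]
  refine ⟨hf, by simp, ?_⟩
  rw [fderiv_eq_sum_coordCovector]
  exact ContDiff.sum fun i _ => (coordCovector i).contDiff.comp (h i)

lemma norm_iteratedFDeriv_succ_sub_le (hf : ∀ i, ContDiff ℝ m (pd i f))
    (hg : ∀ i, ContDiff ℝ m (pd i g)) (x y : Spc n) :
    ‖iteratedFDeriv ℝ (m + 1) f x - iteratedFDeriv ℝ (m + 1) g y‖ ≤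
      ∑ i, ‖iteratedFDeriv ℝ m (pd i f) x - iteratedFDeriv ℝ m (pd i g) y‖ := by
  have key : ∀ {f : Spc n → ℝ}, (∀ i, ContDiff ℝ m (pd i f)) → ∀ x,
      iteratedFDeriv ℝ m (fderiv ℝ f) x = ∑ i,
        (coordCovector i).compContinuousMultilinearMap (iteratedFDeriv ℝ m (pd i f) x) := by
    intro f hf x
    rw [fderiv_eq_sum_coordCovector, iteratedFDeriv_fun_sum_apply fun i _ =>
      ((coordCovector i).contDiff.comp (hf i)).contDiffAt]
    exact Finset.sum_congr rfl fun i _ =>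
      (coordCovector i).iteratedFDeriv_comp_left (hf i).contDiffAt le_rfl
  rw [norm_iteratedFDeriv_succ_sub, key hf, key hg, ← Finset.sum_sub_distrib]
  refine (norm_sum_le _ _).trans (Finset.sum_le_sum fun i _ => ?_)
  have : (coordCovector i).compContinuousMultilinearMap (iteratedFDeriv ℝ m (pd i f) x) -
      (coordCovector i).compContinuousMultilinearMap (iteratedFDeriv ℝ m (pd i g) y) =
      (coordCovector i).compContinuousMultilinearMap
        (iteratedFDeriv ℝ m (pd i f) x - iteratedFDeriv ℝ m (pd i g) y) := by
    ext w; simp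
  rw [this]
  exact ((coordCovector i).norm_compContinuousMultilinearMap_le _).trans
    (mul_le_of_le_one_left (norm_nonneg _) (norm_coordCovector_le i))

lemma norm_iteratedFDeriv_pd_le (hf : ContDiff ℝ (m + 1 : ℕ) f) (i : Fin n) (x : Spc n) :
    ‖iteratedFDeriv ℝ m (pd i f) x‖ ≤ ‖iteratedFDeriv ℝ (m + 1) f x‖ := by
  rw [iteratedFDeriv_pd hf, ← norm_iteratedFDeriv_fderiv]
  exact ((evalBasis i).norm_compContinuousMultilinearMap_le _).trans
    (mul_le_of_le_one_left (norm_nonneg _) (norm_evalBasis_le i))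

lemma norm_iteratedFDeriv_succ_le (hf : ∀ i, ContDiff ℝ m (pd i f)) (x : Spc n) :
    ‖iteratedFDeriv ℝ (m + 1) f x‖ ≤ ∑ i, ‖iteratedFDeriv ℝ m (pd i f) x‖ := by
  have hz : ∀ i : Fin n, pd i (fun _ => (0 : ℝ)) = fun _ => 0 := fun i => funext (pd_zero i)
  have h := norm_iteratedFDeriv_succ_sub_le (m := m) (g := fun _ => 0) hf
    (fun i => by rw [hz]; exact contDiff_const) x x
  simpa [hz, iteratedFDeriv_fun_zero] using h

end iterated

lemma HB.of_sum_le {ι F G : Type*} [Fintype ι] [NormedAddCommGroup F] [NormedAddCommGroup G]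
    {T β e p C : ℝ} {v : ι → ℝ → Spc n → F} {w : ℝ → Spc n → G}
    (h : ∀ i, HB T β e p C (v i)) (hb : ∀ t ∈ Set.Icc 0 T, ∀ x, ‖w t x‖ ≤ ∑ i, ‖v i t x‖)
    (hd : ∀ t ∈ Set.Icc 0 T, ∀ s ∈ Set.Icc 0 T, ∀ x y,
      ‖w t x - w s y‖ ≤ ∑ i, ‖v i t x - v i s y‖) :
    HB T β e p (Fintype.card ι * C) w where
  bd t ht x := (hb t ht x).trans ((Finset.sum_le_sum fun i _ => (h i).bd t ht x).trans
    (le_of_eq (by simp; ring)))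
  sp t ht x y := (hd t ht t ht x y).trans ((Finset.sum_le_sum fun i _ => (h i).sp t ht x y).trans
    (le_of_eq (by simp; ring)))
  tm s t hs hst ht x := (hd t ⟨hs.trans hst, ht⟩ s ⟨hs, hst.trans ht⟩ x x).trans
    ((Finset.sum_le_sum fun i _ => (h i).tm s t hs hst ht x).trans (le_of_eq (by simp; ring)))

lemma XS.of_iteratedFDeriv {T β p C : ℝ} {ex : ℕ → ℝ} {R : ℕ} {v : ℝ → Spc n → ℝ}
    (hc : ∀ t ∈ Set.Icc 0 T, ContDiff ℝ R (v t))
    (h : ∀ m ≤ R, HB T β (ex (R - m)) (p + m) C (fun t => iteratedFDeriv ℝ m (v t))) :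
    XS T β ex R p C v := by
  have h0 : HB T β (ex R) p C v := by
    have := HB.of_lip (K := 1) (w := v) zero_le_one (h 0 (Nat.zero_le _))
      (fun t _ x => by rw [norm_iteratedFDeriv_zero, one_mul]) (fun t _ s _ x y => by
        rw [iteratedFDeriv_zero_eq_comp, iteratedFDeriv_zero_eq_comp, Function.comp_apply,
          Function.comp_apply, ← map_sub, LinearIsometryEquiv.norm_map, one_mul])
    simpa using this
  induction R generalizing p v with
  | zero => exact h0
  | succ R ih =>
    have hd : ∀ i, ∀ t ∈ Set.Icc 0 T, ContDiff ℝ R (NSdeRham.dx i v t) := fun i t ht =>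
      contDiff_pd (hc t ht) i
    have hh : ∀ i, ∀ m ≤ R, HB T β (ex (R - m)) (p + 1 + m) C
        (fun t => iteratedFDeriv ℝ m (NSdeRham.dx i v t)) := by
      intro i m hm
      have hcm : ∀ t ∈ Set.Icc 0 T, ContDiff ℝ (m + 1 : ℕ) (v t) := fun t ht =>
        (hc t ht).of_le (by norm_cast; omega)
      have := HB.of_lip (K := 1) (w := fun t => iteratedFDeriv ℝ m (NSdeRham.dx i v t))
        zero_le_one (h (m + 1) (by omega))
        (fun t ht x => by
          rw [one_mul]; exact norm_iteratedFDeriv_pd_le (hcm t ht) i x)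
        (fun t ht s hs x y => by
          rw [one_mul]; exact norm_iteratedFDeriv_pd_sub_le (hcm t ht) (hcm s hs) i x y)
      rw [one_mul, Nat.add_sub_add_right] at this
      convert this using 1
      push_cast; ring
    refine ⟨h0, fun t ht => (hc t ht).differentiable (by norm_cast), fun i =>
      ih (hd i) (hh i) ?_⟩
    have := HB.of_lip (K := 1) (w := NSdeRham.dx i v) zero_le_one (hh i 0 (Nat.zero_le _))
      (fun t _ x => by rw [norm_iteratedFDeriv_zero, one_mul]) (fun t _ s _ x y => by
        rw [iteratedFDeriv_zero_eq_comp, iteratedFDeriv_zero_eq_comp, Function.comp_apply,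
          Function.comp_apply, ← map_sub, LinearIsometryEquiv.norm_map, one_mul])
    simpa using this

lemma HB.continuous_slice {F : Type*} [NormedAddCommGroup F] {T β e p C t : ℝ}
    {v : ℝ → Spc n → F} (h : HB T β e p C v) (he : 0 < e) (hp : 0 ≤ p) (hβ : 0 ≤ β)
    (ht : t ∈ Set.Icc 0 T) : Continuous (v t) :=
  (h.continuousOn he hp hβ).comp_continuous (f := fun x : Spc n => (t, x)) (by fun_prop)
    fun _ => ⟨ht, trivial⟩

lemma XS.contDiff {T p κ C : ℝ} {ex : ℕ → ℝ} {R : ℕ} {v : ℝ → Spc n → ℝ} {t : ℝ}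
    (hex : GoodEx ex κ) (h : XS T 0 ex R p C v) (hp : 0 ≤ p) (ht : t ∈ Set.Icc 0 T) :
    ContDiff ℝ R (v t) := by
  induction R generalizing p v with
  | zero =>
    exact contDiff_zero.2 (h.hb.continuous_slice (hex.pos 0) hp le_rfl ht)
  | succ R ih => exact contDiff_succ_of_pd (h.diff t ht) fun i => ih (h.dx i) (by linarith)

lemma XS.iteratedFDeriv {T p κ C : ℝ} {ex : ℕ → ℝ} {R m : ℕ} {v : ℝ → Spc n → ℝ}
    (hex : GoodEx ex κ) (h : XS T 0 ex R p C v) (hp : 0 ≤ p) (hm : m ≤ R) :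
    HB T 0 (ex (R - m)) (p + m) ((n : ℝ) ^ m * C) (fun t => _root_.iteratedFDeriv ℝ m (v t)) := by
  induction m generalizing R p v with
  | zero =>
    have := HB.of_lip (K := 1) (w := fun t => _root_.iteratedFDeriv ℝ 0 (v t)) zero_le_one h.hb
      (fun t _ x => by rw [norm_iteratedFDeriv_zero, one_mul]) (fun t _ s _ x y => by
        rw [iteratedFDeriv_zero_eq_comp, iteratedFDeriv_zero_eq_comp, Function.comp_apply,
          Function.comp_apply, ← map_sub, LinearIsometryEquiv.norm_map, one_mul])
    simpa using this
  | succ m ih =>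
    obtain ⟨R, rfl⟩ : ∃ R', R = R' + 1 := ⟨R - 1, by omega⟩
    have hc : ∀ t ∈ Set.Icc 0 T, ∀ i, ContDiff ℝ m (pd i (v t)) := fun t ht i =>
      ((h.dx i).contDiff hex (by linarith) ht).of_le (by norm_cast; omega)
    have := HB.of_sum_le (w := fun t => _root_.iteratedFDeriv ℝ (m + 1) (v t))
      (fun i => ih (h.dx i) (by linarith) (by omega))
      (fun t ht x => norm_iteratedFDeriv_succ_le (hc t ht) x)
      (fun t ht s hs x y => norm_iteratedFDeriv_succ_sub_le (hc t ht) (hc s hs) x y)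
    rw [Nat.add_sub_add_right]
    convert this using 1
    · push_cast; ring
    · rw [Fintype.card_fin]; ring

/-! ### The function spaces of the problem in terms of partial derivatives -/

/-- Exponent `lam` for the top order derivatives and `lam'` for the lower ones. -/
def topEx (lam lam' : ℝ) (m : ℕ) : ℝ := if m = 0 then lam else lam'

section conversion

variable {T lam lam' δ N : ℝ} {s k : ℕ}

lemma goodEx_topEx (h1 : 0 < lam) (h2 : lam < lam') (h3 : lam' < 1) :
    GoodEx (topEx lam lam') ((1 - lam') / 2) where
  kpos := by linarith
  klt := by linarith
  pos m := by unfold topEx; split_ifs <;> linarith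
  mono a b hab := by
    unfold topEx
    split_ifs with ha hb hb
    · exact le_rfl
    · exact h2.le
    · omega
    · exact le_rfl
  le m := by unfold topEx; split_ifs <;> linarith

lemma eAniso0_le_of_eAnisoKS {u : ℝ → Spc n → ℝ} {b m j : ℕ} (hb : b ≤ k)
    (hmj : m + 2 * j ≤ 2 * s) :
    eAniso0 T lam (δ + b + m) (mixDeriv T (b + m) j u) ≤ eAnisoKS T k s lam δ u := by
  unfold eAnisoKS
  have h1 := Finset.single_le_sum_of_canonicallyOrdered
    (f := fun b : ℕ => ∑ m ∈ Finset.range (2 * s + 1), ∑ j ∈ Finset.range (s + 1),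
      if m + 2 * j ≤ 2 * s then eAniso0 T lam (δ + b + m) (mixDeriv T (b + m) j u) else 0)
    (Finset.mem_range.2 (Nat.lt_succ_of_le hb))
  have h2 := Finset.single_le_sum_of_canonicallyOrdered
    (f := fun m : ℕ => ∑ j ∈ Finset.range (s + 1),
      if m + 2 * j ≤ 2 * s then eAniso0 T lam (δ + b + m) (mixDeriv T (b + m) j u) else 0)
    (Finset.mem_range.2 (show m < 2 * s + 1 by omega))
  have h3 := Finset.single_le_sum_of_canonicallyOrdered
    (f := fun j : ℕ => if m + 2 * j ≤ 2 * s then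
      eAniso0 T lam (δ + b + m) (mixDeriv T (b + m) j u) else 0)
    (Finset.mem_range.2 (show j < s + 1 by omega))
  simp only [if_pos hmj] at h3
  exact h3.trans (h2.trans h1)

lemma xs_tDeriv (h1 : 0 < lam) (h2 : lam < lam') (h3 : lam' < 1) (hδ : 0 ≤ δ) (hN : 0 ≤ N)
    {u : ℝ → Spc n → ℝ} (hc : ∀ j ≤ s, ∀ t ∈ Set.Icc 0 T,
      ContDiff ℝ (2 * s + k + 1 - 2 * j : ℕ) (fun x => tDeriv T j u t x))
    (h : eFn T k s lam lam' δ u ≤ ENNReal.ofReal N) {j : ℕ} (hj : j ≤ s) :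
    XS T 0 (topEx lam lam') (2 * s + k + 1 - 2 * j) δ
      ((8 + 2 ^ (δ + (2 * s + k + 1 : ℕ) + 1)) * N) (tDeriv T j u) := by
  have key : ∀ {e : ℝ} (r : ℕ), 0 < e → e ≤ 1 → r ≤ 2 * s + k + 1 →
      eAniso0 T e (δ + r) (mixDeriv T r j u) ≤ ENNReal.ofReal N →
      HB T 0 e (δ + r) ((8 + 2 ^ (δ + (2 * s + k + 1 : ℕ) + 1)) * N)
        (fun t => iteratedFDeriv ℝ r (tDeriv T j u t)) := by
    intro e r he he1 hr hh
    refine (HB.of_eAniso0 he he1 (by positivity) hN hh).mono ?_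
    have hr' : (r : ℝ) ≤ (2 * s + k + 1 : ℕ) := by exact_mod_cast hr
    have := Real.rpow_le_rpow_of_exponent_le (one_le_two : (1 : ℝ) ≤ 2)
      (show δ + r + e ≤ δ + (2 * s + k + 1 : ℕ) + 1 by linarith)
    gcongr
  refine XS.of_iteratedFDeriv (hc j hj) fun r hr => ?_
  rcases hr.lt_or_eq with hlt | rfl
  · rw [topEx, if_neg (by omega)]
    refine key r (h1.trans h2) h3.le (by omega) ?_
    obtain ⟨b, m, rfl, hb, hm⟩ : ∃ b m, r = b + m ∧ b ≤ k ∧ m + 2 * j ≤ 2 * s := by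
      rcases le_total r k with hrk | hrk
      · exact ⟨r, 0, rfl, hrk, by omega⟩
      · exact ⟨k, r - k, by omega, le_rfl, by omega⟩
    have := (eAniso0_le_of_eAnisoKS (T := T) (lam := lam') (δ := δ) (u := u) hb hm).trans
      ((le_add_self).trans h)
    push_cast
    rwa [← add_assoc]
  · rw [Nat.sub_self, topEx, if_pos rfl]
    refine key _ h1 (h2.trans h3).le (by omega) ?_
    obtain ⟨m, hm, hr⟩ : ∃ m, m + 2 * j ≤ 2 * s ∧ 2 * s + k + 1 - 2 * j = k + 1 + m :=
      ⟨2 * s - 2 * j, by omega, by omega⟩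
    rw [hr]
    have := (eAniso0_le_of_eAnisoKS (T := T) (lam := lam) (δ := δ) (u := u) le_rfl hm).trans
      ((le_self_add).trans h)
    rw [Nat.cast_add, ← add_assoc]
    exact this

lemma eAnisoKS_ne_top {u : ℝ → Spc n → ℝ} (h : ∀ b m j, b ≤ k → m + 2 * j ≤ 2 * s →
    eAniso0 T lam (δ + b + m) (mixDeriv T (b + m) j u) ≠ ⊤) : eAnisoKS T k s lam δ u ≠ ⊤ := by
  refine ENNReal.sum_ne_top.2 fun b hb => ENNReal.sum_ne_top.2 fun m _ =>
    ENNReal.sum_ne_top.2 fun j _ => ?_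
  split_ifs with hmj
  · exact h b m j (by simpa [Nat.lt_succ_iff] using hb) hmj
  · exact ENNReal.zero_ne_top

lemma eFn_ne_top (h1 : 0 < lam) (h2 : lam < lam') (h3 : lam' < 1) (hδ : 0 ≤ δ) (hT : 0 ≤ T)
    {u : ℝ → Spc n → ℝ}
    (h : ∀ j ≤ s, ∃ C, XS T 0 (topEx lam lam') (2 * s + k + 1 - 2 * j) δ C (tDeriv T j u)) :
    eFn T k s lam lam' δ u ≠ ⊤ := by
  have hex := goodEx_topEx h1 h2 h3
  refine ENNReal.add_ne_top.2 ⟨eAnisoKS_ne_top fun b m j hb hm => ?_,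
    eAnisoKS_ne_top fun b m j hb hm => ?_⟩
  · obtain ⟨C, hC⟩ := h j (by omega)
    have hh := (hC.iteratedFDeriv hex hδ (m := b + m) (by omega)).exp_mono (e := lam) h1.le
      (by unfold topEx; split_ifs <;> linarith) (by positivity)
      (by have := hex.le (2 * s + k + 1 - 2 * j - (b + m)); have := hex.kpos; linarith) hT
    have := hh.eAniso0_ne_top h1 (by positivity)
    push_cast at this
    rwa [← add_assoc] at this
  · obtain ⟨C, hC⟩ := h j (by omega)
    have hh := hC.iteratedFDeriv hex hδ (m := b + m) (by omega)
    rw [topEx, if_neg (by omega)] at hh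
    have := hh.eAniso0_ne_top (h1.trans h2) (by positivity)
    push_cast at this
    rwa [← add_assoc] at this

lemma anisoReg_of_xs (h1 : 0 < lam) (h2 : lam < lam') (h3 : lam' < 1) (hδ : 0 ≤ δ)
    {u : ℝ → Spc n → ℝ} (hu : ∀ x : Spc n, ContDiffOn ℝ s (fun t => u t x) (Set.Icc 0 T))
    (h : ∀ j ≤ s, ∃ C, XS T 0 (topEx lam lam') (2 * s + k + 1 - 2 * j) δ C (tDeriv T j u)) :
    AnisoReg T (k + 1) s u := by
  have hex := goodEx_topEx h1 h2 h3
  refine ⟨hu, fun j hj t ht => ?_, fun j m hj hm => ?_⟩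
  · obtain ⟨C, hC⟩ := h j hj
    refine (hC.contDiff hex hδ ht).of_le (le_of_eq ?_)
    rw [show 2 * s + k + 1 - 2 * j = 2 * (s - j) + (k + 1) by omega]
    push_cast
    rfl
  · obtain ⟨C, hC⟩ := h j hj
    have hh := hC.iteratedFDeriv hex hδ (m := m) (by omega)
    exact (hh.continuousOn (hex.pos _) (by positivity) le_rfl).comp_continuous
      (f := fun p : Set.Icc (0 : ℝ) T × Spc n => ((p.1 : ℝ), p.2)) (by fun_prop)
      fun p => ⟨p.1.2, trivial⟩

lemma AnisoReg.contDiff_tDeriv {u : ℝ → Spc n → ℝ} (h : AnisoReg T (k + 1) s u) {j : ℕ}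
    (hj : j ≤ s) {t : ℝ} (ht : t ∈ Set.Icc 0 T) :
    ContDiff ℝ (2 * s + k + 1 - 2 * j : ℕ) (fun x => tDeriv T j u t x) := by
  refine (h.2.1 j hj t ht).of_le (le_of_eq ?_)
  rw [show 2 * s + k + 1 - 2 * j = 2 * (s - j) + (k + 1) by omega]
  push_cast
  rfl

lemma xs_of_eHolS (h1 : 0 < lam) (h2 : lam < lam') (h3 : lam' < 1) (hδ : 0 ≤ δ) (hN : 0 ≤ N)
    {R : ℕ} {g : Spc n → ℝ} (hg : ContDiff ℝ R g) (h : eHolS R lam δ g ≤ ENNReal.ofReal N) :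
    XS T 0 (topEx lam lam') R δ ((8 + 2 ^ (δ + R + 1)) * N) (fun _ => g) := by
  have hm : ∀ m ≤ R, eHol0 lam (δ + m) (iteratedFDeriv ℝ m g) ≤ ENNReal.ofReal N := fun m hm =>
    (Finset.single_le_sum_of_canonicallyOrdered
      (f := fun m : ℕ => eHol0 lam (δ + m) (iteratedFDeriv ℝ m g))
      (Finset.mem_range.2 (Nat.lt_succ_of_le hm))).trans h
  have hbd : ∀ m ≤ R, ∀ x, ‖iteratedFDeriv ℝ m g x‖ ≤ N * wt x ^ (-(δ + m)) := fun m hmR x =>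
    norm_le_of_eWSup (by
      refine le_trans ?_ (hm m hmR)
      rw [eHol0, if_neg h1.ne', add_assoc]
      exact le_self_add.trans le_add_self) hN x
  have hpow : ∀ a : ℝ, a ≤ R + 1 → (2 : ℝ) ^ (δ + a) ≤ 2 ^ (δ + R + 1) := fun a ha =>
    Real.rpow_le_rpow_of_exponent_le one_le_two (by linarith)
  have h20 : (0 : ℝ) ≤ 2 ^ (δ + R + 1) := by positivity
  refine XS.of_iteratedFDeriv (fun _ _ => hg) fun m hmR => ⟨fun t _ x => ?_, fun t _ x y => ?_,
    fun a b ha hab hb x => ?_⟩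
  · refine (hbd m hmR x).trans ?_
    have hw := (Real.rpow_pos_of_pos (wt_pos x) (-(δ + m))).le
    rw [zero_mul, Real.exp_zero, mul_one]
    gcongr
    nlinarith
  · have hw := (Real.rpow_pos_of_pos (wtm_pos x y)
      (-(δ + m + topEx lam lam' (R - m)))).le
    rw [zero_mul, Real.exp_zero, mul_one]
    have hmR' : (m : ℝ) ≤ R := by exact_mod_cast hmR
    rcases hmR.lt_or_eq with hlt | rfl
    · rw [topEx, if_neg (by omega)] at hw ⊢
      have hlt' : (m : ℝ) + 1 ≤ R := by exact_mod_cast hlt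
      refine (norm_sub_le_of_fderiv (h1.trans h2).le h3.le (by positivity) hN
        (hg.differentiable_iteratedFDeriv (by exact_mod_cast hlt)) (hbd m hmR)
        (fun x => ?_) x y).trans ?_
      · rw [norm_fderiv_iteratedFDeriv]
        have := hbd (m + 1) hlt x
        rwa [Nat.cast_add, Nat.cast_one, ← add_assoc] at this
      · have := hpow (m + 1) (by linarith)
        rw [← add_assoc] at this
        gcongr
    · rw [Nat.sub_self, topEx, if_pos rfl] at hw ⊢
      refine (norm_sub_le_of_eHol0 h1 (h2.trans h3).le (by positivity) hN (hm _ hmR) x y).trans ?_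
      have := hpow (m + lam) (by linarith)
      rw [← add_assoc] at this
      gcongr
  · rw [sub_self, norm_zero]
    have hw := (Real.rpow_pos_of_pos (wt_pos x) (-(δ + m))).le
    have : 0 ≤ b - a := by linarith
    positivity

end conversion

/-! ### Time regularity -/

section commute

variable {T p κ C C' : ℝ} {ex : ℕ → ℝ} {v w : ℝ → Spc n → ℝ}

/-- Spatial derivatives commute with the time derivative. -/
lemma dx_hasDerivWithinAt (hT : 0 ≤ T) (hex : GoodEx ex κ) (hp : 0 ≤ p)
    (hv : XS T 0 ex 1 p C v) (hw : XS T 0 ex 1 p C' w)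
    (h : ∀ t ∈ Set.Icc 0 T, ∀ x,
      HasDerivWithinAt (fun τ => v τ x) (w t x) (Set.Icc 0 T) t) (i : Fin n) {t : ℝ}
    (ht : t ∈ Set.Icc 0 T) (x : Spc n) :
    HasDerivWithinAt (fun τ => dx i v τ x) (dx i w t x) (Set.Icc 0 T) t := by
  have hcw : ∀ x, Continuous fun t => w (cl T t) x := fun x =>
    hw.hb.continuous_cl_time hT (hex.pos _) hp le_rfl x
  have hcdw : ∀ x, Continuous fun t => dx i w (cl T t) x := fun x =>
    (hw.dx i).hb.continuous_cl_time hT (hex.pos _) (by linarith) le_rfl x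
  have hint : ∀ t ∈ Set.Icc 0 T, ∀ x, v t x = v 0 x + ∫ σ in (0 : ℝ)..t, w (cl T σ) x := by
    intro t ht x
    have := intervalIntegral.integral_eq_sub_of_hasDeriv_right_of_le (f := fun τ => v τ x)
      (f' := fun σ => w (cl T σ) x) ht.1
      (fun τ hτ => ((h τ ⟨hτ.1, hτ.2.trans ht.2⟩ x).continuousWithinAt).mono
        (Set.Icc_subset_Icc_right ht.2))
      (fun τ hτ => by
        have hτT : τ < T := hτ.2.trans_le ht.2
        rw [cl_eq ⟨hτ.1.le, hτT.le⟩]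
        exact ((h τ ⟨hτ.1.le, hτT.le⟩ x).hasDerivAt
          (Icc_mem_nhds hτ.1 hτT)).hasDerivWithinAt)
      ((hcw x).intervalIntegrable _ _)
    linarith
  refine hasDerivWithinAt_of_integral_eq (ψ := fun t => dx i w t x) (c := dx i v 0 x) (hcdw x)
    (fun t ht => ?_) ht
  have hC' := hw.const_nonneg hT
  have hd := (intervalIntegral.hasDerivAt_integral_of_dominated_loc_of_deriv_le
    (μ := volume) (a := 0) (b := t) (x₀ := (0 : ℝ)) (s := Set.univ)
    (F := fun r σ => w (cl T σ) (x + r • EuclideanSpace.single i 1))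
    (F' := fun r σ => dx i w (cl T σ) (x + r • EuclideanSpace.single i 1))
    (bound := fun _ => C') Filter.univ_mem
    (Eventually.of_forall fun r => (hcw _).aestronglyMeasurable)
    ((hcw _).intervalIntegrable _ _) (hcdw _).aestronglyMeasurable
    (Eventually.of_forall fun σ _ r _ => by
      refine ((hw.dx i).hb.bd _ (cl_mem hT σ) _).trans ?_
      rw [zero_mul, Real.exp_zero, mul_one]
      exact mul_le_of_le_one_right hC'
        (Real.rpow_le_one_of_one_le_of_nonpos (one_le_wt _) (by linarith)))
    intervalIntegrable_const
    (Eventually.of_forall fun σ _ r _ =>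
      hasDerivAt_line i (hw.diff _ (cl_mem hT σ) _))).2
  have h1 := hasDerivAt_line i (s := 0) (hv.diff 0 ⟨le_rfl, hT⟩
    (x + (0 : ℝ) • EuclideanSpace.single i 1))
  have h2 := hasDerivAt_line i (s := 0) (hv.diff t ht (x + (0 : ℝ) • EuclideanSpace.single i 1))
  have h3 := (h1.add hd).congr_of_eventuallyEq (f₁ := fun r : ℝ =>
    v t (x + r • EuclideanSpace.single i 1))
    (Eventually.of_forall fun r => hint t ht _)
  have := h2.unique h3
  simpa [dx] using this

end commute

/-- Functions whose time derivatives up to a given order exist and lie in the spaces `XS`, each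
time derivative counting as two spatial derivatives. -/
def XT (T : ℝ) (ex : ℕ → ℝ) : ℕ → ℕ → ℝ → (ℝ → Spc n → ℝ) → Prop
  | 0, m, p, v => ∃ C, XS T 0 ex m p C v
  | j + 1, m, p, v => (∃ C, XS T 0 ex m p C v) ∧ ∀ m', m = m' + 2 → ∃ v', XT T ex j m' p v' ∧
      ∀ t ∈ Set.Icc 0 T, ∀ x, HasDerivWithinAt (fun τ => v τ x) (v' t x) (Set.Icc 0 T) t

lemma tDeriv_zero (T : ℝ) (v : ℝ → Spc n → ℝ) : tDeriv T 0 v = v := by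
  funext t x
  simp [tDeriv]

namespace XT

variable {T p p' κ : ℝ} {ex : ℕ → ℝ} {j m m' : ℕ} {u v : ℝ → Spc n → ℝ}

lemma xs (h : XT T ex j m p v) : ∃ C, XS T 0 ex m p C v := by
  cases j with
  | zero => exact h
  | succ j => exact h.1

lemma pred (h : XT T ex (j + 1) m p v) : XT T ex j m p v := by
  induction j generalizing m v with
  | zero => exact h.1
  | succ j ih =>
    refine ⟨h.1, fun m' hm' => ?_⟩
    obtain ⟨v', hv', hd⟩ := h.2 m' hm'
    exact ⟨v', ih hv', hd⟩

lemma level_le (hex : GoodEx ex κ) (hT : 0 ≤ T) (hp : 0 ≤ p) (h : XT T ex j m p v)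
    (hm : m' ≤ m) : XT T ex j m' p v := by
  induction j generalizing m m' v with
  | zero =>
    obtain ⟨C, hC⟩ := h
    exact hC.level_le hex hm hp hT
  | succ j ih =>
    obtain ⟨C, hC⟩ := h.1
    refine ⟨hC.level_le hex hm hp hT, fun k hk => ?_⟩
    obtain ⟨v', hv', hd⟩ := h.2 (m - 2) (by omega)
    exact ⟨v', ih hv' (by omega), hd⟩

lemma weight_mono (hT : 0 ≤ T) (hp : p ≤ p') (h : XT T ex j m p' v) : XT T ex j m p v := by
  induction j generalizing m v with
  | zero =>
    obtain ⟨C, hC⟩ := h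
    exact ⟨C, hC.weight_mono hp hT⟩
  | succ j ih =>
    obtain ⟨C, hC⟩ := h.1
    refine ⟨⟨C, hC.weight_mono hp hT⟩, fun k hk => ?_⟩
    obtain ⟨v', hv', hd⟩ := h.2 k hk
    exact ⟨v', ih hv', hd⟩

lemma congr (h : XT T ex j m p v) (huv : ∀ t ∈ Set.Icc 0 T, ∀ x, u t x = v t x) :
    XT T ex j m p u := by
  obtain ⟨C, hC⟩ := h.xs
  cases j with
  | zero => exact ⟨C, hC.congr huv⟩
  | succ j =>
    refine ⟨⟨C, hC.congr huv⟩, fun k hk => ?_⟩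
    obtain ⟨v', hv', hd⟩ := h.2 k hk
    exact ⟨v', hv', fun t ht x => (hd t ht x).congr (fun τ hτ => huv τ hτ x) (huv t ht x)⟩

lemma zero : XT T ex j m p (fun _ _ => 0 : ℝ → Spc n → ℝ) := by
  induction j generalizing m with
  | zero => exact ⟨0, XS.zero⟩
  | succ j ih =>
    exact ⟨⟨0, XS.zero⟩, fun m' _ => ⟨_, ih, fun t _ x => hasDerivWithinAt_const _ _ _⟩⟩

lemma add (h : XT T ex j m p v) (h' : XT T ex j m p u) :
    XT T ex j m p (fun t x => v t x + u t x) := by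
  obtain ⟨C, hC⟩ := h.xs
  obtain ⟨D, hD⟩ := h'.xs
  induction j generalizing m v u C D with
  | zero => exact ⟨_, hC.add hD⟩
  | succ j ih =>
    refine ⟨⟨_, hC.add hD⟩, fun k hk => ?_⟩
    obtain ⟨v', hv', hd⟩ := h.2 k hk
    obtain ⟨u', hu', hd'⟩ := h'.2 k hk
    obtain ⟨_, hv''⟩ := hv'.xs
    obtain ⟨_, hu''⟩ := hu'.xs
    exact ⟨_, ih hv' hu' _ hv'' _ hu'', fun t ht x => (hd t ht x).add (hd' t ht x)⟩

lemma const_mul (h : XT T ex j m p v) (c : ℝ) : XT T ex j m p (fun t x => c * v t x) := by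
  obtain ⟨C, hC⟩ := h.xs
  induction j generalizing m v C with
  | zero => exact ⟨_, hC.const_mul c⟩
  | succ j ih =>
    refine ⟨⟨_, hC.const_mul c⟩, fun k hk => ?_⟩
    obtain ⟨v', hv', hd⟩ := h.2 k hk
    obtain ⟨_, hv''⟩ := hv'.xs
    exact ⟨_, ih hv' _ hv'', fun t ht x => (hd t ht x).const_mul c⟩

lemma sum {ι : Type*} (s : Finset ι) {w : ι → ℝ → Spc n → ℝ}
    (h : ∀ k ∈ s, XT T ex j m p (w k)) : XT T ex j m p (fun t x => ∑ k ∈ s, w k t x) := by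
  induction s using Finset.induction_on with
  | empty => simpa using zero
  | insert a s ha ih =>
    simp only [Finset.sum_insert ha]
    exact (h a (Finset.mem_insert_self _ _)).add
      (ih fun k hk => h k (Finset.mem_insert_of_mem hk))

lemma mul (hex : GoodEx ex κ) (hT : 0 ≤ T) (hp : 0 ≤ p) (hp' : 0 ≤ p') (h : XT T ex j m p v)
    (h' : XT T ex j m p' u) : XT T ex j m (p + p') (fun t x => v t x * u t x) := by
  obtain ⟨C, hC⟩ := h.xs
  obtain ⟨D, hD⟩ := h'.xs
  induction j generalizing m v u C D with
  | zero => exact ⟨_, hC.mul hex hD hp hp' le_rfl hT⟩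
  | succ j ih =>
    refine ⟨⟨_, hC.mul hex hD hp hp' le_rfl hT⟩, fun k hk => ?_⟩
    obtain ⟨v', hv', hd⟩ := h.2 k hk
    obtain ⟨u', hu', hd'⟩ := h'.2 k hk
    obtain ⟨_, hv''⟩ := hv'.xs
    obtain ⟨_, hu''⟩ := hu'.xs
    have hvl := h.pred.level_le hex hT hp (show k ≤ m by omega)
    have hul := h'.pred.level_le hex hT hp' (show k ≤ m by omega)
    obtain ⟨_, hvl'⟩ := hvl.xs
    obtain ⟨_, hul'⟩ := hul.xs
    exact ⟨_, (ih hv' hul _ hv'' _ hul').add (ih hvl hu' _ hvl' _ hu''), fun t ht x =>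
      (hd t ht x).mul (hd' t ht x)⟩

lemma dx (hex : GoodEx ex κ) (hT : 0 ≤ T) (hp : 0 ≤ p) (h : XT T ex j (m + 1) p v) (i : Fin n) :
    XT T ex j m (p + 1) (NSdeRham.dx i v) := by
  obtain ⟨C, hC⟩ := h.xs
  induction j generalizing m v C with
  | zero => exact ⟨C, hC.dx i⟩
  | succ j ih =>
    refine ⟨⟨C, hC.dx i⟩, fun k hk => ?_⟩
    obtain ⟨v', hv', hd⟩ := h.2 (k + 1) (by omega)
    obtain ⟨C', hv''⟩ := hv'.xs
    obtain ⟨_, h1⟩ := hC.level_le hex (show 1 ≤ m + 1 by omega) hp hT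
    obtain ⟨_, h2⟩ := hv''.level_le hex (show 1 ≤ k + 1 by omega) hp hT
    exact ⟨_, ih hv' _ hv'', fun t ht x => dx_hasDerivWithinAt hT hex hp h1 h2 hd i ht x⟩

lemma bil {ι : Type*} [Fintype ι] (hex : GoodEx ex κ) (hT : 0 ≤ T) (hp : 0 ≤ p)
    (c : ι → Fin n → ι → ι → ℝ) {U V : ι → ℝ → Spc n → ℝ} (hU : ∀ I, XT T ex j (m + 1) p (U I))
    (hV : ∀ I, XT T ex j (m + 1) p (V I)) (k : ι) :
    XT T ex j m p (NSdeRham.bil c U V k) := by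
  refine sum _ fun i _ => sum _ fun I _ => sum _ fun J _ => const_mul ?_ _
  exact (((hU I).dx hex hT hp i).mul hex hT (by linarith) hp
    ((hV J).level_le hex hT hp (Nat.le_succ m))).weight_mono hT (by linarith)

lemma quad {ι : Type*} [Fintype ι] (hex : GoodEx ex κ) (hT : 0 ≤ T) (hp : 0 ≤ p)
    (c : ι → Fin n → ι → ι → ℝ) {U V : ι → ℝ → Spc n → ℝ} (hU : ∀ I, XT T ex j (m + 1) p (U I))
    (hV : ∀ I, XT T ex j (m + 1) p (V I)) (k : ι) :
    XT T ex j m p (NSdeRham.quad c U V k) :=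
  ((bil hex hT hp c hU hV k).add (bil hex hT hp c hV hU k)).add (bil hex hT hp c hV hV k)

lemma lap (hex : GoodEx ex κ) (hT : 0 ≤ T) (hp : 0 ≤ p) (h : XT T ex j (m + 2) p v) :
    XT T ex j m p (fun t => NSdeRham.lap (v t)) :=
  sum _ fun i _ => ((((h.dx hex hT hp i).dx hex hT (by linarith) i)).weight_mono hT (by linarith) :
    XT T ex j m p _)

/-- A solution of a heat equation inherits the time regularity of the right hand side. -/
lemma bootstrap {ι : Type*} [Fintype ι] (hex : GoodEx ex κ) (hT : 0 ≤ T) (hp : 0 ≤ p) (μ : ℝ)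
    (c : ι → Fin n → ι → ι → ℝ) {U V F : ι → ℝ → Spc n → ℝ}
    (hU : ∀ I, XT T ex j m p (U I)) (hF : ∀ I, XT T ex j m p (F I))
    (hV : ∀ I, ∃ C, XS T 0 ex m p C (V I))
    (hd : ∀ I, ∀ t ∈ Set.Icc 0 T, ∀ x, HasDerivWithinAt (fun τ => V I τ x)
      (μ * NSdeRham.lap (V I t) x - NSdeRham.quad c U V I t x + F I t x) (Set.Icc 0 T) t) :
    ∀ I, XT T ex j m p (V I) := by
  induction j with
  | zero => exact hV
  | succ j ih =>
    have hVj := ih (fun I => (hU I).pred) fun I => (hF I).pred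
    refine fun I => ⟨hV I, fun k hk => ⟨_, ?_, hd I⟩⟩
    subst hk
    have h1 := ((hVj I).lap hex hT hp).const_mul μ
    have h2 := (quad hex hT hp c (fun I => (hU I).pred.level_le hex hT hp (Nat.le_succ (k + 1)))
      (fun I => (hVj I).level_le hex hT hp (Nat.le_succ (k + 1))) I).const_mul (-1)
    have h3 := (hF I).pred.level_le hex hT hp (show k ≤ k + 2 by omega)
    refine ((h1.add h2).add h3).congr fun t _ x => ?_
    ring

lemma tDeriv (hex : GoodEx ex κ) (hT : 0 < T) (hp : 0 ≤ p) (h : XT T ex j m p v) {l : ℕ}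
    (hl : l ≤ j) (hm : 2 * l ≤ m) :
    (∀ x, ContDiffOn ℝ l (fun t => v t x) (Set.Icc 0 T)) ∧
      ∃ C, XS T 0 ex (m - 2 * l) p C (NSdeRham.tDeriv T l v) := by
  induction l generalizing j m v with
  | zero =>
    obtain ⟨C, hC⟩ := h.xs
    refine ⟨fun x => contDiffOn_zero.2 ?_, C, ?_⟩
    · exact (hC.hb.continuousOn (hex.pos _) hp le_rfl).comp (f := fun t => (t, x)) (by fun_prop)
        fun t ht => ⟨ht, trivial⟩
    · simpa [tDeriv_zero] using hC
  | succ l ih =>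
    obtain ⟨j, rfl⟩ : ∃ j', j = j' + 1 := ⟨j - 1, by omega⟩
    obtain ⟨m, rfl⟩ : ∃ m', m = m' + 2 := ⟨m - 2, by omega⟩
    obtain ⟨v', hv', hd⟩ := h.2 m rfl
    obtain ⟨h1, C, hC⟩ := ih hv' (by omega) (by omega)
    have hu := uniqueDiffOn_Icc hT
    have hder : ∀ x, Set.EqOn (derivWithin (fun τ => v τ x) (Set.Icc 0 T)) (fun τ => v' τ x)
        (Set.Icc 0 T) := fun x t ht => (hd t ht x).derivWithin (hu t ht)
    refine ⟨fun x => ?_, C, ?_⟩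
    · have : ((l + 1 : ℕ) : WithTop ℕ∞) = (l : WithTop ℕ∞) + 1 := by norm_cast
      rw [this, contDiffOn_succ_iff_derivWithin hu]
      exact ⟨fun t ht => (hd t ht x).differentiableWithinAt, by simp, (h1 x).congr (hder x)⟩
    · rw [show m + 2 - 2 * (l + 1) = m - 2 * l by omega]
      refine hC.congr fun t ht x => ?_
      unfold NSdeRham.tDeriv
      rw [iteratedDerivWithin_succ']
      exact iteratedDerivWithin_congr (hder x) ht

lemma of_tDeriv (hT : 0 < T) (hv : ∀ x, ContDiffOn ℝ j (fun t => v t x) (Set.Icc 0 T))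
    (h : ∀ l ≤ j, 2 * l ≤ m → ∃ C, XS T 0 ex (m - 2 * l) p C (NSdeRham.tDeriv T l v)) :
    XT T ex j m p v := by
  have h0 : ∃ C, XS T 0 ex m p C v := by
    simpa [tDeriv_zero] using h 0 (Nat.zero_le _) (by omega)
  induction j generalizing m v with
  | zero => exact h0
  | succ j ih =>
    refine ⟨h0, fun k hk => ⟨fun t x => derivWithin (fun τ => v τ x) (Set.Icc 0 T) t, ?_, ?_⟩⟩
    · subst hk
      have hh : ∀ l ≤ j, 2 * l ≤ k → ∃ C, XS T 0 ex (k - 2 * l) p C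
          (NSdeRham.tDeriv T l fun t x => derivWithin (fun τ => v τ x) (Set.Icc 0 T) t) := by
        intro l hl hlk
        obtain ⟨C, hC⟩ := h (l + 1) (by omega) (by omega)
        rw [show k + 2 - 2 * (l + 1) = k - 2 * l by omega] at hC
        refine ⟨C, hC.congr fun t ht x => ?_⟩
        unfold NSdeRham.tDeriv
        rw [iteratedDerivWithin_succ']
      refine ih (fun x => ?_) hh ?_
      · exact (hv x).derivWithin (uniqueDiffOn_Icc hT) (by norm_cast)
      · simpa [tDeriv_zero] using hh 0 (Nat.zero_le _) (by omega)
    · exact fun t ht x =>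
        (((hv x).differentiableOn (by norm_cast)) t ht).hasDerivWithinAt

end XT

/-! ### The perturbed Cauchy problem -/

section perturb

variable {T p κ μ : ℝ} {ex : ℕ → ℝ} {m : ℕ}

lemma lap_add {f g : Spc n → ℝ} (hf : ContDiff ℝ 2 f) (hg : ContDiff ℝ 2 g) (x : Spc n) :
    lap (fun y => f y + g y) x = lap f x + lap g x := by
  have h1 : ∀ {f : Spc n → ℝ}, ContDiff ℝ 2 f → Differentiable ℝ f :=
    fun h => h.differentiable (by norm_num)
  have h2 : ∀ {f : Spc n → ℝ}, ContDiff ℝ 2 f → ∀ i, Differentiable ℝ (pd i f) := fun h i =>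
    (contDiff_pd (m := 1) (by exact_mod_cast h) i).differentiable (by norm_num)
  simp only [lap, ← Finset.sum_add_distrib]
  refine Finset.sum_congr rfl fun i _ => ?_
  rw [show pd i (fun y => f y + g y) = fun y => pd i f y + pd i g y from
    funext fun y => pd_add i (h1 hf y) (h1 hg y), pd_add i (h2 hf i x) (h2 hg i x)]

lemma lap_sub {f g : Spc n → ℝ} (hf : ContDiff ℝ 2 f) (hg : ContDiff ℝ 2 g) (x : Spc n) :
    lap (fun y => f y - g y) x = lap f x - lap g x := by
  have h := lap_add (hf.sub hg) hg x
  simp only [sub_add_cancel] at h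
  linarith

lemma XS.contDiff_two {C : ℝ} {v : ℝ → Spc n → ℝ} (hex : GoodEx ex κ)
    (h : XS T 0 ex m p C v) (hm : 2 ≤ m) (hp : 0 ≤ p) {t : ℝ} (ht : t ∈ Set.Icc 0 T) :
    ContDiff ℝ 2 (v t) :=
  (h.contDiff hex hp ht).of_le (by exact_mod_cast hm)

/-- Duhamel's formula for decaying solutions with zero initial values. -/
lemma eq_heatV (hT : 0 < T) (hμ : 0 < μ) (hex : GoodEx ex κ) (hp : 0 < p)
    {C C' : ℝ} {w h : ℝ → Spc n → ℝ} (hw : XS T 0 ex 2 p C w) (hh : XS T 0 ex 2 p C' h)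
    (hd : ∀ t ∈ Set.Ioo 0 T, ∀ x,
      HasDerivAt (fun τ => w τ x) (μ * lap (w t) x + h t x) t)
    (h0 : ∀ x, w 0 x = 0) : ∀ t ∈ Set.Icc 0 T, ∀ x, w t x = heatV μ T h t x := by
  have hh1 := hh.rate_mono (β' := 1) zero_le_one hT.le
  obtain ⟨K, -, hK⟩ := xs_heatV (n := n) hT.le hμ hex (p + 2 + 1)
  have hV := ((hK 1 le_rfl 2 p C' h hp.le (by norm_num) hh1).1).rate_zero zero_le_one hT.le
  have hz := hw.sub hV
  have key := heat_unique hT hμ hp (w := fun t x => w t x - heatV μ T h t x)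
    (hz.hb.continuousOn (hex.pos 2) hp.le le_rfl) (fun t ht x => by simpa using hz.hb.bd t ht x)
    hz.diff (fun t ht i => (hz.dx i).diff t ht) ?_ (fun x => by simp [h0, heatV_zero_time])
  · exact fun t ht x => sub_eq_zero.1 (key t ht x)
  · intro t ht x
    have ht' := Set.Ioo_subset_Icc_self ht
    have e := (hd t ht x).sub
      ((heatV_hasDerivWithinAt hμ hT.le hex le_rfl hp.le hh1 ht' x).hasDerivAt
        (Icc_mem_nhds ht.1 ht.2))
    rw [lap_sub (hw.contDiff_two hex le_rfl hp.le ht') (hV.contDiff_two hex le_rfl hp.le ht')]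
    exact e.congr_deriv (by ring)

variable {ι : Type*} [Fintype ι]

lemma XS.exists_uniform {β : ℝ} (hT : 0 ≤ T) {V : ι → ℝ → Spc n → ℝ}
    (h : ∀ I, ∃ C, XS T β ex m p C (V I)) : ∃ C, ∀ I, XS T β ex m p C (V I) := by
  choose C hC using h
  exact ⟨∑ J, C J, fun I => (hC I).mono
    (Finset.single_le_sum (fun J _ => (hC J).const_nonneg hT) (Finset.mem_univ I))⟩

lemma quad_eq_sub (c : ι → Fin n → ι → ι → ℝ) {U W : ι → ℝ → Spc n → ℝ} {t : ℝ} {x : Spc n}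
    (hU : ∀ I, DifferentiableAt ℝ (U I t) x) (hW : ∀ I, DifferentiableAt ℝ (W I t) x) (k : ι) :
    quad c U (fun I t x => W I t x - U I t x) k t x = bil c W W k t x - bil c U U k t x := by
  simp only [quad, bil_sub_left c hW hU, bil_sub_right]
  ring

/-- Uniqueness for the equation satisfied by the difference of two solutions. -/
lemma perturb_unique (hT : 0 < T) (hμ : 0 < μ) (hex : GoodEx ex κ) (hp : 0 < p)
    (hm : ex (m + 1) = ex m) (hm2 : 2 ≤ m) (c : ι → Fin n → ι → ι → ℝ) {A B : ℝ}
    {U W : ι → ℝ → Spc n → ℝ} (hU : ∀ I, XS T 0 ex (m + 1) p A (U I))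
    (hW : ∀ I, XS T 0 ex (m + 1) p B (W I))
    (hd : ∀ I, ∀ t ∈ Set.Ioo 0 T, ∀ x,
      HasDerivAt (fun τ => W I τ x) (μ * lap (W I t) x - quad c U W I t x) t)
    (h0 : ∀ I x, W I 0 x = 0) : ∀ I, ∀ t ∈ Set.Icc 0 T, ∀ x, W I t x = 0 := by
  refine quad_unique hex hT.le hμ hp.le hm c hU hW fun I t ht x => ?_
  obtain ⟨C, hq⟩ := xs_quad hex hT.le hp.le c hU hW I
  obtain ⟨C', hq⟩ := hq.level_le hex hm2 (by linarith) hT.le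
  replace hq := hq.weight_mono (show p ≤ p + 1 by linarith) hT.le
  obtain ⟨C'', hW2⟩ := (hW I).level_le hex (show 2 ≤ m + 1 by omega) hp.le hT.le
  have e := eq_heatV hT hμ hex hp hW2.neg hq (fun t ht x => ?_) (fun x => by simp [h0]) t ht x
  · linarith
  · have ht' := Set.Ioo_subset_Icc_self ht
    have hl := lap_sub (contDiff_const (c := (0 : ℝ))) (hW2.contDiff_two hex le_rfl hp.le ht') x
    have hz : lap (fun _ : Spc n => (0 : ℝ)) x = 0 := by
      have : ∀ i, pd i (fun _ : Spc n => (0 : ℝ)) = fun _ => 0 := fun i =>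
        funext fun y => by simp [pd]
      simp [lap, this]
    simp only [zero_sub, hz] at hl
    rw [hl]
    exact (hd I t ht x).neg.congr_deriv (by ring)

/-- Solvability of the perturbed problem for small data. -/
lemma exists_perturb (hT : 0 < T) (hμ : 0 < μ) (hex : GoodEx ex κ) (hp : 0 ≤ p)
    (hm : ex (m + 1) = ex m) (hm2 : 2 ≤ m) (c : ι → Fin n → ι → ι → ℝ) {A : ℝ}
    {U : ι → ℝ → Spc n → ℝ} (hU : ∀ I, XS T 0 ex (m + 1) p A (U I)) :
    ∃ r, 0 < r ∧ ∀ (F : ι → ℝ → Spc n → ℝ) (g : ι → Spc n → ℝ),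
      (∀ I, XS T 0 ex (m + 1) p r (F I)) → (∀ I, XS T 0 ex (m + 1) p r fun _ => g I) →
      ∃ V : ι → ℝ → Spc n → ℝ, (∀ I, ∃ C, XS T 0 ex (m + 1) p C (V I)) ∧
        (∀ I x, V I 0 x = g I x) ∧
        ∀ I, ∀ t ∈ Set.Icc 0 T, ∀ x, HasDerivWithinAt (fun τ => V I τ x)
          (μ * lap (V I t) x - quad c U V I t x + F I t x) (Set.Icc 0 T) t := by
  obtain ⟨r, hr, hfix⟩ := exists_fixed hex hT.le hμ hp hm c A hU
  obtain ⟨K, hK0, hK⟩ := xs_heatV (n := n) hT.le hμ hex (p + (m + 1 : ℕ) + 1)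
  obtain ⟨L, hL0, hL⟩ := xs_heatP (n := n) hT.le hμ hex (p + (m + 1 : ℕ) + 1)
  set B := L + K * Real.exp T + 1 with hB
  have hB0 : 0 < B := by positivity
  refine ⟨r / B, by positivity, fun F g hF hg => ?_⟩
  have hF1 := fun I => (hF I).rate_mono (β' := 1) zero_le_one hT.le
  have hHV := fun I => ((hK 1 le_rfl _ p _ _ hp le_rfl (hF1 I)).1).rate_zero zero_le_one hT.le
  have hHP := fun I => hL _ p _ _ hp le_rfl (hg I)
  have hD := fun I => ((hHP I).add (hHV I)).mono (C' := r) (by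
    have : L + K * Real.exp T ≤ B := by linarith
    calc _ = (L + K * Real.exp T) * (r / B) := by simp only [Real.one_rpow, one_mul]; ring
      _ ≤ B * (r / B) := by gcongr
      _ = r := by field_simp)
  obtain ⟨V, hV, hVeq⟩ := hfix _ hD
  obtain ⟨B', hVS⟩ := XS.exists_uniform hT.le hV
  refine ⟨V, hV, fun I x => ?_, fun I t ht x => ?_⟩
  · rw [hVeq I 0 ⟨le_rfl, hT.le⟩ x]
    simp [heatV_zero_time, heatP_zero_time]
  · obtain ⟨C, hq⟩ := xs_quad hex hT.le hp c hU hVS I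
    have hq1 := (hq.weight_mono (show p ≤ p + 1 by linarith) hT.le).rate_mono (β' := 1)
      zero_le_one hT.le
    have hHQ := ((xs_heatV (n := n) hT.le hμ hex (p + m + 1)).choose_spec.2 1 le_rfl _ p _ _ hp
      le_rfl hq1).1.rate_zero zero_le_one hT.le
    have hm3 : 2 ≤ m + 1 := by omega
    obtain ⟨C1, hq2⟩ := hq1.level_le hex hm2 hp hT.le
    obtain ⟨C2, hF2⟩ := (hF1 I).level_le hex hm3 hp hT.le
    obtain ⟨C3, hg2⟩ := (hg I).level_le hex hm3 hp hT.le
    have d1 := heatP_hasDerivWithinAt hμ hT.le hex hp hg2 ht x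
    have d2 := heatV_hasDerivWithinAt hμ hT.le hex le_rfl hp hF2 ht x
    have d3 := heatV_hasDerivWithinAt hμ hT.le hex le_rfl hp hq2 ht x
    have e : V I t = fun y => (heatP μ T (g I) t y + heatV μ T (F I) t y)
        - heatV μ T (quad c U V I) t y := funext fun y => hVeq I t ht y
    have cP := (hHP I).contDiff_two hex hm3 hp ht
    have cV := (hHV I).contDiff_two hex hm3 hp ht
    have hl : lap (V I t) x = lap (heatP μ T (g I) t) x + lap (heatV μ T (F I) t) x
        - lap (heatV μ T (quad c U V I) t) x := by
      rw [e, lap_sub (cP.add cV) (hHQ.contDiff_two hex hm2 hp ht), lap_add cP cV]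
    have d := ((d1.add d2).sub d3).congr (f₁ := fun τ => V I τ x)
      (fun τ hτ => hVeq I τ hτ x) (hVeq I t ht x)
    rw [hl]
    exact d.congr_deriv (by ring)

end perturb

/-! ### The spaces of the theorem -/

section spaces

variable {q s k : ℕ} {T lam lam' δ μ : ℝ}

lemma xs_of_eFn (h1 : 0 < lam) (h2 : lam < lam') (h3 : lam' < 1) (hδ : 0 ≤ δ) (hT : 0 < T)
    {N : ℝ} (hN : 0 ≤ N) {v : ℝ → Spc n → ℝ} (hv : XT T (topEx lam lam') s (2 * s + k + 1) δ v)
    (h : eFn T k s lam lam' δ v ≤ ENNReal.ofReal N) :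
    XS T 0 (topEx lam lam') (2 * s + k + 1) δ
      ((8 + 2 ^ (δ + (2 * s + k + 1 : ℕ) + 1)) * N) v := by
  have hex := goodEx_topEx h1 h2 h3
  have hc : ∀ j ≤ s, ∀ t ∈ Set.Icc 0 T,
      ContDiff ℝ (2 * s + k + 1 - 2 * j : ℕ) fun x => tDeriv T j v t x := fun j hj t ht =>
    have ⟨_, hC⟩ := (hv.tDeriv hex hT hδ hj (by omega)).2
    hC.contDiff hex hδ ht
  simpa [tDeriv_zero] using xs_tDeriv h1 h2 h3 hδ hN hc h (Nat.zero_le s)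

lemma FMemF.xt (h1 : 0 < lam) (h2 : lam < lam') (h3 : lam' < 1) (hδ : 0 ≤ δ) (hT : 0 < T)
    {u : FormT n q} (hu : FMemF T k s lam lam' δ u) (I : Idx n q) :
    XT T (topEx lam lam') s (2 * s + k + 1) δ (u I) := by
  have hle : eFn T k s lam lam' δ (u I) ≤ ENNReal.ofReal (eFF T k s lam lam' δ u).toReal := by
    rw [ENNReal.ofReal_toReal hu.2]
    exact Finset.single_le_sum (f := fun I => eFn T k s lam lam' δ (u I))
      (fun _ _ => zero_le) (Finset.mem_univ I)
  exact XT.of_tDeriv hT (hu.1 I).1 fun l hl _ => ⟨_, xs_tDeriv h1 h2 h3 hδ ENNReal.toReal_nonneg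
    (fun j hj t ht => (hu.1 I).contDiff_tDeriv hj ht) hle hl⟩

lemma fMemF_of_xt (h1 : 0 < lam) (h2 : lam < lam') (h3 : lam' < 1) (hδ : 0 ≤ δ) (hT : 0 < T)
    {u : FormT n q} (hu : ∀ I, XT T (topEx lam lam') s (2 * s + k + 1) δ (u I)) :
    FMemF T k s lam lam' δ u := by
  have hex := goodEx_topEx h1 h2 h3
  have hj := fun I j (hj : j ≤ s) => (hu I).tDeriv hex hT hδ hj (by omega)
  exact ⟨fun I => anisoReg_of_xs h1 h2 h3 hδ (hj I s le_rfl).1 fun j h => (hj I j h).2,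
    ENNReal.sum_ne_top.2 fun I _ => eFn_ne_top h1 h2 h3 hδ hT.le fun j h => (hj I j h).2⟩

/-- A solution of the Cauchy problem is a solution of a heat equation with quadratic
right hand side. -/
lemma CauchySol.hasDerivAt (hs : 1 ≤ s) {M₁ : M1Type n q} {M₂ : M2Type n q}
    {c : Idx n q → Fin n → Idx n q → Idx n q → ℝ} {u f : FormT n q} {u₀ : FormS n q}
    (hc : ∀ (u : FormT n q) (t : ℝ) (x : Spc n),
      (∀ I, DifferentiableAt ℝ (u I t) x) → ∀ K, Nop M₁ M₂ u K t x = bil c u u K t x)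
    (hu : FMemF T k s lam lam' δ u) (hd : ∀ I, ∀ t ∈ Set.Icc 0 T, Differentiable ℝ (u I t))
    (hsol : CauchySol T μ u (Nop M₁ M₂ u) f u₀) (I : Idx n q) {t : ℝ} (ht : t ∈ Set.Ioo 0 T)
    (x : Spc n) : HasDerivAt (fun τ => u I τ x)
      (μ * lap (u I t) x - bil c u u I t x + f I t x) t := by
  have h := hsol.1 I t ht x
  rw [hc u t x fun J => hd J t (Set.Ioo_subset_Icc_self ht) x] at h
  have hdiff : DifferentiableAt ℝ (fun τ => u I τ x) t :=
    (((hu.1 I).1 x).differentiableOn (by exact_mod_cast (by omega : s ≠ 0))).differentiableAt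
      (Icc_mem_nhds ht.1 ht.2)
  refine hdiff.hasDerivAt.congr_deriv ?_
  change deriv (fun τ => u I τ x) t - μ * lap (u I t) x + _ = _ at h
  linarith

end spaces

/-- openness of the solvable data set for the Navier–Stokes type problem
without pressure (`a = 0`). -/
theorem stmt18 (n q s k : ℕ) (hn : 2 ≤ n) (hq : q ≤ n) (hs : 1 ≤ s) (hk : 1 ≤ k)
    (lam lam' δ μ T : ℝ) (h1 : 0 < lam) (h2 : lam < lam') (h3 : lam' < 1)
    (hδ : (n : ℝ) / 2 < δ) (hμ : 0 < μ) (hT : 0 < T)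
    (M₁ : M1Type n q) (M₂ : M2Type n q)
    (f0 : FormT n q) (u00 : FormS n q) (u0 : FormT n q)
    (hf0 : FMemF T k s lam lam' δ f0) (hu00 : HolMemF (2 * s + k + 1) lam δ u00)
    (hu0 : FMemF T k s lam lam' δ u0)
    (hsol : CauchySol T μ u0 (Nop M₁ M₂ u0) f0 u00) :
    ∃ ε : ℝ, 0 < ε ∧
      ∀ (f : FormT n q) (u₀ : FormS n q),
        FMemF T k s lam lam' δ f → HolMemF (2 * s + k + 1) lam δ u₀ →
        eFF T k s lam lam' δ (f - f0) + eHolSF (2 * s + k + 1) lam δ (u₀ - u00) <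
          ENNReal.ofReal ε →
        ∃ u : FormT n q, FMemF T k s lam lam' δ u ∧
          CauchySol T μ u (Nop M₁ M₂ u) f u₀ ∧
          ∀ u' : FormT n q, FMemF T k s lam lam' δ u' →
            CauchySol T μ u' (Nop M₁ M₂ u') f u₀ → EqOnT T u' u := by
  have hδ0 : 0 < δ := by
    have : (2 : ℝ) ≤ n := by exact_mod_cast hn
    linarith
  have hex := goodEx_topEx h1 h2 h3
  have hm : topEx lam lam' (2 * s + k + 1) = topEx lam lam' (2 * s + k) := by
    simp [topEx, show ¬(s = 0 ∧ k = 0) by omega]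
  have hm2 : 2 ≤ 2 * s + k := by omega
  obtain ⟨c, hc⟩ := exists_Nop_eq_bil M₁ M₂
  have hxt := fun {v : FormT n q} (hv : FMemF T k s lam lam' δ v) => hv.xt h1 h2 h3 hδ0.le hT
  have huni := fun {v : FormT n q} (hv : FMemF T k s lam lam' δ v) =>
    XS.exists_uniform hT.le fun I => (hxt hv I).xs
  obtain ⟨A, hA⟩ := huni hu0
  have hd0 := fun I => (hA I).diff
  obtain ⟨r, hr, hpert⟩ := exists_perturb hT hμ hex hδ0.le hm hm2 c hA
  set K : ℝ := 8 + 2 ^ (δ + (2 * s + k + 1 : ℕ) + 1) with hK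
  have hK0 : 0 < K := by positivity
  refine ⟨r / K, by positivity, fun f u₀ hf hu₀ hlt => ?_⟩
  have hKr : K * (r / K) = r := by field_simp
  have hF : ∀ I, XT T (topEx lam lam') s (2 * s + k + 1) δ ((f - f0) I) := fun I =>
    ((hxt hf I).add ((hxt hf0 I).const_mul (-1))).congr fun t _ x => by
      simp only [Pi.sub_apply]
      ring
  have hFr : ∀ I, XS T 0 (topEx lam lam') (2 * s + k + 1) δ r ((f - f0) I) := fun I => by
    rw [← hKr]
    refine xs_of_eFn h1 h2 h3 hδ0.le hT (by positivity) (hF I) (le_trans ?_ hlt.le)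
    exact le_add_right (Finset.single_le_sum (f := fun I => eFn T k s lam lam' δ ((f - f0) I))
      (fun _ _ => zero_le) (Finset.mem_univ I))
  have hgr : ∀ I, XS T 0 (topEx lam lam') (2 * s + k + 1) δ r fun _ => (u₀ - u00) I := fun I => by
    rw [← hKr]
    refine xs_of_eHolS h1 h2 h3 hδ0.le (by positivity) ((hu₀.1 I).sub (hu00.1 I))
      (le_trans ?_ hlt.le)
    exact le_add_left (Finset.single_le_sum
      (f := fun I => eHolS (2 * s + k + 1) lam δ ((u₀ - u00) I))
      (fun _ _ => zero_le) (Finset.mem_univ I))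
  obtain ⟨V, hV, hV0, hVd⟩ := hpert _ _ hFr hgr
  have hVxt := XT.bootstrap hex hT.le hδ0.le μ c (hxt hu0) hF hV hVd
  obtain ⟨B, hB⟩ := XS.exists_uniform hT.le hV
  have hu : FMemF T k s lam lam' δ (fun I t x => u0 I t x + V I t x) :=
    fMemF_of_xt h1 h2 h3 hδ0.le hT fun I => (hxt hu0 I).add (hVxt I)
  obtain ⟨A', hA'⟩ := huni hu
  have hdu := fun I => (hA' I).diff
  have hu_sol : CauchySol T μ (fun I t x => u0 I t x + V I t x)
      (Nop M₁ M₂ fun I t x => u0 I t x + V I t x) f u₀ := by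
    refine ⟨fun I t ht x => ?_, fun I x => ?_⟩
    · have ht' := Set.Ioo_subset_Icc_self ht
      have hq := quad_eq_sub c (W := fun I t x => u0 I t x + V I t x)
        (fun J => hd0 J t ht' x) (fun J => hdu J t ht' x) I
      simp only [add_sub_cancel_left] at hq
      have d := (hsol.hasDerivAt hs hc hu0 hd0 I ht x).add
        ((hVd I t ht' x).hasDerivAt (Icc_mem_nhds ht.1 ht.2))
      have hl := lap_add ((hA I).contDiff_two hex (by omega) hδ0.le ht')
        ((hB I).contDiff_two hex (by omega) hδ0.le ht') x
      rw [hc (fun I t x => u0 I t x + V I t x) t x fun J => hdu J t ht' x, hl]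
      refine (congrArg (fun z => z - _ + _) d.deriv).trans ?_
      have hq' : quad c u0 V I t x = _ := hq
      simp only [hq', Pi.sub_apply]
      ring
    · simp [hsol.2 I x, hV0 I x]
  refine ⟨_, hu, hu_sol, fun u' hu' hu'_sol I t ht x => ?_⟩
  obtain ⟨A'', hA''⟩ := huni hu'
  have hdu' := fun I => (hA'' I).diff
  refine sub_eq_zero.1 (perturb_unique hT hμ hex hδ0 hm hm2 c hA'
    (fun I => (hA'' I).sub (hA' I)) (fun I t ht x => ?_) (fun I x => ?_) I t ht x)
  · have ht' := Set.Ioo_subset_Icc_self ht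
    have d := (hu'_sol.hasDerivAt hs hc hu' hdu' I ht x).sub
      (hu_sol.hasDerivAt hs hc hu hdu I ht x)
    refine d.congr_deriv ?_
    rw [quad_eq_sub c (fun J => hdu J t ht' x) (fun J => hdu' J t ht' x) I,
      lap_sub ((hA'' I).contDiff_two hex (by omega) hδ0.le ht')
        ((hA' I).contDiff_two hex (by omega) hδ0.le ht')]
    ring
  · exact sub_eq_zero.2 ((hu'_sol.2 I x).trans (hu_sol.2 I x).symm)
end NSdeRham

end
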